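/- If the finite alphabet A ⊆ ℕ (with |A| ≥ 2) satisfies δ_A > 7/8, then the set of denominators arising from A has positive proportion: there exist a constant c > 0 and N₀ such that #D_A(N) ≥ c·N for all N ≥ N₀. -/

import Mathlib

/-- Value of the finite continued fraction `[d₁, d₂, …, d_k] = 1/(d₁ + 1/(d₂ + ⋯ + 1/d_k))`. -/
def cfValue : List ℕ → ℚ
  | [] => 0
  | d :: l => 1 / ((d : ℚ) + cfValue l)

/-- `R_A`: rationals admitting a finite continued fraction expansion with all
partial quotients in the alphabet `A`. -/
def Rset (A : Finset ℕ) : Set ℚ :=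
  {x | ∃ l : List ℕ, l ≠ [] ∧ (∀ d ∈ l, d ∈ A) ∧ cfValue l = x}

/-- `D_A(N)`: denominators `d ≤ N` of fractions `b/d ∈ R_A` with `gcd(b,d) = 1`. -/
def Dset (A : Finset ℕ) (N : ℕ) : Set ℕ :=
  {d | d ≤ N ∧ ∃ b : ℕ, Nat.gcd b d = 1 ∧ ((b : ℚ) / (d : ℚ)) ∈ Rset A}

/-- Iterates of the Gauss map (complete quotients, as remainders): `x₀ = x`,
`x_{n+1} = 1/x_n - ⌊1/x_n⌋`. -/
noncomputable def gaussIter (x : ℝ) : ℕ → ℝ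
  | 0 => x
  | n + 1 => 1 / gaussIter x n - ⌊1 / gaussIter x n⌋₊

/-- `E_A`: irrationals in `(0,1)` whose infinite continued fraction expansion has all
partial quotients `a_{n+1} = ⌊1/x_n⌋` in the alphabet `A`. -/
noncomputable def Eset (A : Finset ℕ) : Set ℝ :=
  {x | x ∈ Set.Ioo (0 : ℝ) 1 ∧ Irrational x ∧ ∀ n : ℕ, ⌊1 / gaussIter x n⌋₊ ∈ A}

/-- The continuant matrix of a word: the product of the matrices `(0 1; 1 d)` over its letters. -/
def contMat (w : List ℕ) : Matrix (Fin 2) (Fin 2) ℤ :=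
  (w.map fun d => !![0, 1; 1, (d : ℤ)]).prod

/-- The continuant of a word, as a natural number. -/
def den (w : List ℕ) : ℕ := (contMat w 1 1).toNat

/-- The continuant of a word without its first letter (zero for the empty word). -/
def num (w : List ℕ) : ℕ := (contMat w 0 1).toNat

lemma contMat_cons (d : ℕ) (w : List ℕ) :
    contMat (d :: w) = !![0, 1; 1, (d : ℤ)] * contMat w := by
  simp [contMat]

lemma contMat_append (v w : List ℕ) : contMat (v ++ w) = contMat v * contMat w := by
  simp [contMat]

lemma contMat_reverse (w : List ℕ) : contMat w.reverse = (contMat w).transpose := by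
  induction w with
  | nil => simp [contMat]
  | cons d w ih =>
    rw [List.reverse_cons, contMat_append, ih, contMat_cons d w, Matrix.transpose_mul]
    congr 1
    ext i j
    fin_cases i <;> fin_cases j <;> simp [contMat]

lemma contMat_cons_apply (d : ℕ) (w : List ℕ) :
    contMat (d :: w) 0 0 = contMat w 1 0 ∧ contMat (d :: w) 0 1 = contMat w 1 1 ∧
    contMat (d :: w) 1 0 = contMat w 0 0 + d * contMat w 1 0 ∧
    contMat (d :: w) 1 1 = contMat w 0 1 + d * contMat w 1 1 := by
  simp [contMat_cons, Matrix.mul_apply, Fin.sum_univ_two]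

lemma contMat_det (w : List ℕ) :
    contMat w 0 0 * contMat w 1 1 - contMat w 0 1 * contMat w 1 0 = 1 ∨
    contMat w 0 0 * contMat w 1 1 - contMat w 0 1 * contMat w 1 0 = -1 := by
  induction w with
  | nil => simp [contMat]
  | cons d w ih =>
    obtain ⟨h1, h2, h3, h4⟩ := contMat_cons_apply d w
    rw [h1, h2, h3, h4]
    rcases ih with h | h
    · right; linear_combination -h
    · left; linear_combination -h

lemma contMat_nonneg (w : List ℕ) (i j : Fin 2) : 0 ≤ contMat w i j := by
  induction w generalizing i j with
  | nil => fin_cases i <;> fin_cases j <;> simp [contMat]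
  | cons d w ih =>
    obtain ⟨h1, h2, h3, h4⟩ := contMat_cons_apply d w
    have := ih 0 0; have := ih 0 1; have := ih 1 0; have := ih 1 1
    fin_cases i <;> fin_cases j <;> simp only [Fin.zero_eta, Fin.mk_one, Fin.isValue] <;>
      first | rw [h1] | rw [h2] | rw [h3] | rw [h4]
    all_goals positivity

lemma den_cast (w : List ℕ) : (den w : ℤ) = contMat w 1 1 :=
  Int.toNat_of_nonneg (contMat_nonneg w 1 1)

lemma num_cast (w : List ℕ) : (num w : ℤ) = contMat w 0 1 :=
  Int.toNat_of_nonneg (contMat_nonneg w 0 1)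

lemma den_nil : den [] = 1 := by simp [den, contMat]

lemma num_nil : num [] = 0 := by simp [num, contMat]

lemma den_cons (d : ℕ) (w : List ℕ) : den (d :: w) = num w + d * den w := by
  have h := (contMat_cons_apply d w).2.2.2
  rw [← den_cast, ← den_cast, ← num_cast] at h
  exact_mod_cast h

lemma num_cons (d : ℕ) (w : List ℕ) : num (d :: w) = den w := by
  have h := (contMat_cons_apply d w).2.1
  rw [← den_cast, ← num_cast] at h
  exact_mod_cast h

lemma den_reverse (w : List ℕ) : den w.reverse = den w := by
  simp [den, contMat_reverse]

lemma num_reverse_cast (w : List ℕ) : (num w.reverse : ℤ) = contMat w 1 0 := by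
  rw [num_cast, contMat_reverse]; rfl

lemma den_append (v w : List ℕ) :
    den (v ++ w) = num v.reverse * num w + den v * den w := by
  zify
  rw [den_cast, num_reverse_cast, num_cast, den_cast, den_cast, contMat_append, Matrix.mul_apply,
    Fin.sum_univ_two]

lemma coprime_num_den (w : List ℕ) : Nat.Coprime (num w) (den w) := by
  rw [← Nat.isCoprime_iff_coprime, num_cast, den_cast]
  rcases contMat_det w with h | h
  · exact ⟨-contMat w 1 0, contMat w 0 0, by linear_combination h⟩
  · exact ⟨contMat w 1 0, -contMat w 0 0, by linear_combination -h⟩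

lemma one_le_den {w : List ℕ} (hw : 0 ∉ w) : 1 ≤ den w := by
  induction w with
  | nil => simp [den_nil]
  | cons d w ih =>
    simp only [List.mem_cons, not_or] at hw
    have := ih hw.2
    rw [den_cons]
    have : 1 ≤ d := by omega
    nlinarith

lemma num_le_den {w : List ℕ} (hw : 0 ∉ w) : num w ≤ den w := by
  cases w with
  | nil => simp [den_nil, num_nil]
  | cons d w =>
    simp only [List.mem_cons, not_or] at hw
    rw [den_cons, num_cons]
    have : 1 ≤ d := by omega
    nlinarith

lemma one_le_num {w : List ℕ} (hw : 0 ∉ w) (hne : w ≠ []) : 1 ≤ num w := by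
  cases w with
  | nil => simp at hne
  | cons d w =>
    simp only [List.mem_cons, not_or] at hw
    rw [num_cons]
    exact one_le_den hw.2

lemma contMat_apply_zero_zero_le {w : List ℕ} (hw : 0 ∉ w) : contMat w 0 0 ≤ contMat w 1 1 := by
  cases w with
  | nil => simp [contMat]
  | cons d w =>
    obtain ⟨h1, h2, h3, h4⟩ := contMat_cons_apply d w
    have h := num_le_den (w := w.reverse) (by
      simp only [List.mem_cons, not_or] at hw; simpa using hw.2)
    zify at h
    rw [num_reverse_cast, den_reverse, den_cast] at h
    have h5 := one_le_den hw
    have h6 := num_le_den hw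
    zify at h5 h6
    rw [den_cast] at h5
    rw [num_cast, den_cast] at h6
    linarith

lemma contMat_le_den {w : List ℕ} (hw : 0 ∉ w) (i j : Fin 2) : contMat w i j ≤ den w := by
  have h1 := num_le_den hw
  have h2 := num_le_den (w := w.reverse) (by simpa using hw)
  have h3 := contMat_apply_zero_zero_le hw
  zify at h1 h2
  rw [num_cast, den_cast] at h1
  rw [num_reverse_cast, den_reverse, den_cast] at h2
  rw [den_cast]
  fin_cases i <;> fin_cases j <;> simp_all

lemma one_le_contMat {w : List ℕ} (hw : 0 ∉ w) (hl : 2 ≤ w.length) (i j : Fin 2) :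
    1 ≤ contMat w i j := by
  have hne : w ≠ [] := by rintro rfl; simp at hl
  have h1 := one_le_num hw hne
  have h2 := one_le_num (w := w.reverse) (by simpa using hw) (by simpa using hne)
  have h3 := one_le_den hw
  have h4 : 1 ≤ contMat w 0 0 := by
    cases w with
    | nil => simp at hne
    | cons d w =>
      rw [(contMat_cons_apply d w).1, ← num_reverse_cast]
      simp only [List.mem_cons, not_or] at hw
      have hne' : w ≠ [] := by rintro rfl; simp at hl
      exact_mod_cast one_le_num (w := w.reverse) (by simpa using hw.2) (by simpa using hne')
  zify at h1 h2 h3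
  rw [num_cast] at h1
  rw [num_reverse_cast] at h2
  rw [den_cast] at h3
  fin_cases i <;> fin_cases j <;> assumption

lemma den_append_bounds {v w : List ℕ} (hv : 0 ∉ v) (hw : 0 ∉ w) :
    den v * den w ≤ den (v ++ w) ∧ den (v ++ w) ≤ 2 * (den v * den w) := by
  have h1 := num_le_den hw
  have h2 := num_le_den (w := v.reverse) (by simpa using hv)
  rw [den_reverse] at h2
  have h3 := Nat.mul_le_mul h2 h1
  rw [den_append]
  omega

lemma two_pow_le_den {w : List ℕ} (hw : 0 ∉ w) : 2 ^ (w.length / 2) ≤ den w := by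
  induction w using List.twoStepInduction with
  | nil => simp [den_nil]
  | singleton d => simpa using one_le_den hw
  | cons_cons x y w ih _ =>
    simp only [List.mem_cons, not_or] at hw
    have h := ih hw.2.2
    have hl : (x :: y :: w).length / 2 = w.length / 2 + 1 := by simp only [List.length_cons]; omega
    rw [hl, pow_succ, den_cons, num_cons, den_cons]
    have hx : 1 ≤ x := by omega
    have hy : 1 ≤ y := by omega
    have : den w ≤ num w + y * den w := by nlinarith
    nlinarith

/-- Words of equal length without zero letters are determined by the last column of their
continuant matrix. -/
lemma eq_of_num_den {v w : List ℕ} (hv : 0 ∉ v) (hw : 0 ∉ w) (hl : v.length = w.length)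
    (hn : num v = num w) (hd : den v = den w) : v = w := by
  induction v generalizing w with
  | nil => exact (List.length_eq_zero_iff.mp (by simpa using hl.symm)).symm
  | cons x v ih =>
    cases w with
    | nil => simp at hl
    | cons y w =>
      simp only [List.mem_cons, not_or] at hv hw
      simp only [List.length_cons, Nat.add_right_cancel_iff] at hl
      rw [num_cons, num_cons] at hn
      rw [den_cons, den_cons, ← hn] at hd
      have hpos := one_le_den hv.2
      have hxy : x = y ∧ num v = num w := by
        rcases v.eq_nil_or_concat' with rfl | hv0
        · have : w = [] := List.length_eq_zero_iff.mp (by simpa using hl.symm)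
          subst this
          simpa [num_nil, den_nil] using hd
        · have hvne : v ≠ [] := by rintro rfl; simp at hv0
          have hwne : w ≠ [] := by
            rintro rfl; exact hvne (List.length_eq_zero_iff.mp (by simpa using hl))
          have a1 := one_le_num hv.2 hvne
          have a2 := one_le_num hw.2 hwne
          have b1 := num_le_den hv.2
          have b2 := num_le_den hw.2
          rw [← hn] at b2
          have : x = y := by
            rcases lt_trichotomy x y with h | h | h
            · exfalso; nlinarith
            · exact h
            · exfalso; nlinarith
          subst this
          exact ⟨rfl, by omega⟩
      rw [hxy.1, ih hv.2 hw.2 hl hxy.2 hn]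

open ZMod in
lemma sum_stdAddChar_mul {P : ℕ} [NeZero P] (t : ZMod P) :
    ∑ x : ZMod P, stdAddChar (t * x) = if t = 0 then (P : ℂ) else 0 := by
  have := AddChar.sum_mulShift t (isPrimitive_stdAddChar P)
  simp only [mul_comm _ t, ZMod.card] at this
  rw [this]; split_ifs <;> simp

open ZMod in
lemma conj_stdAddChar {P : ℕ} [NeZero P] (t : ZMod P) :
    (starRingEnd ℂ) (stdAddChar t) = stdAddChar (-t) := by
  rw [AddChar.map_neg_eq_conj]

open ZMod in
/-- Orthogonality in two variables. -/
lemma sum_stdAddChar_pair {P : ℕ} [NeZero P] (k : ZMod P × ZMod P) :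
    ∑ x : ZMod P × ZMod P, stdAddChar (k.1 * x.1 + k.2 * x.2)
      = if k = 0 then (P : ℂ) ^ 2 else 0 := by
  rw [Fintype.sum_prod_type]
  simp only [AddChar.map_add_eq_mul, ← Finset.mul_sum, sum_stdAddChar_mul, ← Finset.sum_mul]
  by_cases h1 : k.1 = 0 <;> by_cases h2 : k.2 = 0 <;> simp [h1, h2, Prod.ext_iff, sq]

/-- Schur bound for a symmetric nonnegative kernel given by coincidences. -/
lemma schur_bound {ι κ : Type*} [DecidableEq κ] (I : Finset ι) (a : ι → ℝ) (k : ι → κ) (B : ℝ)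
    (hB : ∀ i ∈ I, ((I.filter fun i' => k i' = k i).card : ℝ) ≤ B) :
    ∑ i ∈ I, ∑ i' ∈ I, (if k i = k i' then a i * a i' else 0) ≤ B * ∑ i ∈ I, a i ^ 2 := by
  have h1 : ∀ i ∈ I, ∀ i' ∈ I, (if k i = k i' then a i * a i' else 0) ≤
      (if k i' = k i then a i ^ 2 / 2 else 0) + (if k i = k i' then a i' ^ 2 / 2 else 0) := by
    intro i _ i' _
    by_cases h : k i = k i'
    · simp only [h, if_true]; nlinarith [sq_nonneg (a i - a i')]
    · simp [h, Ne.symm h]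
  have h2 : ∑ i ∈ I, ∑ i' ∈ I, (if k i' = k i then a i ^ 2 / 2 else 0)
      ≤ B * ∑ i ∈ I, a i ^ 2 / 2 := by
    rw [Finset.mul_sum]
    refine Finset.sum_le_sum fun i hi => ?_
    rw [← Finset.sum_filter, Finset.sum_const, nsmul_eq_mul]
    exact mul_le_mul_of_nonneg_right (hB i hi) (by positivity)
  calc _ ≤ ∑ i ∈ I, ∑ i' ∈ I, ((if k i' = k i then a i ^ 2 / 2 else 0)
        + (if k i = k i' then a i' ^ 2 / 2 else 0)) :=
        Finset.sum_le_sum fun i hi => Finset.sum_le_sum fun i' hi' => h1 i hi i' hi'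
    _ = 2 * ∑ i ∈ I, ∑ i' ∈ I, (if k i' = k i then a i ^ 2 / 2 else 0) := by
        simp only [Finset.sum_add_distrib]
        rw [Finset.sum_comm (f := fun i i' => if k i = k i' then a i' ^ 2 / 2 else 0)]
        ring
    _ ≤ 2 * (B * ∑ i ∈ I, a i ^ 2 / 2) := by linarith
    _ = _ := by rw [← Finset.sum_div]; ring

open ZMod in
lemma sum_norm_sq_trig_le {P : ℕ} [NeZero P] {ι : Type*} (I : Finset ι) (c : ι → ℂ)
    (k : ι → ZMod P × ZMod P) (B : ℝ)
    (hB : ∀ i ∈ I, ((I.filter fun i' => k i' = k i).card : ℝ) ≤ B) :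
    ∑ x : ZMod P × ZMod P, ‖∑ i ∈ I, c i * stdAddChar ((k i).1 * x.1 + (k i).2 * x.2)‖ ^ 2
      ≤ (P : ℝ) ^ 2 * (B * ∑ i ∈ I, ‖c i‖ ^ 2) := by
  have hexp : ((∑ x : ZMod P × ZMod P,
      ‖∑ i ∈ I, c i * stdAddChar ((k i).1 * x.1 + (k i).2 * x.2)‖ ^ 2 : ℝ) : ℂ)
      = (P : ℂ) ^ 2 * ∑ i ∈ I, ∑ i' ∈ I,
        (if k i = k i' then c i * (starRingEnd ℂ) (c i') else 0) := by
    push_cast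
    simp only [← Complex.mul_conj', map_sum, map_mul, conj_stdAddChar, Finset.sum_mul_sum]
    rw [Finset.sum_comm, Finset.mul_sum]
    refine Finset.sum_congr rfl fun i _ => ?_
    rw [Finset.sum_comm, Finset.mul_sum]
    refine Finset.sum_congr rfl fun i' _ => ?_
    have h := sum_stdAddChar_pair (k i - k i')
    simp only [sub_eq_zero] at h
    have h3 : ∀ x : ZMod P × ZMod P,
        c i * stdAddChar ((k i).1 * x.1 + (k i).2 * x.2) *
        ((starRingEnd ℂ) (c i') * stdAddChar (-((k i').1 * x.1 + (k i').2 * x.2)))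
        = c i * (starRingEnd ℂ) (c i') *
          stdAddChar ((k i - k i').1 * x.1 + (k i - k i').2 * x.2) := by
      intro x
      have : (k i - k i').1 * x.1 + (k i - k i').2 * x.2
          = ((k i).1 * x.1 + (k i).2 * x.2) + (-((k i').1 * x.1 + (k i').2 * x.2)) := by
        simp only [Prod.fst_sub, Prod.snd_sub]; ring
      rw [this]
      generalize (k i).1 * x.1 + (k i).2 * x.2 = a
      generalize -((k i').1 * x.1 + (k i').2 * x.2) = b
      rw [AddChar.map_add_eq_mul]; ring
    simp only [h3, ← Finset.mul_sum, h]
    split_ifs <;> ring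
  have hre := congrArg Complex.re hexp
  rw [Complex.ofReal_re] at hre
  rw [hre]
  have hP : ((P : ℂ) ^ 2) = (((P : ℝ) ^ 2 : ℝ) : ℂ) := by push_cast; rfl
  rw [hP, Complex.re_ofReal_mul]
  refine mul_le_mul_of_nonneg_left ?_ (by positivity)
  refine le_trans ?_ (schur_bound I (fun i => ‖c i‖) k B hB)
  rw [Complex.re_sum]
  refine Finset.sum_le_sum fun i _ => ?_
  rw [Complex.re_sum]
  refine Finset.sum_le_sum fun i' _ => ?_
  split_ifs
  · refine (Complex.re_le_norm _).trans ?_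
    rw [norm_mul, RCLike.norm_conj]
  · simp

open ZMod in
lemma half_le_norm_sum_stdAddChar {P : ℕ} [NeZero P] {J n : ℕ} (h : 8 * J * n ≤ P) :
    (J : ℝ) / 2 ≤ ‖∑ u ∈ Finset.range J, (stdAddChar ((u : ZMod P) * (n : ZMod P)) : ℂ)‖ := by
  refine le_trans ?_ (Complex.re_le_norm _)
  rw [Complex.re_sum]
  have : ∀ u ∈ Finset.range J,
      (1 / 2 : ℝ) ≤ (stdAddChar ((u : ZMod P) * (n : ZMod P)) : ℂ).re := by
    intro u hu
    have hu := Finset.mem_range.mp hu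
    have hP : (0 : ℝ) < P := by exact_mod_cast Nat.pos_of_ne_zero (NeZero.ne P)
    have h1 : ((u : ZMod P) * (n : ZMod P)) = (((u * n : ℕ) : ℤ) : ZMod P) := by push_cast; rfl
    rw [h1, stdAddChar_coe]
    have h2 : (2 * Real.pi * Complex.I * (((u * n : ℕ) : ℤ) : ℂ) / P)
        = ((2 * Real.pi * (u * n : ℕ) / P : ℝ) : ℂ) * Complex.I := by push_cast; ring
    rw [h2, Complex.exp_ofReal_mul_I_re, ← Real.cos_pi_div_three]
    have h3 : ((8 * (u * n) : ℕ) : ℝ) ≤ P := by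
      exact_mod_cast le_trans (by nlinarith [Nat.zero_le n, hu.le, Nat.mul_le_mul_right n hu.le]) h
    apply Real.cos_le_cos_of_nonneg_of_le_pi
    · positivity
    · linarith [Real.pi_pos]
    · rw [div_le_div_iff₀ hP (by norm_num)]
      push_cast at h3 ⊢
      nlinarith [Real.pi_pos]
  calc (J : ℝ) / 2 = ∑ u ∈ Finset.range J, (1 / 2 : ℝ) := by simp; ring
    _ ≤ _ := Finset.sum_le_sum this

/-- An element of `ℤ/P` represented by an integer of absolute value less than `J`. -/
def NearZero {P : ℕ} (J : ℕ) (z : ZMod P) : Prop := ∃ e : ℤ, |e| < J ∧ (e : ZMod P) = z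

lemma sum_mul_sum_mul_sum_sum {ι κ β : Type*} (r : Finset ι) (Θ : Finset κ) (Y : Finset β)
    (f g : ι → ℂ) (h : κ → β → ℂ) :
    (∑ u ∈ r, f u) * (∑ v ∈ r, g v) * ∑ j ∈ Θ, ∑ b ∈ Y, h j b
      = ∑ i ∈ (r ×ˢ r) ×ˢ (Θ ×ˢ Y), f i.1.1 * g i.1.2 * h i.2.1 i.2.2 := by
  rw [Finset.sum_mul_sum, ← Finset.sum_product', ← Finset.sum_product', Finset.sum_mul_sum,
    ← Finset.sum_product']

lemma large_sieve_rescale {J P T B E y : ℝ} (hJ : 0 < J)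
    (h : J ^ 4 / 16 * T ≤ P ^ 2 * (B * (J ^ 2 * y * E))) :
    T ≤ 16 * (P / J) ^ 2 * y * B * E := by
  have e : 16 * (P / J) ^ 2 * y * B * E = 16 / J ^ 4 * (P ^ 2 * (B * (J ^ 2 * y * E))) := by
    field_simp
  have e2 : T = 16 / J ^ 4 * (J ^ 4 / 16 * T) := by field_simp
  rw [e, e2]
  gcongr

open ZMod Classical in
/-- A large sieve inequality for bilinear exponential sums. -/
lemma bilinear_large_sieve {P : ℕ} [NeZero P] {α β : Type*} (X : Finset α) (Y : Finset β)
    (x₁ x₂ : α → ℕ) (y₁ y₂ : β → ZMod P) (Θ : Finset (ZMod P)) (J : ℕ) (hJ : 0 < J)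
    (hJP : J ≤ P)
    (hx₁ : ∀ a ∈ X, 8 * J * x₁ a ≤ P) (hx₂ : ∀ a ∈ X, 8 * J * x₂ a ≤ P)
    (hinj : Set.InjOn (fun a => (x₁ a, x₂ a)) (X : Set α)) (B : ℝ) (hB0 : 0 ≤ B)
    (hB : ∀ j ∈ Θ, ∀ b ∈ Y, (((Θ ×ˢ Y).filter fun p =>
      NearZero J (p.1 * y₁ p.2 - j * y₁ b) ∧ NearZero J (p.1 * y₂ p.2 - j * y₂ b)).card : ℝ) ≤ B) :
    ∑ j ∈ Θ, ‖∑ a ∈ X, ∑ b ∈ Y,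
        (stdAddChar (j * ((x₁ a : ZMod P) * y₁ b + (x₂ a : ZMod P) * y₂ b)) : ℂ)‖ ^ 2
      ≤ 16 * ((P : ℝ) / J) ^ 2 * X.card * Y.card * B := by
  set S : ZMod P → ℂ := fun j => ∑ a ∈ X, ∑ b ∈ Y,
    (stdAddChar (j * ((x₁ a : ZMod P) * y₁ b + (x₂ a : ZMod P) * y₂ b)) : ℂ) with hS
  set F : ZMod P × ZMod P → ℂ := fun x => ∑ j ∈ Θ, ∑ b ∈ Y,
    (starRingEnd ℂ) (S j) * stdAddChar (j * (x.1 * y₁ b + x.2 * y₂ b)) with hF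
  set D : ZMod P → ℂ := fun x => ∑ u ∈ Finset.range J, (stdAddChar ((u : ZMod P) * x) : ℂ) with hD
  set E := ∑ j ∈ Θ, ‖S j‖ ^ 2 with hE
  have hE0 : 0 ≤ E := Finset.sum_nonneg fun _ _ => by positivity
  have hJ' : (0 : ℝ) < J := by exact_mod_cast hJ
  -- duality
  have h1 : ((E : ℝ) : ℂ) = ∑ a ∈ X, F (x₁ a, x₂ a) := by
    rw [hE]; push_cast
    simp only [hF]
    rw [Finset.sum_comm]
    refine Finset.sum_congr rfl fun j _ => ?_
    simp only [← Finset.mul_sum]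
    rw [← Complex.conj_mul']
  have h2 : E ^ 2 ≤ X.card * ∑ a ∈ X, ‖F (x₁ a, x₂ a)‖ ^ 2 := by
    have : E ≤ ∑ a ∈ X, ‖F (x₁ a, x₂ a)‖ := by
      calc E = ‖((E : ℝ) : ℂ)‖ := by rw [Complex.norm_real, Real.norm_of_nonneg hE0]
        _ ≤ _ := by rw [h1]; exact norm_sum_le _ _
    calc E ^ 2 ≤ (∑ a ∈ X, ‖F (x₁ a, x₂ a)‖) ^ 2 := by gcongr
      _ ≤ _ := sq_sum_le_card_mul_sum_sq
  -- smoothing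
  have h3 : ∀ a ∈ X, (J : ℝ) ^ 4 / 16 * ‖F (x₁ a, x₂ a)‖ ^ 2
      ≤ ‖D (x₁ a) * D (x₂ a) * F (x₁ a, x₂ a)‖ ^ 2 := by
    intro a ha
    rw [norm_mul, norm_mul, mul_pow, mul_pow]
    have e1 := half_le_norm_sum_stdAddChar (hx₁ a ha)
    have e2 := half_le_norm_sum_stdAddChar (hx₂ a ha)
    have e1' : ((J : ℝ) / 2) ^ 2 ≤ ‖D (x₁ a)‖ ^ 2 := by gcongr
    have e2' : ((J : ℝ) / 2) ^ 2 ≤ ‖D (x₂ a)‖ ^ 2 := by gcongr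
    refine mul_le_mul_of_nonneg_right ?_ (by positivity)
    calc (J : ℝ) ^ 4 / 16 = ((J : ℝ) / 2) ^ 2 * ((J : ℝ) / 2) ^ 2 := by ring
      _ ≤ _ := by gcongr
  have h4 : ∑ a ∈ X, ‖D (x₁ a) * D (x₂ a) * F (x₁ a, x₂ a)‖ ^ 2
      ≤ ∑ x : ZMod P × ZMod P, ‖D x.1 * D x.2 * F x‖ ^ 2 := by
    have hlt : ∀ n : ℕ, 8 * J * n ≤ P → n < P := by
      intro n hn
      have := Nat.pos_of_ne_zero (NeZero.ne P)
      rcases Nat.eq_zero_or_pos n with h | h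
      · omega
      · nlinarith
    have hinj' : Set.InjOn (fun a => ((x₁ a : ZMod P), (x₂ a : ZMod P))) (X : Set α) := by
      intro a ha b hb hab
      simp only [Prod.mk.injEq] at hab
      apply hinj ha hb
      have q1 := (ZMod.natCast_eq_natCast_iff' _ _ _).mp hab.1
      have q2 := (ZMod.natCast_eq_natCast_iff' _ _ _).mp hab.2
      rw [Nat.mod_eq_of_lt (hlt _ (hx₁ a ha)), Nat.mod_eq_of_lt (hlt _ (hx₁ b hb))] at q1
      rw [Nat.mod_eq_of_lt (hlt _ (hx₂ a ha)), Nat.mod_eq_of_lt (hlt _ (hx₂ b hb))] at q2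
      simp [q1, q2]
    rw [← Finset.sum_image (f := fun x : ZMod P × ZMod P => ‖D x.1 * D x.2 * F x‖ ^ 2) hinj']
    exact Finset.sum_le_sum_of_subset_of_nonneg (Finset.subset_univ _)
      fun _ _ _ => by positivity
  -- the smoothed sum as a trigonometric sum
  set I := (Finset.range J ×ˢ Finset.range J) ×ˢ (Θ ×ˢ Y) with hI
  set k : (ℕ × ℕ) × (ZMod P × β) → ZMod P × ZMod P := fun i =>
    ((i.1.1 : ZMod P) + i.2.1 * y₁ i.2.2, (i.1.2 : ZMod P) + i.2.1 * y₂ i.2.2) with hk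
  have h5 : ∀ x : ZMod P × ZMod P, D x.1 * D x.2 * F x
      = ∑ i ∈ I, (starRingEnd ℂ) (S i.2.1) * stdAddChar ((k i).1 * x.1 + (k i).2 * x.2) := by
    intro x
    simp only [hD, hF]
    rw [sum_mul_sum_mul_sum_sum]
    refine Finset.sum_congr rfl fun i _ => ?_
    have : (k i).1 * x.1 + (k i).2 * x.2
        = (i.1.1 : ZMod P) * x.1 + ((i.1.2 : ZMod P) * x.2
          + i.2.1 * (x.1 * y₁ i.2.2 + x.2 * y₂ i.2.2)) := by
      simp only [hk]; ring
    rw [this, AddChar.map_add_eq_mul, AddChar.map_add_eq_mul]; ring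
  have h6 : ∀ i ∈ I, ((I.filter fun i' => k i' = k i).card : ℝ) ≤ B := by
    rintro ⟨⟨u, v⟩, ⟨j, b⟩⟩ hi
    simp only [hI, Finset.mem_product, Finset.mem_range] at hi
    refine le_trans ?_ (hB j hi.2.1 b hi.2.2)
    have hsmall : ∀ n m : ℕ, n < J → m < J → |(n : ℤ) - m| < J := by
      intro n m hn hm; rw [abs_lt]; constructor <;> omega
    have hcast : ∀ n m : ℕ, n < J → m < J → (n : ZMod P) = m → n = m := by
      intro n m hn hm h
      have := (ZMod.natCast_eq_natCast_iff' _ _ _).mp h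
      rwa [Nat.mod_eq_of_lt (by omega), Nat.mod_eq_of_lt (by omega)] at this
    norm_cast
    apply Finset.card_le_card_of_injOn (fun i => i.2)
    · rintro ⟨⟨u', v'⟩, ⟨j', b'⟩⟩ hi'
      simp only [hI, hk, Finset.coe_filter, Set.mem_ofPred_eq, Finset.mem_product, Finset.mem_range,
        Prod.mk.injEq] at hi'
      simp only [Finset.coe_filter, Set.mem_ofPred_eq, Finset.mem_product]
      refine ⟨hi'.1.2, ⟨(u : ℤ) - u', hsmall _ _ hi.1.1 hi'.1.1.1, ?_⟩,
        ⟨(v : ℤ) - v', hsmall _ _ hi.1.2 hi'.1.1.2, ?_⟩⟩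
      · push_cast; linear_combination -hi'.2.1
      · push_cast; linear_combination -hi'.2.2
    · rintro ⟨⟨u', v'⟩, ⟨j', b'⟩⟩ hi' ⟨⟨u'', v''⟩, ⟨j'', b''⟩⟩ hi'' heq
      simp only [hI, hk, Finset.coe_filter, Set.mem_ofPred_eq, Finset.mem_product, Finset.mem_range,
        Prod.mk.injEq] at hi' hi'' heq
      obtain ⟨rfl, rfl⟩ := heq
      have e1 := hcast u' u'' hi'.1.1.1 hi''.1.1.1 (by linear_combination hi'.2.1 - hi''.2.1)
      have e2 := hcast v' v'' hi'.1.1.2 hi''.1.1.2 (by linear_combination hi'.2.2 - hi''.2.2)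
      rw [e1, e2]
  have h7 := sum_norm_sq_trig_le I (fun i => (starRingEnd ℂ) (S i.2.1)) k B h6
  have h8 : ∑ i ∈ I, ‖(starRingEnd ℂ) (S i.2.1)‖ ^ 2 = (J : ℝ) ^ 2 * Y.card * E := by
    simp only [RCLike.norm_conj, hI]
    rw [Finset.sum_product]
    dsimp only
    rw [Finset.sum_const, Finset.sum_product, Finset.card_product, Finset.card_range]
    simp only [Finset.sum_const, nsmul_eq_mul, ← Finset.mul_sum]
    push_cast; ring
  rw [h8] at h7
  have h9 : (J : ℝ) ^ 4 / 16 * ∑ a ∈ X, ‖F (x₁ a, x₂ a)‖ ^ 2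
      ≤ (P : ℝ) ^ 2 * (B * ((J : ℝ) ^ 2 * Y.card * E)) := by
    rw [Finset.mul_sum]
    refine (Finset.sum_le_sum h3).trans (h4.trans ?_)
    simp only [h5]
    exact h7
  have h10 : ∑ a ∈ X, ‖F (x₁ a, x₂ a)‖ ^ 2 ≤ 16 * ((P : ℝ) / J) ^ 2 * Y.card * B * E :=
    large_sieve_rescale hJ' h9
  rcases hE0.eq_or_lt with h0 | h0
  · rw [← h0]; positivity
  · have h11 : E ^ 2 ≤ 16 * ((P : ℝ) / J) ^ 2 * X.card * Y.card * B * E := by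
      refine h2.trans ?_
      calc _ ≤ (X.card : ℝ) * (16 * ((P : ℝ) / J) ^ 2 * Y.card * B * E) := by gcongr
        _ = _ := by ring
    rw [sq] at h11
    exact le_of_mul_le_mul_right h11 h0

/-- A finite set of words of equal length without zero letters. -/
structure IsBlock (X : Finset (List ℕ)) : Prop where
  zero_notMem : ∀ w ∈ X, 0 ∉ w
  length_eq : ∀ v ∈ X, ∀ w ∈ X, v.length = w.length

/-- All concatenations of a word of `X` with a word of `Y`. -/
def cat (X Y : Finset (List ℕ)) : Finset (List ℕ) := Finset.image₂ (· ++ ·) X Y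

lemma mem_cat {X Y : Finset (List ℕ)} {w : List ℕ} :
    w ∈ cat X Y ↔ ∃ x ∈ X, ∃ y ∈ Y, x ++ y = w := by
  simp [cat, Finset.mem_image₂]

lemma IsBlock.cat {X Y : Finset (List ℕ)} (hX : IsBlock X) (hY : IsBlock Y) :
    IsBlock (cat X Y) := by
  constructor
  · intro w hw
    obtain ⟨x, hx, y, hy, rfl⟩ := mem_cat.mp hw
    simp [hX.zero_notMem x hx, hY.zero_notMem y hy]
  · intro w hw w' hw'
    obtain ⟨x, hx, y, hy, rfl⟩ := mem_cat.mp hw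
    obtain ⟨x', hx', y', hy', rfl⟩ := mem_cat.mp hw'
    simp [hX.length_eq x hx x' hx', hY.length_eq y hy y' hy']

lemma cat_assoc (X Y Z : Finset (List ℕ)) : cat (cat X Y) Z = cat X (cat Y Z) :=
  Finset.image₂_assoc fun a b c => List.append_assoc a b c

lemma IsBlock.injOn_append {X Y : Finset (List ℕ)} (hX : IsBlock X) :
    Set.InjOn (fun p : List ℕ × List ℕ => p.1 ++ p.2) ((X : Set (List ℕ)) ×ˢ (Y : Set (List ℕ))) := by
  rintro ⟨x, y⟩ h ⟨x', y'⟩ h' heq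
  have := List.append_inj heq (hX.length_eq x h.1 x' h'.1)
  exact Prod.ext this.1 this.2

lemma IsBlock.card_cat {X : Finset (List ℕ)} (hX : IsBlock X) (Y : Finset (List ℕ)) :
    (_root_.cat X Y).card = X.card * Y.card :=
  Finset.card_image₂_iff.mpr hX.injOn_append

lemma IsBlock.sum_cat {X : Finset (List ℕ)} (hX : IsBlock X) (Y : Finset (List ℕ))
    (f : List ℕ → ℂ) : ∑ w ∈ _root_.cat X Y, f w = ∑ x ∈ X, ∑ y ∈ Y, f (x ++ y) := by
  rw [← Finset.sum_product', _root_.cat, ← Finset.image_uncurry_product, Finset.sum_image]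
  · rfl
  · intro p hp p' hp' h
    exact hX.injOn_append (by simpa using hp) (by simpa using hp') h

open ZMod in
/-- The exponential sum over the continuants of a set of words. -/
noncomputable def wordSum (P : ℕ) [NeZero P] (Ω : Finset (List ℕ)) (j : ZMod P) : ℂ :=
  ∑ w ∈ Ω, (stdAddChar (j * (den w : ZMod P)) : ℂ)

open Classical in
lemma sum_norm_sq_wordSum_le {P : ℕ} [NeZero P] {X Y : Finset (List ℕ)} (hX : IsBlock X)
    {m : ℕ} (hm : 1 ≤ m) (hXm : ∀ x ∈ X, den x ≤ m) (hmP : 8 * m ≤ P)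
    (Θ : Finset (ZMod P)) {B : ℝ} (hB0 : 0 ≤ B)
    (hB : ∀ j ∈ Θ, ∀ y ∈ Y, (((Θ ×ˢ Y).filter fun p =>
      NearZero (P / (8 * m)) (p.1 * (num p.2 : ZMod P) - j * (num y : ZMod P)) ∧
      NearZero (P / (8 * m)) (p.1 * (den p.2 : ZMod P) - j * (den y : ZMod P))).card : ℝ) ≤ B) :
    ∑ j ∈ Θ, ‖wordSum P (cat X Y) j‖ ^ 2 ≤ 4096 * (m : ℝ) ^ 2 * (cat X Y).card * B := by
  have hJ : 0 < P / (8 * m) := Nat.div_pos hmP (by omega)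
  have hle : ∀ n : ℕ, n ≤ m → 8 * (P / (8 * m)) * n ≤ P := by
    intro n hn
    calc 8 * (P / (8 * m)) * n ≤ 8 * (P / (8 * m)) * m := by gcongr
      _ = P / (8 * m) * (8 * m) := by ring
      _ ≤ P := Nat.div_mul_le_self _ _
  have h := bilinear_large_sieve X Y (fun x => num x.reverse) den (fun y => (num y : ZMod P))
    (fun y => (den y : ZMod P)) Θ (P / (8 * m)) hJ (Nat.div_le_self _ _)
    (fun x hx => hle _ (le_trans (by
      have := num_le_den (w := x.reverse) (by simpa using hX.zero_notMem x hx)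
      rwa [den_reverse] at this) (hXm x hx)))
    (fun x hx => hle _ (hXm x hx)) (by
      intro x hx x' hx' heq
      simp only [Prod.mk.injEq] at heq
      rw [← List.reverse_inj]
      refine eq_of_num_den (by simpa using hX.zero_notMem x hx)
        (by simpa using hX.zero_notMem x' hx') (by simpa using hX.length_eq x hx x' hx') heq.1 ?_
      simpa [den_reverse] using heq.2) B hB0 hB
  have hS : ∀ j : ZMod P, wordSum P (cat X Y) j = ∑ x ∈ X, ∑ y ∈ Y,
      (ZMod.stdAddChar (j * ((num x.reverse : ZMod P) * (num y : ZMod P)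
        + (den x : ZMod P) * (den y : ZMod P))) : ℂ) := by
    intro j
    rw [wordSum, hX.sum_cat]
    simp only [den_append, Nat.cast_add, Nat.cast_mul]
  simp only [hS]
  refine h.trans ?_
  have h16 : (P : ℝ) / (P / (8 * m) : ℕ) ≤ 16 * m := by
    rw [div_le_iff₀ (by exact_mod_cast hJ)]
    have := Nat.lt_div_mul_add (a := P) (b := 8 * m) (by omega)
    have h2 : P ≤ 16 * m * (P / (8 * m)) := by nlinarith
    exact_mod_cast h2
  rw [hX.card_cat]
  have h17 : ((P : ℝ) / (P / (8 * m) : ℕ)) ^ 2 ≤ (16 * m) ^ 2 := by gcongr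
  push_cast
  calc _ ≤ 16 * (16 * (m : ℝ)) ^ 2 * X.card * Y.card * B := by gcongr
    _ = _ := by ring

/-- Parseval: the number of continuants is at least `|Ω|²` over the normalised energy. -/
lemma card_sq_mul_le {P : ℕ} [NeZero P] {Ω : Finset (List ℕ)} (h : ∀ w ∈ Ω, den w < P) :
    (P : ℝ) * (Ω.card : ℝ) ^ 2
      ≤ (Ω.image den).card * ∑ j : ZMod P, ‖wordSum P Ω j‖ ^ 2 := by
  classical
  have hexp : ((∑ j : ZMod P, ‖wordSum P Ω j‖ ^ 2 : ℝ) : ℂ)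
      = P * ∑ w ∈ Ω, ∑ w' ∈ Ω, (if den w = den w' then (1 : ℂ) else 0) := by
    push_cast
    simp only [← Complex.mul_conj', wordSum, map_sum, conj_stdAddChar, Finset.sum_mul_sum]
    rw [Finset.sum_comm, Finset.mul_sum]
    refine Finset.sum_congr rfl fun w hw => ?_
    rw [Finset.sum_comm, Finset.mul_sum]
    refine Finset.sum_congr rfl fun w' hw' => ?_
    have h3 : ∀ j : ZMod P, (ZMod.stdAddChar (j * (den w : ZMod P)) : ℂ) *
        ZMod.stdAddChar (-(j * (den w' : ZMod P)))
        = ZMod.stdAddChar (((den w : ZMod P) - (den w' : ZMod P)) * j) := by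
      intro j
      rw [← AddChar.map_add_eq_mul]; congr 1; ring
    simp only [h3, sum_stdAddChar_mul, sub_eq_zero]
    have : ((den w : ZMod P) = den w') ↔ den w = den w' := by
      rw [ZMod.natCast_eq_natCast_iff', Nat.mod_eq_of_lt (h w hw), Nat.mod_eq_of_lt (h w' hw')]
    simp [this]
  have hE : ∑ j : ZMod P, ‖wordSum P Ω j‖ ^ 2
      = P * ∑ d ∈ Ω.image den, ((Ω.filter fun w => den w = d).card : ℝ) ^ 2 := by
    have h4 : ∑ w ∈ Ω, ∑ w' ∈ Ω, (if den w = den w' then (1 : ℂ) else 0)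
        = ∑ d ∈ Ω.image den, ((Ω.filter fun w => den w = d).card : ℂ) ^ 2 := by
      rw [← Finset.sum_fiberwise_of_maps_to (g := den) (t := Ω.image den)
        (fun w hw => Finset.mem_image_of_mem _ hw)]
      refine Finset.sum_congr rfl fun d _ => ?_
      have : ∀ w ∈ Ω.filter (fun w => den w = d),
          ∑ w' ∈ Ω, (if den w = den w' then (1 : ℂ) else 0)
          = ((Ω.filter fun w => den w = d).card : ℂ) := by
        intro w hw
        rw [(Finset.mem_filter.mp hw).2, ← Finset.sum_filter]
        simp [eq_comm]
      rw [Finset.sum_congr rfl this, Finset.sum_const, nsmul_eq_mul, sq]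
    rw [h4] at hexp
    exact_mod_cast hexp
  have hc : (Ω.card : ℝ) = ∑ d ∈ Ω.image den, ((Ω.filter fun w => den w = d).card : ℝ) := by
    rw [Finset.card_eq_sum_card_image den Ω]; push_cast; rfl
  rw [hE, hc]
  have := sq_sum_le_card_mul_sum_sq (s := Ω.image den)
    (f := fun d => ((Ω.filter fun w => den w = d).card : ℝ))
  calc _ ≤ (P : ℝ) * ((Ω.image den).card *
      ∑ d ∈ Ω.image den, ((Ω.filter fun w => den w = d).card : ℝ) ^ 2) := by gcongr
    _ = _ := by ring

/-- Separated real numbers in an interval. -/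
lemma card_le_of_separated {α : Type*} (s : Finset α) (f : α → ℝ) {lo ℓ σ : ℝ} (hσ : 0 < σ)
    (hℓ : 0 ≤ ℓ) (hf : ∀ a ∈ s, lo ≤ f a ∧ f a ≤ lo + ℓ)
    (hsep : ∀ a ∈ s, ∀ b ∈ s, a ≠ b → σ ≤ |f a - f b|) : (s.card : ℝ) ≤ ℓ / σ + 1 := by
  have h0 : 0 ≤ ℓ / σ := by positivity
  have : s.card ≤ (Finset.range (⌊ℓ / σ⌋₊ + 1)).card := by
    apply Finset.card_le_card_of_injOn (fun a => ⌊(f a - lo) / σ⌋₊)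
    · intro a ha
      simp only [Finset.coe_range, Set.mem_Iio, Nat.lt_succ_iff]
      apply Nat.floor_le_floor
      have := (hf a ha).2
      gcongr
      linarith
    · intro a ha b hb hab
      by_contra hne
      have h1 := hsep a ha b hb hne
      have ha0 : 0 ≤ (f a - lo) / σ := div_nonneg (by linarith [(hf a ha).1]) hσ.le
      have hb0 : 0 ≤ (f b - lo) / σ := div_nonneg (by linarith [(hf b hb).1]) hσ.le
      have a1 := Nat.floor_le ha0
      have a2 := Nat.lt_floor_add_one ((f a - lo) / σ)
      have b1 := Nat.floor_le hb0
      have b2 := Nat.lt_floor_add_one ((f b - lo) / σ)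
      simp only at hab
      rw [hab] at a1 a2
      have h2 : |(f a - lo) / σ - (f b - lo) / σ| < 1 := by
        rw [abs_lt]; constructor <;> linarith
      rw [← sub_div, abs_div, abs_of_pos hσ, div_lt_one hσ] at h2
      rw [show f a - lo - (f b - lo) = f a - f b by ring] at h2
      linarith
  rw [Finset.card_range] at this
  calc (s.card : ℝ) ≤ (⌊ℓ / σ⌋₊ + 1 : ℕ) := by exact_mod_cast this
    _ ≤ ℓ / σ + 1 := by push_cast; gcongr; exact Nat.floor_le h0

lemma card_le_mul_of_fiber {α β : Type*} [DecidableEq β] (s : Finset α) (f : α → β) {n m : ℝ}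
    (hn : 0 ≤ n) (hfib : ∀ a ∈ s, ((s.filter fun x => f x = f a).card : ℝ) ≤ n)
    (himg : ((s.image f).card : ℝ) ≤ m) : (s.card : ℝ) ≤ n * m := by
  rw [Finset.card_eq_sum_card_image f s]
  push_cast
  calc _ ≤ ∑ _b ∈ s.image f, n := by
        refine Finset.sum_le_sum fun b hb => ?_
        obtain ⟨a, ha, rfl⟩ := Finset.mem_image.mp hb
        exact hfib a ha
    _ = n * (s.image f).card := by rw [Finset.sum_const, nsmul_eq_mul, mul_comm]
    _ ≤ n * m := by gcongr

/-- The determinant of the vectors `(num v, den v)` and `(num w, den w)`. -/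
def wordDet (v w : List ℕ) : ℤ := num v * den w - den v * num w

/-- The value of a word as a continued fraction. -/
noncomputable def wordSlope (w : List ℕ) : ℝ := num w / den w

lemma isCoprime_num_den (w : List ℕ) : IsCoprime (num w : ℤ) (den w : ℤ) :=
  Nat.isCoprime_iff_coprime.mpr (coprime_num_den w)

lemma dvd_of_dvd_num_den {q z : ℤ} (w : List ℕ) (h1 : q ∣ z * num w) (h2 : q ∣ z * den w) :
    q ∣ z := by
  obtain ⟨a, b, hab⟩ := isCoprime_num_den w
  have : z = a * (z * num w) + b * (z * den w) := by linear_combination -z * hab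
  rw [this]
  exact dvd_add (h1.mul_left _) (h2.mul_left _)

lemma dvd_wordDet_trans {q : ℤ} {y v w : List ℕ} (h1 : q ∣ wordDet y v) (h2 : q ∣ wordDet y w) :
    q ∣ wordDet v w := by
  apply dvd_of_dvd_num_den y
  · have : wordDet v w * num y = num v * wordDet y w - num w * wordDet y v := by
      simp only [wordDet]; ring
    rw [this]
    exact dvd_sub (h2.mul_left _) (h1.mul_left _)
  · have : wordDet v w * den y = den v * wordDet y w - den w * wordDet y v := by
      simp only [wordDet]; ring
    rw [this]
    exact dvd_sub (h2.mul_left _) (h1.mul_left _)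

lemma num_append_cast (v w : List ℕ) :
    (num (v ++ w) : ℤ) = contMat v 0 0 * num w + contMat v 0 1 * den w := by
  rw [num_cast, contMat_append, Matrix.mul_apply, Fin.sum_univ_two, num_cast, den_cast]

lemma den_append_cast (v w : List ℕ) :
    (den (v ++ w) : ℤ) = contMat v 1 0 * num w + contMat v 1 1 * den w := by
  rw [den_cast, contMat_append, Matrix.mul_apply, Fin.sum_univ_two, num_cast, den_cast]

lemma dvd_wordDet_append {q : ℤ} {v w w' : List ℕ} (h : q ∣ wordDet (v ++ w) (v ++ w')) :
    q ∣ wordDet w w' := by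
  have : wordDet (v ++ w) (v ++ w') = (contMat v 0 0 * contMat v 1 1
      - contMat v 0 1 * contMat v 1 0) * wordDet w w' := by
    simp only [wordDet, num_append_cast, den_append_cast]; ring
  rw [this] at h
  rcases contMat_det v with h1 | h1 <;> rw [h1] at h <;> simpa using h

lemma wordSlope_sub {v w : List ℕ} (hv : 0 ∉ v) (hw : 0 ∉ w) :
    wordSlope v - wordSlope w = (wordDet v w : ℝ) / (den v * den w) := by
  have h1 : (0 : ℝ) < den v := by exact_mod_cast one_le_den hv
  have h2 : (0 : ℝ) < den w := by exact_mod_cast one_le_den hw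
  simp only [wordSlope, wordDet]
  push_cast
  field_simp

lemma wordDet_ne_zero {v w : List ℕ} (hv : 0 ∉ v) (hw : 0 ∉ w) (hl : v.length = w.length)
    (hne : v ≠ w) : wordDet v w ≠ 0 := by
  intro h
  apply hne
  have h0 : num v * den w = num w * den v := by
    have : (num v * den w : ℤ) = num w * den v := by
      simp only [wordDet] at h; linear_combination h
    exact_mod_cast this
  have c1 := coprime_num_den v
  have c2 := coprime_num_den w
  have d1 : den v ∣ den w := c1.symm.dvd_of_dvd_mul_left ⟨num w, by rw [h0]; ring⟩
  have d2 : den w ∣ den v := c2.symm.dvd_of_dvd_mul_left ⟨num v, by rw [← h0]; ring⟩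
  have hd := Nat.dvd_antisymm d1 d2
  refine eq_of_num_den hv hw hl ?_ hd
  rw [hd] at h0
  exact Nat.eq_of_mul_eq_mul_right (one_le_den hw) h0

lemma wordSlope_mem {w : List ℕ} (hw : 0 ∉ w) : 0 ≤ wordSlope w ∧ wordSlope w ≤ 1 := by
  have h1 : (0 : ℝ) < den w := by exact_mod_cast one_le_den hw
  have h2 : (num w : ℝ) ≤ den w := by exact_mod_cast num_le_den hw
  exact ⟨by unfold wordSlope; positivity, by unfold wordSlope; rw [div_le_one h1]; exact h2⟩

lemma le_abs_wordSlope_sub {v w : List ℕ} (hv : 0 ∉ v) (hw : 0 ∉ w) (hl : v.length = w.length)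
    (hne : v ≠ w) {q : ℕ} (hq : (q : ℤ) ∣ wordDet v w) {m : ℝ} (hvm : (den v : ℝ) ≤ m)
    (hwm : (den w : ℝ) ≤ m) : (q : ℝ) / m ^ 2 ≤ |wordSlope v - wordSlope w| := by
  have h1 : (0 : ℝ) < den v := by exact_mod_cast one_le_den hv
  have h2 : (0 : ℝ) < den w := by exact_mod_cast one_le_den hw
  rw [wordSlope_sub hv hw, abs_div, abs_of_pos (mul_pos h1 h2)]
  have h3 : (q : ℝ) ≤ |(wordDet v w : ℝ)| := by
    have := Int.le_of_dvd (abs_pos.mpr (wordDet_ne_zero hv hw hl hne)) ((dvd_abs _ _).mpr hq)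
    exact_mod_cast this
  have h4 : 0 ≤ m := h1.le.trans hvm
  rw [sq]
  gcongr

lemma abs_wordSlope_append_sub_le {u r : List ℕ} (hu : 0 ∉ u) (hr : 0 ∉ r) :
    |wordSlope (u ++ r) - wordSlope u| ≤ 1 / (den u : ℝ) ^ 2 := by
  have hur : 0 ∉ u ++ r := by simp [hu, hr]
  have h1 : (0 : ℝ) < den (u ++ r) := by exact_mod_cast one_le_den hur
  have h2 : (0 : ℝ) < den u := by exact_mod_cast one_le_den hu
  have h3 : ((den u : ℝ) * num r) ≤ den (u ++ r) := by
    have := (den_append_bounds hu hr).1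
    have h4 := Nat.mul_le_mul_left (den u) (num_le_den hr)
    exact_mod_cast h4.trans this
  have hD : wordDet (u ++ r) u = (contMat u 0 0 * contMat u 1 1
      - contMat u 0 1 * contMat u 1 0) * num r := by
    simp only [wordDet, num_append_cast, den_append_cast]
    rw [num_cast u, den_cast u]; ring
  have hD' : |(wordDet (u ++ r) u : ℝ)| = num r := by
    rcases contMat_det u with h | h <;> rw [hD, h] <;> simp
  rw [wordSlope_sub hur hu, abs_div, abs_of_pos (mul_pos h1 h2), hD', div_le_div_iff₀ (by positivity)
    (by positivity)]
  nlinarith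

open Classical in
/-- Counting words close to `y` and in a congruence class determined by `y`. -/
lemma card_near_le {U Z W : Finset (List ℕ)} (hU : IsBlock U) (hZ : IsBlock Z) (hW : IsBlock W)
    {mU mW dU : ℝ} (hdU : 0 < dU) (hUm : ∀ u ∈ U, (den u : ℝ) ≤ mU)
    (hUd : ∀ u ∈ U, dU ≤ den u) (hmU : 0 < mU) (hmW : 0 < mW)
    (hWm : ∀ w ∈ W, (den w : ℝ) ≤ mW) (y : List ℕ) {q : ℕ} (hq : 1 ≤ q)
    {lam : ℝ} (hlam : 0 ≤ lam) :
    (((cat U (cat Z W)).filter fun y' =>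
      (q : ℤ) ∣ wordDet y y' ∧ |wordSlope y - wordSlope y'| ≤ lam).card : ℝ)
      ≤ (mW ^ 2 / q + 1) * (((2 * lam + 2 / dU ^ 2) * mU ^ 2 + 1) * Z.card) := by
  have hq0 : (0 : ℝ) < q := by exact_mod_cast hq
  set T := (U ×ˢ (Z ×ˢ W)).filter fun t => (q : ℤ) ∣ wordDet y (t.1 ++ (t.2.1 ++ t.2.2)) ∧
    |wordSlope y - wordSlope (t.1 ++ (t.2.1 ++ t.2.2))| ≤ lam with hT
  have h1 : ((cat U (cat Z W)).filter fun y' =>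
      (q : ℤ) ∣ wordDet y y' ∧ |wordSlope y - wordSlope y'| ≤ lam).card ≤ T.card := by
    refine (Finset.card_le_card ?_).trans (Finset.card_image_le (f := fun t =>
      t.1 ++ (t.2.1 ++ t.2.2)))
    intro y' hy'
    obtain ⟨hy', hp⟩ := Finset.mem_filter.mp hy'
    obtain ⟨u, hu, v, hv, rfl⟩ := mem_cat.mp hy'
    obtain ⟨z, hz, w, hw, rfl⟩ := mem_cat.mp hv
    exact Finset.mem_image.mpr ⟨(u, z, w), Finset.mem_filter.mpr ⟨by simp [hu, hz, hw], hp⟩, rfl⟩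
  have h2 : (T.card : ℝ) ≤ (mW ^ 2 / q + 1) *
      (((2 * lam + 2 / dU ^ 2) * mU ^ 2 + 1) * Z.card) := by
    apply card_le_mul_of_fiber T (fun t => (t.1, t.2.1)) (by positivity)
    · rintro ⟨u, z, w⟩ -
      have key := card_le_of_separated (T.filter fun x => (x.1, x.2.1) = (u, z))
        (fun t => wordSlope t.2.2) (lo := 0) (ℓ := 1) (σ := q / mW ^ 2) (by positivity) (by norm_num)
        (by
          rintro ⟨u', z', w'⟩ h
          simp only [hT, Finset.mem_filter, Finset.mem_product, Prod.mk.injEq] at h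
          have := wordSlope_mem (hW.zero_notMem w' h.1.1.2.2)
          simpa using this)
        (by
          rintro ⟨u', z', w'⟩ h ⟨u'', z'', w''⟩ h' hne
          simp only [hT, Finset.mem_filter, Finset.mem_product, Prod.mk.injEq] at h h'
          obtain ⟨rfl, rfl⟩ := h.2
          obtain ⟨rfl, rfl⟩ := h'.2
          have hne' : w' ≠ w'' := by rintro rfl; exact hne rfl
          refine le_abs_wordSlope_sub (hW.zero_notMem _ h.1.1.2.2) (hW.zero_notMem _ h'.1.1.2.2)
            (hW.length_eq _ h.1.1.2.2 _ h'.1.1.2.2) hne' ?_ (hWm _ h.1.1.2.2) (hWm _ h'.1.1.2.2)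
          exact dvd_wordDet_append (dvd_wordDet_append (dvd_wordDet_trans h.1.2.1 h'.1.2.1)))
      simpa using key
    · apply card_le_mul_of_fiber _ (fun t => t.2) (by positivity)
      · rintro ⟨u, z⟩ -
        have key := card_le_of_separated
          ((T.image fun t => (t.1, t.2.1)).filter fun x => x.2 = z)
          (fun t => wordSlope t.1) (lo := wordSlope y - lam - 1 / dU ^ 2)
          (ℓ := 2 * lam + 2 / dU ^ 2) (σ := 1 / mU ^ 2) (by positivity) (by positivity)
          (by
            rintro ⟨u', z'⟩ h
            simp only [hT, Finset.mem_filter, Finset.mem_image, Finset.mem_product,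
              Prod.mk.injEq] at h
            obtain ⟨⟨⟨u'', z'', w''⟩, h, rfl, rfl⟩, rfl⟩ := h
            have h3 := abs_wordSlope_append_sub_le (r := z'' ++ w'') (hU.zero_notMem _ h.1.1)
              (by simp [hZ.zero_notMem _ h.1.2.1, hW.zero_notMem _ h.1.2.2])
            have h4 : 1 / (den u'' : ℝ) ^ 2 ≤ 1 / dU ^ 2 := by
              have := hUd _ h.1.1
              gcongr
            have h5 := abs_le.mp (h3.trans h4)
            have h6 := abs_le.mp h.2.2
            have h7 : 2 / dU ^ 2 = 1 / dU ^ 2 + 1 / dU ^ 2 := by ring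
            dsimp only at h5 h6 ⊢
            constructor <;> linarith [h5.1, h5.2, h6.1, h6.2])
          (by
            rintro ⟨u', z'⟩ h ⟨u'', z''⟩ h' hne
            simp only [hT, Finset.mem_filter, Finset.mem_image, Finset.mem_product,
              Prod.mk.injEq] at h h'
            obtain ⟨⟨⟨u1, z1, w1⟩, h, rfl, rfl⟩, rfl⟩ := h
            obtain ⟨⟨⟨u2, z2, w2⟩, h', rfl, rfl⟩, rfl⟩ := h'
            have hne' : u1 ≠ u2 := by rintro rfl; exact hne rfl
            have := le_abs_wordSlope_sub (q := 1) (hU.zero_notMem _ h.1.1) (hU.zero_notMem _ h'.1.1)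
              (hU.length_eq _ h.1.1 _ h'.1.1) hne' (by simp) (hUm _ h.1.1) (hUm _ h'.1.1)
            simpa using this)
        simpa using key
      · norm_cast
        apply Finset.card_le_card
        intro z hz
        simp only [hT, Finset.mem_filter, Finset.mem_image, Finset.mem_product] at hz
        obtain ⟨_, ⟨t, ht, rfl⟩, rfl⟩ := hz
        exact ht.1.2.1
  exact le_trans (by exact_mod_cast h1) h2

lemma rational_approx_rigid {P J R Y q q' a a' b b' j j' z z' e n : ℤ} (hP : 0 < P)
    (hq : 1 ≤ q) (hq' : 1 ≤ q') (hqR : q ≤ R) (hqR' : q' ≤ R) (hb : |b| ≤ R) (hb' : |b'| ≤ R)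
    (hj : j * q = a * P + b) (hj' : j' * q' = a' * P + b') (hz : 0 ≤ z) (hz' : 0 ≤ z')
    (hzY : z ≤ Y) (hzY' : z' ≤ Y) (he : |e| < J) (h : j' * z' - j * z = e + n * P)
    (hR : R ^ 2 * (J + 2 * Y) ≤ P) :
    q * a' * z' - q' * a * z = n * q * q' ∧ q * b' * z' - q' * b * z = q * q' * e := by
  have hR0 : 0 < R := by linarith
  have hJ0 : 0 < J := lt_of_le_of_lt (abs_nonneg e) he
  have hY0 : 0 ≤ Y := hz.trans hzY
  have key : P * (q * a' * z' - q' * a * z - n * q * q')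
      = q * q' * e - q * b' * z' + q' * b * z := by
    linear_combination (-q * z') * hj' + q' * z * hj + q * q' * h
  have b1 : |q * q' * e| < R ^ 2 * J := by
    rw [abs_mul, abs_of_pos (by positivity : 0 < q * q')]
    have : q * q' ≤ R ^ 2 := by rw [sq]; gcongr
    calc q * q' * |e| < q * q' * J := by gcongr
      _ ≤ _ := by gcongr
  have b2 : |q * b' * z'| ≤ R ^ 2 * Y := by
    rw [abs_mul, abs_mul, abs_of_nonneg hz', abs_of_pos (by linarith : 0 < q), sq]
    gcongr
  have b3 : |q' * b * z| ≤ R ^ 2 * Y := by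
    rw [abs_mul, abs_mul, abs_of_nonneg hz, abs_of_pos (by linarith : 0 < q'), sq]
    gcongr
  have hlt : |P * (q * a' * z' - q' * a * z - n * q * q')| < P := by
    rw [key]
    have := abs_add_le (q * q' * e - q * b' * z') (q' * b * z)
    have := abs_sub (q * q' * e) (q * b' * z')
    nlinarith
  have hA : q * a' * z' - q' * a * z - n * q * q' = 0 := by
    rw [abs_mul, abs_of_pos hP] at hlt
    have : |q * a' * z' - q' * a * z - n * q * q'| < 1 := by
      by_contra hcon
      push Not at hcon
      nlinarith
    exact Int.abs_lt_one_iff.mp this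
  refine ⟨by linear_combination hA, ?_⟩
  rw [hA, mul_zero] at key
  linear_combination key

lemma dvd_of_rational_approx {q q' a a' n₁ n₂ : ℤ} {y y' : List ℕ} (hc : IsCoprime a q)
    (h1 : q * a' * num y' - q' * a * num y = n₁ * q * q')
    (h2 : q * a' * den y' - q' * a * den y = n₂ * q * q') : q ∣ q' := by
  apply dvd_of_dvd_num_den y
  · apply hc.symm.dvd_of_dvd_mul_left
    exact ⟨a' * num y' - n₁ * q', by linear_combination -h1⟩
  · apply hc.symm.dvd_of_dvd_mul_left
    exact ⟨a' * den y' - n₂ * q', by linear_combination -h2⟩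

/-- Two close points near rationals of small height have the same denominator. -/
lemma rational_approx_pair {P J R Y q q' a a' b b' j j' : ℤ} {y y' : List ℕ} (hP : 0 < P)
    (hq : 1 ≤ q) (hq' : 1 ≤ q') (hqR : q ≤ R) (hqR' : q' ≤ R) (hb : |b| ≤ R) (hb' : |b'| ≤ R)
    (hj : j * q = a * P + b) (hj' : j' * q' = a' * P + b')
    (hc : IsCoprime a q) (hc' : IsCoprime a' q') (hy0 : 0 ∉ y) (hy0' : 0 ∉ y')
    (hy : den y ≤ Y) (hy' : den y' ≤ Y)
    (h1 : ∃ e n : ℤ, |e| < J ∧ j' * num y' - j * num y = e + n * P)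
    (h2 : ∃ e n : ℤ, |e| < J ∧ j' * den y' - j * den y = e + n * P)
    (hR : R ^ 2 * (J + 2 * Y) ≤ P) :
    q = q' ∧ q ∣ a' * num y' - a * num y ∧ q ∣ a' * den y' - a * den y ∧
      |b' * num y' - b * num y| < q * J ∧ |b' * den y' - b * den y| < q * J := by
  obtain ⟨e₁, n₁, he₁, h1⟩ := h1
  obtain ⟨e₂, n₂, he₂, h2⟩ := h2
  have hn : (num y : ℤ) ≤ Y := le_trans (by exact_mod_cast num_le_den hy0) hy
  have hn' : (num y' : ℤ) ≤ Y := le_trans (by exact_mod_cast num_le_den hy0') hy'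
  obtain ⟨A1, B1⟩ := rational_approx_rigid hP hq hq' hqR hqR' hb hb' hj hj' (by positivity)
    (by positivity) hn hn' he₁ h1 hR
  obtain ⟨A2, B2⟩ := rational_approx_rigid hP hq hq' hqR hqR' hb hb' hj hj' (by positivity)
    (by positivity) hy hy' he₂ h2 hR
  have hqq : q = q' := by
    apply Int.dvd_antisymm (by linarith) (by linarith) (dvd_of_rational_approx hc A1 A2)
    apply dvd_of_rational_approx (y := y') (y' := y) (a' := a) (n₁ := -n₁) (n₂ := -n₂) hc'
    · linear_combination -A1
    · linear_combination -A2
  subst hqq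
  have hq0 : q ≠ 0 := by linarith
  have hqp : 0 < q := by linarith
  refine ⟨rfl, ⟨n₁, mul_left_cancel₀ hq0 (by linear_combination A1)⟩,
    ⟨n₂, mul_left_cancel₀ hq0 (by linear_combination A2)⟩, ?_, ?_⟩
  · rw [mul_left_cancel₀ hq0 (by linear_combination B1 : q * (b' * num y' - b * num y) = q * (q * e₁)),
      abs_mul, abs_of_pos hqp]
    gcongr
  · rw [mul_left_cancel₀ hq0 (by linear_combination B2 : q * (b' * den y' - b * den y) = q * (q * e₂)),
      abs_mul, abs_of_pos hqp]
    gcongr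

lemma dvd_wordDet_of_pair {q a a' : ℤ} {y y' : List ℕ} (hc : IsCoprime a q)
    (h1 : q ∣ a' * num y' - a * num y) (h2 : q ∣ a' * den y' - a * den y) :
    q ∣ wordDet y y' := by
  apply hc.symm.dvd_of_dvd_mul_left
  have : a * wordDet y y' = num y' * (a' * den y' - a * den y)
      - den y' * (a' * num y' - a * num y) := by
    simp only [wordDet]; ring
  rw [this]
  exact dvd_sub (h2.mul_left _) (h1.mul_left _)

lemma abs_mul_wordDet_le {q J Y b b' : ℤ} {y y' : List ℕ} (hy0' : 0 ∉ y')
    (hy' : den y' ≤ Y) (h1 : |b' * num y' - b * num y| < q * J)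
    (h2 : |b' * den y' - b * den y| < q * J) :
    |b * wordDet y y'| ≤ 2 * (q * J * Y) := by
  have : b * wordDet y y' = num y' * (b' * den y' - b * den y)
      - den y' * (b' * num y' - b * num y) := by
    simp only [wordDet]; ring
  rw [this]
  have hn' : (num y' : ℤ) ≤ Y := le_trans (by exact_mod_cast num_le_den hy0') hy'
  refine (abs_sub _ _).trans ?_
  rw [abs_mul, abs_mul, Nat.abs_cast, Nat.abs_cast]
  have hY : 0 ≤ Y := le_trans (by positivity) hn'
  have a1 : (num y' : ℤ) * |b' * den y' - b * den y| ≤ Y * (q * J) := by gcongr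
  have a2 : (den y' : ℤ) * |b' * num y' - b * num y| ≤ Y * (q * J) := by gcongr
  linarith

/-- Two candidates for `j'` with the same word `y'` differ by little modulo `P`. -/
lemma exists_shift {P J q a a' b b' j j' k₁ k₂ c₂ : ℤ} {w : List ℕ} (hq : 1 ≤ q)
    (hj : j * q = a * P + b) (hj' : j' * q = a' * P + b')
    (h1 : q ∣ a * num w - k₁) (h2 : q ∣ a * den w - k₂)
    (h1' : q ∣ a' * num w - k₁) (h2' : q ∣ a' * den w - k₂)
    (hb : |b * den w - c₂| < q * J) (hb' : |b' * den w - c₂| < q * J) :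
    ∃ t k : ℤ, j' = j + t + k * P ∧ |t| * den w ≤ 2 * J := by
  have hdvd : q ∣ a' - a := by
    apply dvd_of_dvd_num_den w
    · have : (a' - a) * num w = (a' * num w - k₁) - (a * num w - k₁) := by ring
      rw [this]; exact dvd_sub h1' h1
    · have : (a' - a) * den w = (a' * den w - k₂) - (a * den w - k₂) := by ring
      rw [this]; exact dvd_sub h2' h2
  obtain ⟨k, hk⟩ := hdvd
  refine ⟨j' - j - k * P, k, by ring, ?_⟩
  have e : q * (j' - j - k * P) = b' - b := by linear_combination hj' - hj + P * hk
  have hqp : 0 < q := by linarith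
  have : q * (|j' - j - k * P| * den w) ≤ q * (2 * J) := by
    calc q * (|j' - j - k * P| * den w) = |(b' - b) * den w| := by
          rw [← e, abs_mul, abs_mul, abs_of_pos hqp, Nat.abs_cast]; ring
      _ = |(b' * den w - c₂) - (b * den w - c₂)| := by ring_nf
      _ ≤ |b' * den w - c₂| + |b * den w - c₂| := abs_sub _ _
      _ ≤ q * (2 * J) := by linarith
  exact le_of_mul_le_mul_left this hqp

lemma NearZero.exists_int {P : ℕ} [NeZero P] {J : ℕ} {j j' : ZMod P} {m m' : ℕ}
    (h : NearZero J (j' * (m' : ZMod P) - j * (m : ZMod P))) :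
    ∃ e n : ℤ, |e| < J ∧ (j'.val : ℤ) * m' - (j.val : ℤ) * m = e + n * P := by
  obtain ⟨e, he, h⟩ := h
  have h2 : ((e : ℤ) : ZMod P) = (((j'.val : ℤ) * m' - (j.val : ℤ) * m : ℤ) : ZMod P) := by
    push_cast
    rw [ZMod.natCast_zmod_val, ZMod.natCast_zmod_val, h]
  obtain ⟨n, hn⟩ := (ZMod.intCast_eq_intCast_iff_dvd_sub _ _ _).mp h2
  exact ⟨e, n, he, by linear_combination hn⟩

lemma card_shift_le {P : ℕ} [NeZero P] (j₀ : ZMod P) (s : Finset (ZMod P)) (τ : ℕ)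
    (h : ∀ j ∈ s, ∃ t k : ℤ, (j.val : ℤ) = j₀.val + t + k * P ∧ |t| ≤ τ) :
    (s.card : ℝ) ≤ 2 * τ + 1 := by
  have h1 : s ⊆ (Finset.Icc (-(τ : ℤ)) τ).image fun t : ℤ => j₀ + (t : ZMod P) := by
    intro j hj
    obtain ⟨t, k, h1, h2⟩ := h j hj
    refine Finset.mem_image.mpr ⟨t, Finset.mem_Icc.mpr (abs_le.mp h2), ?_⟩
    have := congrArg (fun z : ℤ => (z : ZMod P)) h1
    simpa using this.symm
  have h2 := (Finset.card_le_card h1).trans Finset.card_image_le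
  rw [Int.card_Icc] at h2
  have h3 : s.card ≤ 2 * τ + 1 := by omega
  exact_mod_cast h3

/-- Rational approximations with coprime numerator and denominator of all `j / P`. -/
structure RatApprox (P : ℕ) [NeZero P] (a b : ZMod P → ℤ) (q : ZMod P → ℕ) : Prop where
  eq : ∀ j : ZMod P, (j.val : ℤ) * q j = a j * P + b j
  coprime : ∀ j, IsCoprime (a j) (q j : ℤ)
  one_le : ∀ j, 1 ≤ q j

open Classical in
lemma card_pairs_le {P : ℕ} [NeZero P] {a b : ZMod P → ℤ} {q : ZMod P → ℕ}
    (hab : RatApprox P a b q) {T J Y₂ τ : ℕ} {Y₁ Λ : ℝ} (hT : 1 ≤ T) {Θ : Finset (ZMod P)}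
    (hΘ : ∀ j ∈ Θ, q j ≤ 2 * T ∧ |b j| ≤ 2 * T ∧ (T ≤ q j ∨ T ≤ |b j|))
    {U Z W : Finset (List ℕ)} (hU : IsBlock U) (hZ : IsBlock Z) (hW : IsBlock W)
    {mU mW dU : ℝ} (hdU : 0 < dU) (hUm : ∀ u ∈ U, (den u : ℝ) ≤ mU)
    (hUd : ∀ u ∈ U, dU ≤ den u) (hmU : 0 < mU) (hmW : 0 < mW)
    (hWm : ∀ w ∈ W, (den w : ℝ) ≤ mW)
    (hY₁ : 0 < Y₁) (hYd : ∀ y ∈ cat U (cat Z W), Y₁ ≤ den y)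
    (hYm : ∀ y ∈ cat U (cat Z W), den y ≤ Y₂)
    (hP : (2 * T) ^ 2 * (J + 2 * Y₂) ≤ P) (hΛ1 : 1 ≤ Λ) (hΛ : 2 * J * Y₂ ≤ Λ * Y₁ ^ 2)
    (hτ : 2 * J ≤ τ * Y₁) {j : ZMod P} (hj : j ∈ Θ) {y : List ℕ} (hy : y ∈ cat U (cat Z W)) :
    (((Θ ×ˢ cat U (cat Z W)).filter fun p =>
      NearZero J (p.1 * (num p.2 : ZMod P) - j * (num y : ZMod P)) ∧
      NearZero J (p.1 * (den p.2 : ZMod P) - j * (den y : ZMod P))).card : ℝ)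
      ≤ (2 * τ + 1) * ((mW ^ 2 / q j + 1) *
        (((2 * (Λ * q j / T) + 2 / dU ^ 2) * mU ^ 2 + 1) * Z.card)) := by
  have hB := hU.cat (hZ.cat hW)
  have hP0 : (0 : ℤ) < P := by exact_mod_cast Nat.pos_of_ne_zero (NeZero.ne P)
  have hPZ : ((2 * T : ℕ) : ℤ) ^ 2 * ((J : ℤ) + 2 * (Y₂ : ℤ)) ≤ P := by exact_mod_cast hP
  have hT0 : (0 : ℝ) < T := by exact_mod_cast hT
  set G := (Θ ×ˢ cat U (cat Z W)).filter fun p =>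
      NearZero J (p.1 * (num p.2 : ZMod P) - j * (num y : ZMod P)) ∧
      NearZero J (p.1 * (den p.2 : ZMod P) - j * (den y : ZMod P)) with hG
  have pair : ∀ p ∈ G, (q j : ℤ) = q p.1 ∧ (q j : ℤ) ∣ a p.1 * num p.2 - a j * num y ∧
      (q j : ℤ) ∣ a p.1 * den p.2 - a j * den y ∧
      |b p.1 * num p.2 - b j * num y| < q j * J ∧ |b p.1 * den p.2 - b j * den y| < q j * J := by
    rintro ⟨j', y'⟩ hp
    simp only [hG, Finset.mem_filter, Finset.mem_product] at hp
    obtain ⟨⟨hj', hy'⟩, h1, h2⟩ := hp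
    have t1 := hΘ j hj
    have t2 := hΘ j' hj'
    refine rational_approx_pair (R := ((2 * T : ℕ) : ℤ)) (Y := (Y₂ : ℤ)) hP0
      (by exact_mod_cast hab.one_le j)
      (by exact_mod_cast hab.one_le j') (by exact_mod_cast t1.1) (by exact_mod_cast t2.1)
      (by push_cast; exact t1.2.1) (by push_cast; exact t2.2.1) (hab.eq j) (hab.eq j')
      (hab.coprime j) (hab.coprime j') (hB.zero_notMem _ hy) (hB.zero_notMem _ hy')
      (by exact_mod_cast hYm _ hy) (by exact_mod_cast hYm _ hy') h1.exists_int h2.exists_int hPZ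
  have hq1 : (1 : ℤ) ≤ q j := by exact_mod_cast hab.one_le j
  have hq0 : (0 : ℝ) < q j := by exact_mod_cast hab.one_le j
  apply card_le_mul_of_fiber G Prod.snd (by positivity)
  · rintro ⟨j₀, y₀⟩ hp₀
    have e0 := pair _ hp₀
    have hy₀ := (Finset.mem_product.mp (Finset.mem_filter.mp hp₀).1).2
    have : (G.filter fun x => x.2 = (j₀, y₀).2).card
        ≤ ((G.filter fun x => x.2 = (j₀, y₀).2).image Prod.fst).card := by
      rw [Finset.card_image_of_injOn]
      rintro ⟨j₁, y₁⟩ h₁ ⟨j₂, y₂⟩ h₂ h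
      simp only [Finset.coe_filter, Set.mem_ofPred_eq] at h₁ h₂ h
      rw [h, h₁.2, h₂.2]
    refine le_trans (by exact_mod_cast this) (card_shift_le j₀ _ τ ?_)
    intro j' hj'
    obtain ⟨⟨j₁, y₁⟩, h₃, rfl⟩ := Finset.mem_image.mp hj'
    obtain ⟨h₁, h₂⟩ := Finset.mem_filter.mp h₃
    dsimp only at h₂
    subst h₂
    have e1 := pair (j₁, y₁) h₁
    dsimp only at e0 e1
    have q0 := hab.eq j₀
    have q1 := hab.eq j₁
    rw [← e0.1] at q0
    rw [← e1.1] at q1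
    obtain ⟨t, k, h3, h4⟩ := exists_shift hq1 q0 q1 e0.2.1 e0.2.2.1 e1.2.1 e1.2.2.1
      e0.2.2.2.2 e1.2.2.2.2
    refine ⟨t, k, h3, ?_⟩
    have h5 : (|t| : ℝ) * den y₁ ≤ 2 * J := by exact_mod_cast h4
    have h6 : (|t| : ℝ) * Y₁ ≤ τ * Y₁ := by
      refine le_trans ?_ hτ
      refine le_trans ?_ h5
      have := hYd _ hy₀
      gcongr
    have h7 := le_of_mul_le_mul_right h6 hY₁
    exact_mod_cast h7
  · refine le_trans ?_ (card_near_le hU hZ hW hdU hUm hUd hmU hmW hWm y (hab.one_le j)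
      (lam := Λ * q j / T) (by positivity))
    norm_cast
    apply Finset.card_le_card
    intro y' hy'
    obtain ⟨⟨j', y''⟩, hp, rfl⟩ := Finset.mem_image.mp hy'
    have e := pair _ hp
    have hy' := (Finset.mem_product.mp (Finset.mem_filter.mp hp).1).2
    dsimp only at e hy' ⊢
    refine Finset.mem_filter.mpr ⟨hy', dvd_wordDet_of_pair (hab.coprime j) e.2.1 e.2.2.1, ?_⟩
    have z1 := hB.zero_notMem _ hy
    have z2 := hB.zero_notMem _ hy'
    rcases (hΘ j hj).2.2 with h | h
    · have s1 := wordSlope_mem z1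
      have s2 := wordSlope_mem z2
      have : (1 : ℝ) ≤ Λ * q j / T := by
        rw [le_div_iff₀ hT0, one_mul]
        have : (T : ℝ) ≤ q j := by exact_mod_cast h
        nlinarith
      refine le_trans ?_ this
      rw [abs_le]; constructor <;> linarith [s1.1, s1.2, s2.1, s2.2]
    · have hD := abs_mul_wordDet_le (q := q j) (Y := Y₂) z2 (by exact_mod_cast hYm _ hy')
        e.2.2.2.1 e.2.2.2.2
      rw [abs_mul] at hD
      have hD' : (T : ℝ) * |(wordDet y y'' : ℝ)| ≤ q j * (2 * J * Y₂) := by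
        have : (T : ℤ) * |wordDet y y''| ≤ 2 * (q j * J * Y₂) := le_trans (by gcongr) hD
        have h8 : ((T : ℤ) : ℝ) * ((|wordDet y y''| : ℤ) : ℝ) ≤ ((2 * (q j * J * Y₂) : ℤ) : ℝ) := by
          exact_mod_cast this
        push_cast at h8
        linarith
      have d1 := hYd _ hy
      have d2 := hYd _ hy'
      rw [wordSlope_sub z1 z2, abs_div, abs_of_pos (by nlinarith : (0 : ℝ) < den y * den y''),
        div_le_div_iff₀ (by nlinarith) hT0]
      calc |(wordDet y y'' : ℝ)| * T ≤ q j * (2 * J * Y₂) := by linarith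
        _ ≤ q j * (Λ * Y₁ ^ 2) := by gcongr
        _ ≤ q j * (Λ * (den y * den y'')) := by rw [sq]; gcongr
        _ = _ := by ring

/-- A factorisation of `Ω` adapted to frequencies at distance about `T / (q N)` from a rational
of denominator `q`. -/
structure IsSplit (C C' : ℝ) (N T m : ℕ) (mU mW : ℝ) (Ω X U Z W : Finset (List ℕ)) : Prop where
  eq : Ω = cat X (cat U (cat Z W))
  blockX : IsBlock X
  blockU : IsBlock U
  blockZ : IsBlock Z
  blockW : IsBlock W
  denX_le : ∀ x ∈ X, den x ≤ m
  le_denX : ∀ x ∈ X, (m : ℝ) ≤ C * den x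
  denU_le : ∀ u ∈ U, (den u : ℝ) ≤ mU
  le_denU : ∀ u ∈ U, mU ≤ C * den u
  denW_le : ∀ w ∈ W, (den w : ℝ) ≤ mW
  cardX : (m : ℝ) ^ (7 / 4 : ℝ) ≤ C * X.card
  cardU : mU ^ (7 / 4 : ℝ) ≤ C * U.card
  cardW : mW ^ (7 / 4 : ℝ) ≤ C * W.card
  le_m : 5 * C * (T : ℝ) ^ 2 ≤ m
  m_le : (m : ℝ) ≤ C' * (T : ℝ) ^ (5 / 2 : ℝ)
  le_mU : (T : ℝ) ≤ C' * mU ^ 2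
  mU_le : mU ≤ C' * (T : ℝ) ^ (5 / 8 : ℝ)
  le_mW : (T : ℝ) ≤ C' * mW ^ 2
  mW_le : mW ≤ C' * (T : ℝ) ^ (5 / 8 : ℝ)
  mU_pos : 0 < mU
  mW_pos : 0 < mW
  four_m_le : 4 * m ≤ N

lemma sq_le_of_rpow_card {m C k : ℝ} (hm : 0 < m) (h : m ^ (7 / 4 : ℝ) ≤ C * k) :
    m ^ 2 ≤ C * k * m ^ (1 / 4 : ℝ) := by
  have : m ^ 2 = m ^ (7 / 4 : ℝ) * m ^ (1 / 4 : ℝ) := by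
    rw [← Real.rpow_add hm, ← Real.rpow_natCast]; norm_num
  rw [this]
  gcongr

lemma split_count_bound {C C' T q mU mW z : ℝ} (hC : 1 ≤ C) (hC' : 1 ≤ C') (hT : 1 ≤ T)
    (hq : 1 ≤ q) (hqT : q ≤ 2 * T) (hU : T ≤ C' * mU ^ 2) (hW : T ≤ C' * mW ^ 2) (hmU : 0 < mU)
    (hmW : 0 < mW) (hz : 0 ≤ z) :
    (mW ^ 2 / q + 1) * (((2 * (2 * C ^ 3 * q / T) + 2 / (mU / C) ^ 2) * mU ^ 2 + 1) * z)
      ≤ 21 * C ^ 3 * C' ^ 2 * (mW ^ 2 * mU ^ 2 * z / T) := by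
  have hq0 : 0 < q := by linarith
  have hT0 : 0 < T := by linarith
  have h1 : mW ^ 2 / q + 1 ≤ 3 * C' * (mW ^ 2 / q) := by
    have : q ≤ 2 * C' * mW ^ 2 := by nlinarith
    have h2 : 1 ≤ 2 * C' * (mW ^ 2 / q) := by
      rw [← mul_div_assoc, le_div_iff₀ hq0]; linarith
    have h3 : 0 < mW ^ 2 / q := by positivity
    nlinarith
  have h2 : (2 * (2 * C ^ 3 * q / T) + 2 / (mU / C) ^ 2) * mU ^ 2 + 1
      ≤ 7 * C ^ 3 * C' * (q * mU ^ 2 / T) := by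
    have e : (2 * (2 * C ^ 3 * q / T) + 2 / (mU / C) ^ 2) * mU ^ 2 + 1
        = 4 * C ^ 3 * (q * mU ^ 2 / T) + (2 * C ^ 2 + 1) := by field_simp; ring
    rw [e]
    have h4 : 1 ≤ C' * (q * mU ^ 2 / T) := by
      rw [← mul_div_assoc, le_div_iff₀ hT0]
      nlinarith [mul_le_mul_of_nonneg_right hq (by positivity : 0 ≤ C' * mU ^ 2)]
    have h5 : 0 < q * mU ^ 2 / T := by positivity
    have h6 : 2 * C ^ 2 + 1 ≤ 3 * C ^ 3 := by nlinarith [sq_nonneg C, mul_self_nonneg (C - 1)]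
    have h7 : C ^ 3 * (q * mU ^ 2 / T) ≤ C ^ 3 * (C' * (q * mU ^ 2 / T)) := by
      gcongr; nlinarith
    have h8 : C ^ 3 ≤ C ^ 3 * (C' * (q * mU ^ 2 / T)) :=
      le_mul_of_one_le_right (by positivity) h4
    linarith
  calc _ ≤ (3 * C' * (mW ^ 2 / q)) * ((7 * C ^ 3 * C' * (q * mU ^ 2 / T)) * z) := by gcongr
    _ = _ := by field_simp; ring

lemma split_final_bound {C C' T m mU mW x u z w : ℝ} (hC : 1 ≤ C) (hC' : 1 ≤ C') (hT : 1 ≤ T)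
    (hm : 0 < m) (hmU : 0 < mU) (hmW : 0 < mW) (hx : 0 ≤ x) (hu : 0 ≤ u) (hz : 0 ≤ z) (hw : 0 ≤ w)
    (cX : m ^ (7 / 4 : ℝ) ≤ C * x) (cU : mU ^ (7 / 4 : ℝ) ≤ C * u)
    (cW : mW ^ (7 / 4 : ℝ) ≤ C * w) (bX : m ≤ C' * T ^ (5 / 2 : ℝ))
    (bU : mU ≤ C' * T ^ (5 / 8 : ℝ)) (bW : mW ≤ C' * T ^ (5 / 8 : ℝ)) :
    m ^ 2 * (mW ^ 2 * mU ^ 2 * z / T)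
      ≤ C ^ 3 * C' * ((x * (u * (z * w))) * T ^ (-(1 / 16) : ℝ)) := by
  have hT0 : 0 < T := by linarith
  have h1 := sq_le_of_rpow_card hm cX
  have h2 := sq_le_of_rpow_card hmU cU
  have h3 := sq_le_of_rpow_card hmW cW
  have h4 : m ^ (1 / 4 : ℝ) * mU ^ (1 / 4 : ℝ) * mW ^ (1 / 4 : ℝ) ≤ C' * T ^ (15 / 16 : ℝ) := by
    rw [← Real.mul_rpow (by positivity) (by positivity),
      ← Real.mul_rpow (by positivity) (by positivity)]
    have h5 : m * mU * mW ≤ C' ^ 3 * T ^ (15 / 4 : ℝ) := by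
      calc m * mU * mW ≤ (C' * T ^ (5 / 2 : ℝ)) * (C' * T ^ (5 / 8 : ℝ)) *
            (C' * T ^ (5 / 8 : ℝ)) := by gcongr
        _ = C' ^ 3 * (T ^ (5 / 2 : ℝ) * T ^ (5 / 8 : ℝ) * T ^ (5 / 8 : ℝ)) := by ring
        _ = _ := by rw [← Real.rpow_add hT0, ← Real.rpow_add hT0]; norm_num
    calc (m * mU * mW) ^ (1 / 4 : ℝ) ≤ (C' ^ 3 * T ^ (15 / 4 : ℝ)) ^ (1 / 4 : ℝ) := by gcongr
      _ ≤ (C' ^ 4 * T ^ (15 / 4 : ℝ)) ^ (1 / 4 : ℝ) := by gcongr; norm_num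
      _ = C' * T ^ (15 / 16 : ℝ) := by
        rw [Real.mul_rpow (by positivity) (by positivity), ← Real.rpow_mul hT0.le,
          ← Real.rpow_natCast C', ← Real.rpow_mul (by positivity)]
        norm_num
  have h6 : T ^ (15 / 16 : ℝ) / T = T ^ (-(1 / 16) : ℝ) := by
    rw [← Real.rpow_sub_one hT0.ne']; norm_num
  calc m ^ 2 * (mW ^ 2 * mU ^ 2 * z / T)
      ≤ (C * x * m ^ (1 / 4 : ℝ)) * ((C * w * mW ^ (1 / 4 : ℝ)) * (C * u * mU ^ (1 / 4 : ℝ)) * z / T)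
        := by gcongr
    _ = C ^ 3 * (x * (u * (z * w))) * (m ^ (1 / 4 : ℝ) * mU ^ (1 / 4 : ℝ) * mW ^ (1 / 4 : ℝ)) / T
        := by ring
    _ ≤ C ^ 3 * (x * (u * (z * w))) * (C' * T ^ (15 / 16 : ℝ)) / T := by gcongr
    _ = C ^ 3 * C' * ((x * (u * (z * w))) * (T ^ (15 / 16 : ℝ) / T)) := by ring
    _ = _ := by rw [h6]

lemma major_arc_bound {C C' : ℝ} (hC : 1 ≤ C) (hC' : 1 ≤ C') {N T m : ℕ} (hT : 1 ≤ T)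
    [NeZero (2 * N)] {mU mW : ℝ} {Ω X U Z W : Finset (List ℕ)}
    (h : IsSplit C C' N T m mU mW Ω X U Z W) (hΩ : ∀ w ∈ Ω, den w ≤ N ∧ (N : ℝ) ≤ C * den w)
    {a b : ZMod (2 * N) → ℤ} {q : ZMod (2 * N) → ℕ} (hab : RatApprox (2 * N) a b q)
    {Θ : Finset (ZMod (2 * N))}
    (hΘ : ∀ j ∈ Θ, q j ≤ 2 * T ∧ |b j| ≤ 2 * T ∧ (T ≤ q j ∨ T ≤ |b j|)) :
    ∑ j ∈ Θ, ‖wordSum (2 * N) Ω j‖ ^ 2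
      ≤ 430080 * C ^ 7 * C' ^ 3 * ((Ω.card : ℝ) ^ 2 * (T : ℝ) ^ (-(1 / 16) : ℝ)) := by
  classical
  have hN : 0 < N := Nat.pos_of_ne_zero fun h0 => NeZero.ne (2 * N) (by simp [h0])
  have hNr : (0 : ℝ) < N := by exact_mod_cast hN
  have hTr : (1 : ℝ) ≤ T := by exact_mod_cast hT
  have hm : (0 : ℝ) < m := lt_of_lt_of_le (by positivity) h.le_m
  have hm1 : 1 ≤ m := by exact_mod_cast hm
  set Y := cat U (cat Z W) with hY
  have hYB : IsBlock Y := h.blockU.cat (h.blockZ.cat h.blockW)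
  rcases X.eq_empty_or_nonempty with hX | ⟨x₀, hx₀⟩
  · have : Ω = ∅ := by rw [h.eq, hX]; simp [cat]
    simp [this, wordSum]
  have hx₀d : (0 : ℝ) < den x₀ := by exact_mod_cast one_le_den (h.blockX.zero_notMem _ hx₀)
  have hYbound : ∀ y ∈ Y, (N : ℝ) / (2 * C * m) ≤ den y ∧ (den y : ℝ) ≤ C * N / m := by
    intro y hy
    have hmem : x₀ ++ y ∈ Ω := by rw [h.eq]; exact mem_cat.mpr ⟨_, hx₀, _, hy, rfl⟩
    have h1 := hΩ _ hmem
    have h2 := den_append_bounds (h.blockX.zero_notMem _ hx₀) (hYB.zero_notMem _ hy)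
    have h3 : (den x₀ : ℝ) * den y ≤ N := by exact_mod_cast h2.1.trans h1.1
    have h4 : (den (x₀ ++ y) : ℝ) ≤ 2 * (den x₀ * den y) := by exact_mod_cast h2.2
    have h5 := h.le_denX _ hx₀
    have h6 : (den x₀ : ℝ) ≤ m := by exact_mod_cast h.denX_le _ hx₀
    constructor
    · rw [div_le_iff₀ (by positivity)]
      calc (N : ℝ) ≤ C * (2 * (den x₀ * den y)) := h1.2.trans (by gcongr)
        _ ≤ C * (2 * (m * den y)) := by gcongr
        _ = _ := by ring
    · rw [le_div_iff₀ hm]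
      calc (den y : ℝ) * m ≤ den y * (C * den x₀) := by gcongr
        _ = C * (den x₀ * den y) := by ring
        _ ≤ _ := by gcongr
  set Y₂ := ⌊C * N / m⌋₊ with hY₂
  have hY₂le : (Y₂ : ℝ) ≤ C * N / m := Nat.floor_le (by positivity)
  set J := 2 * N / (8 * m) with hJ
  have hJle : (J : ℝ) ≤ N / (4 * m) := by
    refine (Nat.cast_div_le).trans (le_of_eq ?_)
    push_cast; field_simp; ring
  set τ := ⌈C⌉₊ with hτ
  have hτC : C ≤ τ := Nat.le_ceil C
  have hτ2 : (2 * (τ : ℝ) + 1) ≤ 5 * C := by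
    have := Nat.ceil_lt_add_one (by linarith : 0 ≤ C)
    linarith
  have hPcond : (2 * T) ^ 2 * (J + 2 * Y₂) ≤ 2 * N := by
    have : ((2 * (T : ℝ)) ^ 2 * (J + 2 * Y₂)) ≤ 2 * N := by
      calc ((2 * (T : ℝ)) ^ 2 * (J + 2 * Y₂)) ≤ (2 * (T : ℝ)) ^ 2 * (N / (4 * m) + 2 * (C * N / m))
            := by gcongr
        _ = ((1 + 8 * C) * T ^ 2) * N / m := by field_simp; ring
        _ ≤ (2 * m) * N / m := by
          refine div_le_div_of_nonneg_right (mul_le_mul_of_nonneg_right ?_ hNr.le) hm.le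
          have := h.le_m
          nlinarith [mul_le_mul_of_nonneg_right hC (by positivity : 0 ≤ (T : ℝ) ^ 2)]
        _ = 2 * N := by field_simp
    exact_mod_cast this
  set Bd : ℝ := 5 * C * (21 * C ^ 3 * C' ^ 2 * (mW ^ 2 * mU ^ 2 * Z.card / T)) with hBd
  have hmU := h.mU_pos
  have hmW := h.mW_pos
  have hBd0 : 0 ≤ Bd := by positivity
  have hcount : ∀ j ∈ Θ, ∀ y ∈ Y, (((Θ ×ˢ Y).filter fun p =>
      NearZero (2 * N / (8 * m)) (p.1 * (num p.2 : ZMod (2 * N)) - j * (num y : ZMod (2 * N))) ∧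
      NearZero (2 * N / (8 * m))
        (p.1 * (den p.2 : ZMod (2 * N)) - j * (den y : ZMod (2 * N)))).card : ℝ) ≤ Bd := by
    intro j hj y hy
    refine (card_pairs_le hab (T := T) (J := J) (Y₂ := Y₂) (τ := τ) (Y₁ := N / (2 * C * m))
      (Λ := 2 * C ^ 3) hT hΘ h.blockU h.blockZ h.blockW (dU := mU / C) (by positivity) h.denU_le
      (fun u hu => by rw [div_le_iff₀ (by positivity), mul_comm]; exact h.le_denU u hu)
      h.mU_pos h.mW_pos h.denW_le (by positivity)
      (fun y hy => (hYbound y hy).1) (fun y hy => Nat.le_floor (hYbound y hy).2) hPcond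
      (by nlinarith [one_le_pow₀ hC (n := 3)]) ?_ ?_ hj hy).trans ?_
    · calc 2 * (J : ℝ) * Y₂ ≤ 2 * (N / (4 * m)) * (C * N / m) := by gcongr
        _ = _ := by field_simp; norm_num
    · calc 2 * (J : ℝ) ≤ 2 * (N / (4 * m)) := by gcongr
        _ = C * (N / (2 * C * m)) := by field_simp; norm_num
        _ ≤ _ := by gcongr
    · have t := hΘ j hj
      have hq1 : (1 : ℝ) ≤ q j := by exact_mod_cast hab.one_le j
      have hq2 : (q j : ℝ) ≤ 2 * T := by exact_mod_cast t.1
      have := split_count_bound (z := Z.card) hC hC' hTr hq1 hq2 h.le_mU h.le_mW hmU hmW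
        (by positivity)
      rw [hBd]
      gcongr
  have main := sum_norm_sq_wordSum_le h.blockX hm1 h.denX_le (P := 2 * N) (Y := Y)
    (by have := h.four_m_le; omega) Θ hBd0 hcount
  rw [← h.eq] at main
  refine main.trans ?_
  have fin := split_final_bound (x := X.card) (u := U.card) (z := Z.card) (w := W.card) hC hC' hTr
    hm hmU hmW (by positivity) (by positivity) (by positivity) (by positivity)
    h.cardX h.cardU h.cardW h.m_le h.mU_le h.mW_le
  have hcard : (Ω.card : ℝ) = X.card * (U.card * (Z.card * W.card)) := by
    rw [h.eq, h.blockX.card_cat, h.blockU.card_cat, h.blockZ.card_cat]; push_cast; ring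
  rw [← hcard] at fin
  calc 4096 * (m : ℝ) ^ 2 * Ω.card * Bd
      = 430080 * C ^ 4 * C' ^ 2 * Ω.card * ((m : ℝ) ^ 2 * (mW ^ 2 * mU ^ 2 * Z.card / T)) := by
        rw [hBd]; ring
    _ ≤ 430080 * C ^ 4 * C' ^ 2 * Ω.card *
        (C ^ 3 * C' * (Ω.card * (T : ℝ) ^ (-(1 / 16) : ℝ))) := by gcongr
    _ = _ := by ring

/-- Integers whose multiples by `j` are close to multiples of `P`. -/
lemma card_near_multiples_le {P q L : ℕ} {j a b : ℤ} {H : ℝ} (hP : 0 < P) (hq : 1 ≤ q) (hH : 0 ≤ H)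
    (hc : IsCoprime a (q : ℤ)) (hj : j * q = a * P + b) (hb : |b| * q ≤ P) (s : Finset ℤ)
    (hs : ∀ D ∈ s, |D| ≤ L ∧ ∃ f n : ℤ, |(f : ℝ)| ≤ H ∧ j * D = f + n * P) :
    (s.card : ℝ) ≤ (4 * H * q / P + 1) * (4 * L / q + 1) := by
  have h1 : ∀ D, ∃ f n : ℤ, D ∈ s → |(f : ℝ)| ≤ H ∧ j * D = f + n * P := by
    intro D
    by_cases hD : D ∈ s
    · obtain ⟨f, n, h⟩ := (hs D hD).2
      exact ⟨f, n, fun _ => h⟩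
    · exact ⟨0, 0, fun h => absurd h hD⟩
  choose f n hf using h1
  have hq0 : (0 : ℝ) < q := by exact_mod_cast hq
  have hP0 : (0 : ℝ) < P := by exact_mod_cast hP
  set h : ℤ := ((q : ℤ) + 1) / 2 with hh
  have hh1 : 2 * h ≤ q + 1 := by omega
  have hh2 : (q : ℤ) ≤ 2 * h := by omega
  have hh0 : 0 < h := by omega
  apply card_le_mul_of_fiber s (fun D => (D + L) / h) (by positivity)
  · intro D₀ _
    have key := card_le_of_separated (s.filter fun x => (x + L) / h = (D₀ + L) / h)
      (fun D => (f D : ℝ)) (lo := -H) (ℓ := 2 * H) (σ := P / (2 * q)) (by positivity)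
      (by positivity)
      (by
        intro D hD
        have := abs_le.mp (hf D (Finset.mem_filter.mp hD).1).1
        constructor <;> linarith [this.1, this.2])
      (by
        intro D hD E hE hne
        obtain ⟨hD, hD'⟩ := Finset.mem_filter.mp hD
        obtain ⟨hE, hE'⟩ := Finset.mem_filter.mp hE
        have e1 := (hf D hD).2
        have e2 := (hf E hE).2
        have a1 := Int.mul_ediv_add_emod (D + L) h
        have a2 := Int.mul_ediv_add_emod (E + L) h
        rw [hD'] at a1
        rw [hE'] at a2
        have b1 := Int.emod_nonneg (D + L) hh0.ne'
        have b2 := Int.emod_lt_of_pos (D + L) hh0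
        have b3 := Int.emod_nonneg (E + L) hh0.ne'
        have b4 := Int.emod_lt_of_pos (E + L) hh0
        have hDE : |D - E| ≤ h - 1 := by rw [abs_le]; constructor <;> linarith
        have hDE0 : D - E ≠ 0 := sub_ne_zero.mpr hne
        have hne0 : a * (D - E) - (n D - n E) * q ≠ 0 := by
          intro h0
          have : (q : ℤ) ∣ D - E :=
            hc.symm.dvd_of_dvd_mul_left ⟨n D - n E, by linear_combination h0⟩
          have := Int.le_of_dvd (abs_pos.mpr hDE0) ((dvd_abs _ _).mpr this)
          omega
        have e3 : q * (f D - f E) = P * (a * (D - E) - (n D - n E) * q) + b * (D - E) := by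
          linear_combination (D - E) * hj - q * e1 + q * e2
        have h5 : (P : ℤ) ≤ 2 * (q * |f D - f E|) := by
          have h6 : (P : ℤ) ≤ |(P : ℤ) * (a * (D - E) - (n D - n E) * q)| := by
            rw [abs_mul, Nat.abs_cast]
            exact le_mul_of_one_le_right (by positivity) (Int.one_le_abs hne0)
          have h7 : 2 * |b * (D - E)| ≤ P := by
            rw [abs_mul]
            have h8 : 2 * |D - E| ≤ q := by linarith
            calc 2 * (|b| * |D - E|) = |b| * (2 * |D - E|) := by ring
              _ ≤ |b| * q := by gcongr
              _ ≤ P := hb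
          have h9 : |(P : ℤ) * (a * (D - E) - (n D - n E) * q)|
              ≤ |q * (f D - f E)| + |b * (D - E)| := by
            rw [show (P : ℤ) * (a * (D - E) - (n D - n E) * q)
              = q * (f D - f E) - b * (D - E) by linear_combination -e3]
            exact abs_sub _ _
          rw [abs_mul (q : ℤ) (f D - f E), Nat.abs_cast] at h9
          linarith
        rw [div_le_iff₀ (by positivity)]
        have : (P : ℝ) ≤ 2 * (q * |(f D : ℝ) - f E|) := by exact_mod_cast h5
        linarith)
    refine key.trans (le_of_eq ?_)
    field_simp
    ring
  · have hsub : s.image (fun D => (D + L) / h) ⊆ Finset.Icc 0 (2 * L / h) := by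
      intro x hx
      obtain ⟨D, hD, rfl⟩ := Finset.mem_image.mp hx
      have := abs_le.mp (hs D hD).1
      exact Finset.mem_Icc.mpr ⟨Int.ediv_nonneg (by linarith [this.1]) hh0.le,
        Int.ediv_le_ediv hh0 (by linarith [this.2])⟩
    have h2 := Finset.card_le_card hsub
    rw [Int.card_Icc] at h2
    have h0 : 0 ≤ 2 * (L : ℤ) / h := Int.ediv_nonneg (by positivity) hh0.le
    have h3 : ((s.image (fun D => (D + L) / h)).card : ℤ) ≤ 2 * L / h + 1 := by omega
    have h4 : (2 * (L : ℤ) / h) * q ≤ 4 * L := by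
      have := Int.ediv_mul_le (2 * (L : ℤ)) hh0.ne'
      nlinarith
    have h5 : ((2 * (L : ℤ) / h : ℤ) : ℝ) ≤ 4 * L / q := by
      rw [le_div_iff₀ hq0]; exact_mod_cast h4
    have h6 : ((s.image (fun D => (D + L) / h)).card : ℝ) ≤ ((2 * (L : ℤ) / h : ℤ) : ℝ) + 1 := by
      exact_mod_cast h3
    linarith

/-- Words of a block having the same determinant with a given word. -/
lemma card_wordDet_eq_le {Y : Finset (List ℕ)} (hY : IsBlock Y) {Y₁ Y₂ : ℝ} (hY₁ : 0 < Y₁)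
    (hYd : ∀ y ∈ Y, Y₁ ≤ den y) (hYm : ∀ y ∈ Y, (den y : ℝ) ≤ Y₂) {y : List ℕ} (hy : y ∈ Y)
    (D : ℤ) : ((Y.filter fun y' => wordDet y y' = D).card : ℝ) ≤ Y₂ / Y₁ + 1 := by
  apply card_le_of_separated _ (fun y' => (den y' : ℝ)) (lo := 0) hY₁
    (hY₁.le.trans ((hYd y hy).trans (hYm y hy)))
  · intro y' hy'
    have := hYm y' (Finset.mem_filter.mp hy').1
    constructor
    · positivity
    · linarith
  · intro v hv w hw hne
    obtain ⟨hv, hv'⟩ := Finset.mem_filter.mp hv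
    obtain ⟨hw, hw'⟩ := Finset.mem_filter.mp hw
    have hy1 : (0 : ℤ) < den y := by exact_mod_cast one_le_den (hY.zero_notMem y hy)
    have e : (num y : ℤ) * (den v - den w) = den y * (num v - num w) := by
      simp only [wordDet] at hv' hw'
      linear_combination hv' - hw'
    have hdvd : (den y : ℤ) ∣ den v - den w :=
      (isCoprime_num_den y).symm.dvd_of_dvd_mul_left ⟨_, e⟩
    have hne0 : (den v : ℤ) - den w ≠ 0 := by
      intro h0
      apply hne
      rw [h0, mul_zero, eq_comm, mul_eq_zero] at e
      have h1 := e.resolve_left hy1.ne'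
      refine eq_of_num_den (hY.zero_notMem v hv) (hY.zero_notMem w hw) (hY.length_eq v hv w hw) ?_ ?_
      · have : (num v : ℤ) = num w := by linarith
        exact_mod_cast this
      · have : (den v : ℤ) = den w := by linarith
        exact_mod_cast this
    have h2 := Int.le_of_dvd (abs_pos.mpr hne0) ((dvd_abs _ _).mpr hdvd)
    have h3 : (den y : ℝ) ≤ |(den v : ℝ) - den w| := by exact_mod_cast h2
    exact (hYd y hy).trans h3

lemma exists_shift_of_le {P J Y j j' k₁ k₂ : ℤ} {w : List ℕ} (hw : 0 ∉ w) (hwY : den w ≤ Y)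
    (hP : 4 * J * Y ≤ P)
    (h1 : ∃ e n : ℤ, |e| < J ∧ j * num w - k₁ = e + n * P)
    (h2 : ∃ e n : ℤ, |e| < J ∧ j * den w - k₂ = e + n * P)
    (h1' : ∃ e n : ℤ, |e| < J ∧ j' * num w - k₁ = e + n * P)
    (h2' : ∃ e n : ℤ, |e| < J ∧ j' * den w - k₂ = e + n * P) :
    ∃ t k : ℤ, j' = j + t + k * P ∧ |t| * den w ≤ 2 * J := by
  obtain ⟨e₁, n₁, he₁, h1⟩ := h1
  obtain ⟨e₂, n₂, he₂, h2⟩ := h2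
  obtain ⟨e₁', n₁', he₁', h1'⟩ := h1'
  obtain ⟨e₂', n₂', he₂', h2'⟩ := h2'
  have hd : (1 : ℤ) ≤ den w := by exact_mod_cast one_le_den hw
  have hn : (num w : ℤ) ≤ den w := by exact_mod_cast num_le_den hw
  have f1 : |e₁' - e₁| < 2 * J := (abs_sub _ _).trans_lt (by linarith)
  have f2 : |e₂' - e₂| < 2 * J := (abs_sub _ _).trans_lt (by linarith)
  have hJ : 0 < J := (abs_nonneg _).trans_lt he₁
  have key : (e₁' - e₁) * den w - (e₂' - e₂) * num w
      = P * ((n₂' - n₂) * num w - (n₁' - n₁) * den w) := by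
    linear_combination den w * (h1 - h1') - num w * (h2 - h2')
  have hlt : |P * ((n₂' - n₂) * num w - (n₁' - n₁) * den w)| < 4 * J * Y := by
    rw [← key]
    refine (abs_sub _ _).trans_lt ?_
    rw [abs_mul, abs_mul, Nat.abs_cast, Nat.abs_cast]
    have g1 : |e₁' - e₁| * den w < 2 * J * den w := by gcongr
    have g2 : |e₂' - e₂| * num w ≤ 2 * J * den w := by gcongr
    nlinarith
  have hP0 : 0 < P := by nlinarith
  have hz : (n₂' - n₂) * num w - (n₁' - n₁) * den w = 0 := by
    rw [abs_mul, abs_of_pos hP0] at hlt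
    apply Int.abs_lt_one_iff.mp
    by_contra hcon
    push Not at hcon
    nlinarith
  obtain ⟨k, hk⟩ : (den w : ℤ) ∣ n₂' - n₂ :=
    (isCoprime_num_den w).symm.dvd_of_dvd_mul_right ⟨n₁' - n₁, by linear_combination hz⟩
  refine ⟨j' - j - k * P, k, by ring, ?_⟩
  have e : (j' - j - k * P) * den w = e₂' - e₂ := by linear_combination h2' - h2 + P * hk
  rw [← Nat.abs_cast (den w), ← abs_mul, e]
  exact f2.le

open Classical in
lemma card_minor_pairs_le {P : ℕ} [NeZero P] {a b : ZMod P → ℤ} {q : ZMod P → ℕ}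
    (hab : RatApprox P a b q) {J Y₂ τ : ℕ} {Y₁ : ℝ} {Θ : Finset (ZMod P)}
    {Y : Finset (List ℕ)} (hB : IsBlock Y) (hY₁ : 0 < Y₁) (hYd : ∀ y ∈ Y, Y₁ ≤ den y)
    (hYm : ∀ y ∈ Y, den y ≤ Y₂) (hP : 4 * J * Y₂ ≤ P) (hτ : 2 * J ≤ τ * Y₁)
    {j : ZMod P} (hb : |b j| * q j ≤ P) {y : List ℕ} (hy : y ∈ Y) :
    (((Θ ×ˢ Y).filter fun p =>
      NearZero J (p.1 * (num p.2 : ZMod P) - j * (num y : ZMod P)) ∧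
      NearZero J (p.1 * (den p.2 : ZMod P) - j * (den y : ZMod P))).card : ℝ)
      ≤ (2 * τ + 1) * ((Y₂ / Y₁ + 1) *
        ((4 * (2 * J * Y₂) * q j / P + 1) * (4 * (Y₂ ^ 2 : ℕ) / q j + 1))) := by
  have hPpos := Nat.pos_of_ne_zero (NeZero.ne P)
  have hPZ : 4 * (J : ℤ) * (Y₂ : ℤ) ≤ P := by exact_mod_cast hP
  set G := (Θ ×ˢ Y).filter fun p =>
      NearZero J (p.1 * (num p.2 : ZMod P) - j * (num y : ZMod P)) ∧
      NearZero J (p.1 * (den p.2 : ZMod P) - j * (den y : ZMod P)) with hG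
  have memG : ∀ p ∈ G, p.2 ∈ Y ∧
      (∃ e n : ℤ, |e| < J ∧ (p.1.val : ℤ) * num p.2 - (j.val : ℤ) * num y = e + n * P) ∧
      (∃ e n : ℤ, |e| < J ∧ (p.1.val : ℤ) * den p.2 - (j.val : ℤ) * den y = e + n * P) := by
    intro p hp
    simp only [hG, Finset.mem_filter, Finset.mem_product] at hp
    exact ⟨hp.1.2, hp.2.1.exists_int, hp.2.2.exists_int⟩
  apply card_le_mul_of_fiber G Prod.snd (by positivity)
  · rintro ⟨j₀, y₀⟩ hp₀
    obtain ⟨hy₀, e0, e0'⟩ := memG _ hp₀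
    have : (G.filter fun x => x.2 = (j₀, y₀).2).card
        ≤ ((G.filter fun x => x.2 = (j₀, y₀).2).image Prod.fst).card := by
      rw [Finset.card_image_of_injOn]
      rintro ⟨j₁, y₁⟩ h₁ ⟨j₂, y₂⟩ h₂ h
      simp only [Finset.coe_filter, Set.mem_ofPred_eq] at h₁ h₂ h
      rw [h, h₁.2, h₂.2]
    refine le_trans (by exact_mod_cast this) (card_shift_le j₀ _ τ ?_)
    intro j' hj'
    obtain ⟨⟨j₁, y₁⟩, h₃, rfl⟩ := Finset.mem_image.mp hj'
    obtain ⟨h₁, h₂⟩ := Finset.mem_filter.mp h₃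
    dsimp only at h₂
    subst h₂
    obtain ⟨-, e1, e1'⟩ := memG _ h₁
    obtain ⟨t, k, h3, h4⟩ := exists_shift_of_le (hB.zero_notMem _ hy₀)
      (by exact_mod_cast hYm _ hy₀) hPZ e0 e0' e1 e1'
    refine ⟨t, k, h3, ?_⟩
    have h5 : (|t| : ℝ) * den y₁ ≤ 2 * J := by exact_mod_cast h4
    have h6 : (|t| : ℝ) * Y₁ ≤ τ * Y₁ := by
      refine le_trans ?_ hτ
      refine le_trans ?_ h5
      have := hYd _ hy₀
      gcongr
    have h7 := le_of_mul_le_mul_right h6 hY₁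
    exact_mod_cast h7
  · have himg : ∀ y' ∈ G.image Prod.snd, y' ∈ Y ∧ ∃ f n : ℤ, |(f : ℝ)| ≤ 2 * J * Y₂ ∧
        (j.val : ℤ) * wordDet y y' = f + n * P := by
      intro y' hy'
      obtain ⟨⟨j', y''⟩, hp, rfl⟩ := Finset.mem_image.mp hy'
      obtain ⟨hy', ⟨e₁, n₁, he₁, h1⟩, e₂, n₂, he₂, h2⟩ := memG _ hp
      dsimp only at hy' h1 h2 ⊢
      refine ⟨hy', e₂ * num y'' - e₁ * den y'', n₂ * num y'' - n₁ * den y'', ?_, ?_⟩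
      · have hd : (den y'' : ℤ) ≤ Y₂ := by exact_mod_cast hYm _ hy'
        have hn : (num y'' : ℤ) ≤ Y₂ :=
          le_trans (by exact_mod_cast num_le_den (hB.zero_notMem _ hy')) hd
        have : |e₂ * num y'' - e₁ * den y''| ≤ 2 * J * (Y₂ : ℤ) := by
          refine (abs_sub _ _).trans ?_
          rw [abs_mul, abs_mul, Nat.abs_cast, Nat.abs_cast]
          have g1 : |e₁| * den y'' ≤ J * (Y₂ : ℤ) := by gcongr
          have g2 : |e₂| * num y'' ≤ J * (Y₂ : ℤ) := by gcongr
          linarith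
        exact_mod_cast this
      · simp only [wordDet]
        linear_combination den y'' * -h1 + num y'' * h2
    apply card_le_mul_of_fiber _ (wordDet y)
      (by have : (0 : ℝ) ≤ Y₂ / Y₁ := by positivity
          linarith)
    · intro y₀ hy₀
      refine le_trans ?_ (card_wordDet_eq_le hB hY₁ hYd
        (fun y hy => by exact_mod_cast hYm y hy) hy (wordDet y y₀))
      norm_cast
      apply Finset.card_le_card
      intro y' hy'
      obtain ⟨h1, h2⟩ := Finset.mem_filter.mp hy'
      exact Finset.mem_filter.mpr ⟨(himg _ h1).1, h2⟩
    · apply card_near_multiples_le hPpos (hab.one_le j) (by positivity) (hab.coprime j) (hab.eq j) hb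
      intro D hD
      obtain ⟨y', hy', rfl⟩ := Finset.mem_image.mp hD
      obtain ⟨h1, h2⟩ := himg _ hy'
      refine ⟨?_, h2⟩
      have d1 : (den y : ℤ) ≤ Y₂ := by exact_mod_cast hYm _ hy
      have d2 : (den y' : ℤ) ≤ Y₂ := by exact_mod_cast hYm _ h1
      have n1 : (num y : ℤ) ≤ Y₂ := le_trans (by exact_mod_cast num_le_den (hB.zero_notMem _ hy)) d1
      have n2 : (num y' : ℤ) ≤ Y₂ := le_trans (by exact_mod_cast num_le_den (hB.zero_notMem _ h1)) d2
      have g1 : (num y : ℤ) * den y' ≤ Y₂ * Y₂ := by gcongr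
      have g2 : (den y : ℤ) * num y' ≤ Y₂ * Y₂ := by gcongr
      have g3 : (0 : ℤ) ≤ num y * den y' := by positivity
      have g4 : (0 : ℤ) ≤ den y * num y' := by positivity
      rw [wordDet, abs_le]
      push_cast
      constructor <;> nlinarith

/-- A factorisation of `Ω` adapted to frequencies with a rational approximation of denominator
between `N ^ (1 / 4)` and `N ^ (3 / 4)`. -/
structure IsMinorSplit (C C' : ℝ) (N m : ℕ) (Ω X Y : Finset (List ℕ)) : Prop where
  eq : Ω = cat X Y
  blockX : IsBlock X
  blockY : IsBlock Y
  denX_le : ∀ x ∈ X, den x ≤ m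
  le_denX : ∀ x ∈ X, (m : ℝ) ≤ C * den x
  card : (N : ℝ) ^ (7 / 4 : ℝ) ≤ C * Ω.card
  le_m : (N : ℝ) ^ (5 / 8 : ℝ) ≤ m
  m_le : (m : ℝ) ≤ C' * (N : ℝ) ^ (25 / 32 : ℝ)
  four_m_le : 4 * m ≤ N

lemma minor_product_bound {C C' N m q J Y : ℝ} (hC : 1 ≤ C) (hC' : 1 ≤ C') (hN : 1 ≤ N)
    (hm : 0 < m) (hq1 : N ^ (1 / 4 : ℝ) ≤ q) (hq2 : q ≤ N ^ (3 / 4 : ℝ))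
    (hm1 : N ^ (5 / 8 : ℝ) ≤ m) (hm2 : m ≤ C' * N ^ (25 / 32 : ℝ)) (hY0 : 0 ≤ Y)
    (hJ : J ≤ N / (4 * m)) (hY : Y ≤ C * N / m) :
    (4 * (2 * J * Y) * q / (2 * N) + 1) * (4 * Y ^ 2 / q + 1)
      ≤ 10 * C ^ 3 * C' ^ 2 * (N ^ (7 / 4 : ℝ) / m ^ 2) := by
  have hN0 : 0 < N := by linarith
  have hq0 : 0 < q := lt_of_lt_of_le (by positivity) hq1
  -- the two factors
  have h1 : 4 * (2 * J * Y) * q / (2 * N) ≤ C * (N * q / m ^ 2) := by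
    calc 4 * (2 * J * Y) * q / (2 * N)
        ≤ 4 * (2 * (N / (4 * m)) * (C * N / m)) * q / (2 * N) := by gcongr
      _ = _ := by field_simp
  have h2 : 4 * Y ^ 2 / q ≤ 4 * C ^ 2 * (N ^ 2 / (q * m ^ 2)) := by
    calc 4 * Y ^ 2 / q ≤ 4 * (C * N / m) ^ 2 / q := by gcongr
      _ = _ := by field_simp
  set s := N ^ (7 / 4 : ℝ) / m ^ 2 with hs
  have hs0 : 0 < s := by positivity
  have a1 : N * q / m ^ 2 ≤ s := by
    rw [hs]
    gcongr
    calc N * q ≤ N * N ^ (3 / 4 : ℝ) := by gcongr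
      _ = _ := by nth_rewrite 1 [← Real.rpow_one N]; rw [← Real.rpow_add hN0]; norm_num
  have a2 : N ^ 2 / (q * m ^ 2) ≤ s := by
    rw [hs, div_le_div_iff₀ (by positivity) (by positivity)]
    calc N ^ 2 * m ^ 2 = N ^ (7 / 4 : ℝ) * (N ^ (1 / 4 : ℝ) * m ^ 2) := by
          rw [← mul_assoc, ← Real.rpow_add hN0, ← Real.rpow_natCast]; norm_num
      _ ≤ N ^ (7 / 4 : ℝ) * (q * m ^ 2) := by gcongr
  have hmm : m ^ 2 ≤ C' ^ 2 * N ^ (25 / 16 : ℝ) := by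
    calc m ^ 2 ≤ (C' * N ^ (25 / 32 : ℝ)) ^ 2 := by gcongr
      _ = _ := by
        rw [mul_pow, ← Real.rpow_natCast (N ^ (25 / 32 : ℝ)), ← Real.rpow_mul hN0.le]; norm_num
  have a3 : 1 ≤ C' ^ 2 * s := by
    rw [hs, ← mul_div_assoc, le_div_iff₀ (by positivity), one_mul]
    refine hmm.trans ?_
    exact mul_le_mul_of_nonneg_left (Real.rpow_le_rpow_of_exponent_le hN (by norm_num))
      (by positivity)
  have a4 : (N * q / m ^ 2) * (N ^ 2 / (q * m ^ 2)) ≤ s := by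
    have : (N * q / m ^ 2) * (N ^ 2 / (q * m ^ 2)) = N ^ 3 / m ^ 2 / m ^ 2 := by field_simp
    rw [this, hs]
    gcongr
    rw [div_le_iff₀ (by positivity)]
    calc N ^ 3 = N ^ (7 / 4 : ℝ) * (N ^ (5 / 8 : ℝ)) ^ 2 := by
          rw [← Real.rpow_natCast (N ^ (5 / 8 : ℝ)), ← Real.rpow_mul hN0.le, ← Real.rpow_add hN0,
            ← Real.rpow_natCast]
          norm_num
      _ ≤ _ := by gcongr
  have c1 : 1 ≤ C ^ 2 := one_le_pow₀ hC
  have c1' : 1 ≤ C' ^ 2 := one_le_pow₀ hC'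
  have c3 : C ^ 2 ≤ C ^ 3 := pow_le_pow_right₀ hC (by norm_num)
  have c4 : C ≤ C ^ 3 := by nlinarith
  have e0 : s ≤ C' ^ 2 * s := le_mul_of_one_le_left hs0.le c1'
  have b1 : C * (N * q / m ^ 2) ≤ C ^ 3 * (C' ^ 2 * s) := by gcongr; exact a1.trans e0
  have b2 : 4 * C ^ 2 * (N ^ 2 / (q * m ^ 2)) ≤ 4 * (C ^ 3 * (C' ^ 2 * s)) := by
    rw [mul_assoc]; gcongr; exact a2.trans e0
  have b3 : 1 ≤ C ^ 3 * (C' ^ 2 * s) := by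
    refine a3.trans (le_mul_of_one_le_left (by positivity) (by linarith))
  calc _ ≤ (C * (N * q / m ^ 2) + 1) * (4 * C ^ 2 * (N ^ 2 / (q * m ^ 2)) + 1) := by gcongr
    _ = 4 * C ^ 3 * ((N * q / m ^ 2) * (N ^ 2 / (q * m ^ 2))) + C * (N * q / m ^ 2)
        + 4 * C ^ 2 * (N ^ 2 / (q * m ^ 2)) + 1 := by ring
    _ ≤ 4 * C ^ 3 * (C' ^ 2 * s) + C * (N * q / m ^ 2)
        + 4 * C ^ 2 * (N ^ 2 / (q * m ^ 2)) + 1 := by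
      have := mul_le_mul_of_nonneg_left (a4.trans e0) (by positivity : 0 ≤ 4 * C ^ 3)
      linarith
    _ ≤ _ := by linarith

lemma minor_arc_bound {C C' : ℝ} (hC : 1 ≤ C) (hC' : 1 ≤ C') {N m : ℕ}
    [NeZero (2 * N)] {Ω X Y : Finset (List ℕ)} (hCN : C ≤ (N : ℝ) ^ (1 / 4 : ℝ))
    (h : IsMinorSplit C C' N m Ω X Y) (hΩ : ∀ w ∈ Ω, den w ≤ N ∧ (N : ℝ) ≤ C * den w)
    {a b : ZMod (2 * N) → ℤ} {q : ZMod (2 * N) → ℕ} (hab : RatApprox (2 * N) a b q)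
    {Θ : Finset (ZMod (2 * N))}
    (hΘ : ∀ j ∈ Θ, (N : ℝ) ^ (1 / 4 : ℝ) ≤ q j ∧ (q j : ℝ) ≤ (N : ℝ) ^ (3 / 4 : ℝ) ∧
      |b j| * q j ≤ (2 * N : ℕ)) :
    ∑ j ∈ Θ, ‖wordSum (2 * N) Ω j‖ ^ 2 ≤ 614400 * C ^ 7 * C' ^ 2 * (Ω.card : ℝ) ^ 2 := by
  classical
  have hN : 0 < N := Nat.pos_of_ne_zero fun h0 => NeZero.ne (2 * N) (by simp [h0])
  have hNr : (0 : ℝ) < N := by exact_mod_cast hN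
  have hN1 : (1 : ℝ) ≤ N := by exact_mod_cast hN
  have hm : (0 : ℝ) < m := lt_of_lt_of_le (by positivity) h.le_m
  have hm1 : 1 ≤ m := by exact_mod_cast hm
  rcases X.eq_empty_or_nonempty with hX | ⟨x₀, hx₀⟩
  · have : Ω = ∅ := by rw [h.eq, hX]; simp [cat]
    simp [this, wordSum]
  have hx₀d : (0 : ℝ) < den x₀ := by exact_mod_cast one_le_den (h.blockX.zero_notMem _ hx₀)
  have hYbound : ∀ y ∈ Y, (N : ℝ) / (2 * C * m) ≤ den y ∧ (den y : ℝ) ≤ C * N / m := by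
    intro y hy
    have hmem : x₀ ++ y ∈ Ω := by rw [h.eq]; exact mem_cat.mpr ⟨_, hx₀, _, hy, rfl⟩
    have h1 := hΩ _ hmem
    have h2 := den_append_bounds (h.blockX.zero_notMem _ hx₀) (h.blockY.zero_notMem _ hy)
    have h3 : (den x₀ : ℝ) * den y ≤ N := by exact_mod_cast h2.1.trans h1.1
    have h4 : (den (x₀ ++ y) : ℝ) ≤ 2 * (den x₀ * den y) := by exact_mod_cast h2.2
    have h5 := h.le_denX _ hx₀
    have h6 : (den x₀ : ℝ) ≤ m := by exact_mod_cast h.denX_le _ hx₀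
    constructor
    · rw [div_le_iff₀ (by positivity)]
      calc (N : ℝ) ≤ C * (2 * (den x₀ * den y)) := h1.2.trans (by gcongr)
        _ ≤ C * (2 * (m * den y)) := by gcongr
        _ = _ := by ring
    · rw [le_div_iff₀ hm]
      calc (den y : ℝ) * m ≤ den y * (C * den x₀) := by gcongr
        _ = C * (den x₀ * den y) := by ring
        _ ≤ _ := by gcongr
  set Y₂ := ⌊C * N / m⌋₊ with hY₂
  have hY₂le : (Y₂ : ℝ) ≤ C * N / m := Nat.floor_le (by positivity)
  set J := 2 * N / (8 * m) with hJ
  have hJle : (J : ℝ) ≤ N / (4 * m) := by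
    refine (Nat.cast_div_le).trans (le_of_eq ?_)
    push_cast; field_simp; ring
  set τ := ⌈C⌉₊ with hτ
  have hτC : C ≤ τ := Nat.le_ceil C
  have hτ2 : (2 * (τ : ℝ) + 1) ≤ 5 * C := by
    have := Nat.ceil_lt_add_one (by linarith : 0 ≤ C)
    linarith
  have hPcond : 4 * J * Y₂ ≤ 2 * N := by
    have : 4 * (J : ℝ) * Y₂ ≤ 2 * N := by
      have hmsq : C * N ≤ (m : ℝ) ^ 2 := by
        calc C * N ≤ (N : ℝ) ^ (1 / 4 : ℝ) * N := by gcongr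
          _ = ((N : ℝ) ^ (5 / 8 : ℝ)) ^ 2 := by
            rw [← Real.rpow_natCast ((N : ℝ) ^ (5 / 8 : ℝ)), ← Real.rpow_mul hNr.le,
              ← Real.rpow_add_one hNr.ne']
            norm_num
          _ ≤ _ := by gcongr; exact h.le_m
      calc 4 * (J : ℝ) * Y₂ ≤ 4 * (N / (4 * m)) * (C * N / m) := by gcongr
        _ = (C * N / m ^ 2) * N := by field_simp
        _ ≤ 1 * N := by gcongr; rw [div_le_one (by positivity)]; exact hmsq
        _ ≤ _ := by linarith
    exact_mod_cast this
  set s : ℝ := (N : ℝ) ^ (7 / 4 : ℝ) / (m : ℝ) ^ 2 with hs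
  set Bd : ℝ := 5 * C * (3 * C ^ 2 * (10 * C ^ 3 * C' ^ 2 * s)) with hBd
  have hBd0 : 0 ≤ Bd := by positivity
  have hratio : (Y₂ : ℝ) / (N / (2 * C * m)) + 1 ≤ 3 * C ^ 2 := by
    have : (Y₂ : ℝ) / (N / (2 * C * m)) ≤ 2 * C ^ 2 := by
      rw [div_le_iff₀ (by positivity)]
      refine hY₂le.trans (le_of_eq ?_)
      field_simp
    nlinarith
  have hcount : ∀ j ∈ Θ, ∀ y ∈ Y, (((Θ ×ˢ Y).filter fun p =>
      NearZero (2 * N / (8 * m)) (p.1 * (num p.2 : ZMod (2 * N)) - j * (num y : ZMod (2 * N))) ∧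
      NearZero (2 * N / (8 * m))
        (p.1 * (den p.2 : ZMod (2 * N)) - j * (den y : ZMod (2 * N)))).card : ℝ) ≤ Bd := by
    intro j hj y hy
    have t := hΘ j hj
    refine (card_minor_pairs_le hab (J := J) (Y₂ := Y₂) (τ := τ) (Y₁ := N / (2 * C * m))
      h.blockY (by positivity) (fun y hy => (hYbound y hy).1)
      (fun y hy => Nat.le_floor (hYbound y hy).2) hPcond ?_ (by exact_mod_cast t.2.2) hy).trans ?_
    · calc 2 * (J : ℝ) ≤ 2 * (N / (4 * m)) := by gcongr
        _ = C * (N / (2 * C * m)) := by field_simp; norm_num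
        _ ≤ _ := by gcongr
    · have := minor_product_bound hC hC' hN1 hm t.1 t.2.1 h.le_m h.m_le
        (by positivity : (0 : ℝ) ≤ Y₂) hJle hY₂le
      rw [hBd]
      push_cast
      gcongr
  have main := sum_norm_sq_wordSum_le h.blockX hm1 h.denX_le (P := 2 * N) (Y := Y)
    (by have := h.four_m_le; omega) Θ hBd0 hcount
  rw [← h.eq] at main
  refine main.trans ?_
  calc 4096 * (m : ℝ) ^ 2 * Ω.card * Bd
      = 614400 * C ^ 6 * C' ^ 2 * Ω.card * (N : ℝ) ^ (7 / 4 : ℝ) := by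
        rw [hBd, hs]; field_simp; ring
    _ ≤ 614400 * C ^ 6 * C' ^ 2 * Ω.card * (C * Ω.card) := by gcongr; exact h.card
    _ = _ := by ring

lemma exists_ratApprox {N : ℕ} (hN : 0 < N) [NeZero (2 * N)] :
    ∃ (a b : ZMod (2 * N) → ℤ) (q : ZMod (2 * N) → ℕ), RatApprox (2 * N) a b q ∧
      ∀ j, (q j : ℝ) ≤ (N : ℝ) ^ (3 / 4 : ℝ) ∧ (|b j| : ℝ) ≤ 2 * (N : ℝ) ^ (1 / 4 : ℝ) ∧
        |b j| * q j ≤ (2 * N : ℕ) := by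
  have hN1 : (1 : ℝ) ≤ N := by exact_mod_cast hN
  have hN0 : (0 : ℝ) < N := by linarith
  set n := ⌊(N : ℝ) ^ (3 / 4 : ℝ)⌋₊ with hn
  have hn0 : 0 < n := Nat.floor_pos.mpr (Real.one_le_rpow hN1 (by norm_num))
  choose r hr using fun j : ZMod (2 * N) =>
    Real.exists_rat_abs_sub_le_and_den_le ((j.val : ℝ) / (2 * N)) hn0
  have hb : ∀ j, (|((j.val : ℤ) * (r j).den - (r j).num * (2 * N : ℕ) : ℤ)| : ℝ) * (n + 1)
      ≤ 2 * N := by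
    intro j
    have h1 := (hr j).1
    have hd : (0 : ℝ) < (r j).den := by exact_mod_cast (r j).den_pos
    have h2 : (((j.val : ℤ) * (r j).den - (r j).num * (2 * N : ℕ) : ℤ) : ℝ)
        = ((j.val : ℝ) / (2 * N) - (r j : ℝ)) * (2 * N * (r j).den) := by
      rw [Rat.cast_def]
      push_cast
      field_simp
    rw [h2, abs_mul, abs_of_pos (by positivity : (0 : ℝ) < 2 * N * (r j).den)]
    rw [le_div_iff₀ (by positivity)] at h1
    nlinarith
  refine ⟨fun j => (r j).num, fun j => (j.val : ℤ) * (r j).den - (r j).num * (2 * N : ℕ),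
    fun j => (r j).den, ⟨fun j => by ring, fun j => ?_, fun j => (r j).den_pos⟩, fun j => ⟨?_, ?_, ?_⟩⟩
  · exact Int.isCoprime_iff_nat_coprime.mpr (by simpa using (r j).reduced)
  · exact le_trans (by exact_mod_cast (hr j).2) (Nat.floor_le (by positivity))
  · have h3 : (N : ℝ) ^ (3 / 4 : ℝ) ≤ n + 1 := (Nat.lt_floor_add_one _).le
    have h4 : 2 * (N : ℝ) = 2 * (N : ℝ) ^ (1 / 4 : ℝ) * (N : ℝ) ^ (3 / 4 : ℝ) := by
      rw [mul_assoc, ← Real.rpow_add hN0]; norm_num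
    have h5 := hb j
    have h6 : (0 : ℝ) < (N : ℝ) ^ (3 / 4 : ℝ) := by positivity
    refine le_of_mul_le_mul_right ?_ h6
    rw [← h4]
    refine le_trans ?_ h5
    push_cast
    gcongr
  · have h5 := hb j
    have h6 : ((r j).den : ℝ) ≤ n + 1 := by
      have : ((r j).den : ℝ) ≤ n := by exact_mod_cast (hr j).2
      linarith
    have : (|((j.val : ℤ) * (r j).den - (r j).num * (2 * N : ℕ) : ℤ)| : ℝ) * (r j).den
      ≤ (2 * N : ℕ) := by
      push_cast at h5 ⊢
      refine le_trans ?_ h5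
      gcongr
    exact_mod_cast this

lemma sum_two_rpow_le (s : Finset ℕ) :
    ∑ k ∈ s, (((2 ^ k : ℕ) : ℝ)) ^ (-(1 / 16) : ℝ) ≤ (1 - (2 : ℝ) ^ (-(1 / 16) : ℝ))⁻¹ := by
  set r := (2 : ℝ) ^ (-(1 / 16) : ℝ) with hr
  have hr0 : 0 ≤ r := by positivity
  have hr1 : r < 1 := Real.rpow_lt_one_of_one_lt_of_neg (by norm_num) (by norm_num)
  have : ∀ k : ℕ, ((2 ^ k : ℕ) : ℝ) ^ (-(1 / 16) : ℝ) = r ^ k := by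
    intro k
    rw [hr]
    push_cast
    rw [← Real.rpow_natCast, ← Real.rpow_natCast, ← Real.rpow_mul (by norm_num),
      ← Real.rpow_mul (by norm_num), mul_comm]
  simp_rw [this]
  rw [← tsum_geometric_of_lt_one hr0 hr1]
  exact (summable_geometric_of_lt_one hr0 hr1).sum_le_tsum s fun _ _ => by positivity

/-- The bound for the second moment of `wordSum`, relative to its trivial size. -/
noncomputable def energyConst (C C' : ℝ) : ℝ :=
  614400 * C ^ 7 * C' ^ 2 + 430080 * C ^ 7 * C' ^ 3 * (1 - (2 : ℝ) ^ (-(1 / 16) : ℝ))⁻¹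

lemma energyConst_pos {C C' : ℝ} (hC : 1 ≤ C) (hC' : 1 ≤ C') : 0 < energyConst C C' := by
  have hr1 : (2 : ℝ) ^ (-(1 / 16) : ℝ) < 1 :=
    Real.rpow_lt_one_of_one_lt_of_neg (by norm_num) (by norm_num)
  have : 0 < 1 - (2 : ℝ) ^ (-(1 / 16) : ℝ) := by linarith
  have : 0 < C := by linarith
  have : 0 < C' := by linarith
  unfold energyConst
  positivity

lemma energy_le {C C' : ℝ} (hC : 1 ≤ C) (hC' : 1 ≤ C') {N : ℕ} [NeZero (2 * N)]
    (hCN : C ≤ (N : ℝ) ^ (1 / 4 : ℝ)) {Ω : Finset (List ℕ)}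
    (hΩ : ∀ w ∈ Ω, den w ≤ N ∧ (N : ℝ) ≤ C * den w)
    (hminor : ∃ m X Y, IsMinorSplit C C' N m Ω X Y)
    (hmajor : ∀ T : ℕ, 1 ≤ T → (T : ℝ) ≤ 2 * (N : ℝ) ^ (1 / 4 : ℝ) →
      ∃ m mU mW X U Z W, IsSplit C C' N T m mU mW Ω X U Z W) :
    ∑ j, ‖wordSum (2 * N) Ω j‖ ^ 2 ≤ energyConst C C' * (Ω.card : ℝ) ^ 2 := by
  classical
  have hN : 0 < N := Nat.pos_of_ne_zero fun h0 => NeZero.ne (2 * N) (by simp [h0])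
  obtain ⟨a, b, q, hab, hq⟩ := exists_ratApprox hN
  set M : Finset (ZMod (2 * N)) := Finset.univ.filter fun j => (N : ℝ) ^ (1 / 4 : ℝ) ≤ q j with hM
  rw [← Finset.sum_filter_add_sum_filter_not Finset.univ
    (fun j => (N : ℝ) ^ (1 / 4 : ℝ) ≤ q j), energyConst, add_mul]
  refine add_le_add ?_ ?_
  · obtain ⟨m, X, Y, h⟩ := hminor
    exact minor_arc_bound hC hC' hCN h hΩ hab fun j hj =>
      ⟨(Finset.mem_filter.mp hj).2, (hq j).1, (hq j).2.2⟩
  · set S : Finset (ZMod (2 * N)) :=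
      Finset.univ.filter fun j => ¬ (N : ℝ) ^ (1 / 4 : ℝ) ≤ q j with hS
    set t : ZMod (2 * N) → ℕ := fun j => max (q j) (b j).natAbs with ht
    have ht1 : ∀ j, 1 ≤ t j := fun j => le_max_of_le_left (hab.one_le j)
    have ht2 : ∀ j ∈ S, (t j : ℝ) ≤ 2 * (N : ℝ) ^ (1 / 4 : ℝ) := by
      intro j hj
      have h1 := (Finset.mem_filter.mp hj).2
      have h2 := (hq j).2.1
      have h3 : (0 : ℝ) ≤ (N : ℝ) ^ (1 / 4 : ℝ) := by positivity
      rw [ht]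
      push_cast
      refine max_le (by linarith) ?_
      rw [Nat.cast_natAbs]
      exact_mod_cast h2
    set g : ZMod (2 * N) → ℕ := fun j => Nat.log 2 (t j) with hg
    rw [← Finset.sum_fiberwise_of_maps_to (fun j hj => Finset.mem_image_of_mem g hj)]
    have hfib : ∀ k ∈ S.image g, ∑ j ∈ S with g j = k, ‖wordSum (2 * N) Ω j‖ ^ 2
        ≤ 430080 * C ^ 7 * C' ^ 3 *
          ((Ω.card : ℝ) ^ 2 * (((2 ^ k : ℕ) : ℝ)) ^ (-(1 / 16) : ℝ)) := by
      intro k hk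
      obtain ⟨j₀, hj₀, rfl⟩ := Finset.mem_image.mp hk
      have h4 : 2 ^ g j₀ ≤ t j₀ := Nat.pow_log_le_self 2 (by have := ht1 j₀; omega)
      obtain ⟨m, mU, mW, X, U, Z, W, h⟩ := hmajor (2 ^ g j₀) Nat.one_le_two_pow
        (le_trans (by exact_mod_cast h4) (ht2 j₀ hj₀))
      refine major_arc_bound hC hC' Nat.one_le_two_pow h hΩ hab fun j hj => ?_
      obtain ⟨hj1, hj2⟩ := Finset.mem_filter.mp hj
      rw [← hj2]
      have h5 : 2 ^ g j ≤ t j := Nat.pow_log_le_self 2 (by have := ht1 j; omega)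
      have h6 : t j < 2 * 2 ^ g j := by
        rw [← pow_succ']; exact Nat.lt_pow_succ_log_self (by norm_num) _
      have h7 : q j ≤ t j := le_max_left _ _
      have h8 : (b j).natAbs ≤ t j := le_max_right _ _
      refine ⟨by omega, ?_, ?_⟩
      · rw [Int.abs_eq_natAbs]
        exact_mod_cast (by omega : (b j).natAbs ≤ 2 * 2 ^ g j)
      · rcases le_max_iff.mp h5 with h9 | h9
        · exact Or.inl h9
        · right
          rw [Int.abs_eq_natAbs]
          exact_mod_cast h9
    refine (Finset.sum_le_sum hfib).trans ?_
    rw [← Finset.mul_sum, ← Finset.mul_sum]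
    have := sum_two_rpow_le (S.image g)
    calc _ ≤ 430080 * C ^ 7 * C' ^ 3 *
          ((Ω.card : ℝ) ^ 2 * (1 - (2 : ℝ) ^ (-(1 / 16) : ℝ))⁻¹) := by gcongr
      _ = _ := by ring

lemma card_image_den_ge {C C' : ℝ} (hC : 1 ≤ C) (hC' : 1 ≤ C') {N : ℕ} (hN : 0 < N)
    (hCN : C ≤ (N : ℝ) ^ (1 / 4 : ℝ)) {Ω : Finset (List ℕ)}
    (hΩ : ∀ w ∈ Ω, den w ≤ N ∧ (N : ℝ) ≤ C * den w)
    (hminor : ∃ m X Y, IsMinorSplit C C' N m Ω X Y)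
    (hmajor : ∀ T : ℕ, 1 ≤ T → (T : ℝ) ≤ 2 * (N : ℝ) ^ (1 / 4 : ℝ) →
      ∃ m mU mW X U Z W, IsSplit C C' N T m mU mW Ω X U Z W) :
    (N : ℝ) ≤ energyConst C C' * (Ω.image den).card := by
  have : NeZero (2 * N) := ⟨by omega⟩
  have hNr : (0 : ℝ) < N := by exact_mod_cast hN
  have hcard : (0 : ℝ) < Ω.card := by
    obtain ⟨m, X, Y, h⟩ := hminor
    exact pos_of_mul_pos_right (lt_of_lt_of_le (by positivity) h.card) (by linarith)
  have h1 := card_sq_mul_le (P := 2 * N) (Ω := Ω) fun w hw => by have := (hΩ w hw).1; omega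
  have h2 := energy_le hC hC' hCN hΩ hminor hmajor
  have h3 : ((2 * N : ℕ) : ℝ) * (Ω.card : ℝ) ^ 2
      ≤ (energyConst C C' * (Ω.image den).card) * (Ω.card : ℝ) ^ 2 := by
    refine h1.trans ?_
    calc _ ≤ ((Ω.image den).card : ℝ) * (energyConst C C' * (Ω.card : ℝ) ^ 2) := by gcongr
      _ = _ := by ring
  have h4 := le_of_mul_le_mul_right h3 (by positivity)
  push_cast at h4
  linarith

/-- The word of the first `n` continued fraction digits of `x`. -/
noncomputable def digits (x : ℝ) (n : ℕ) : List ℕ :=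
  (List.range n).map fun k => ⌊1 / gaussIter x k⌋₊

lemma digits_succ (x : ℝ) (n : ℕ) : digits x (n + 1) = digits x n ++ [⌊1 / gaussIter x n⌋₊] := by
  simp [digits, List.range_succ]

lemma mem_of_mem_digits {A : Finset ℕ} {x : ℝ} (hx : x ∈ Eset A) {n d : ℕ} (hd : d ∈ digits x n) :
    d ∈ A := by
  obtain ⟨k, -, rfl⟩ := List.mem_map.mp hd
  exact hx.2.2 k

lemma gaussIter_mem {A : Finset ℕ} {x : ℝ} (hx : x ∈ Eset A) (n : ℕ) :
    gaussIter x n ∈ Set.Ioo (0 : ℝ) 1 ∧ Irrational (gaussIter x n) := by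
  induction n with
  | zero => exact ⟨hx.1, hx.2.1⟩
  | succ n ih =>
    obtain ⟨⟨h0, h1⟩, hi⟩ := ih
    have hi' : Irrational (gaussIter x (n + 1)) := by
      simp only [gaussIter, one_div]
      exact hi.inv.sub_natCast _
    refine ⟨⟨?_, ?_⟩, hi'⟩
    · refine lt_of_le_of_ne ?_ hi'.ne_zero.symm
      simp only [gaussIter]
      linarith [Nat.floor_le (by positivity : 0 ≤ 1 / gaussIter x n)]
    · simp only [gaussIter]
      linarith [Nat.lt_floor_add_one (1 / gaussIter x n)]

lemma mul_contMat_digits {A : Finset ℕ} {x : ℝ} (hx : x ∈ Eset A) (n : ℕ) :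
    x * (contMat (digits x n) 1 0 * gaussIter x n + contMat (digits x n) 1 1)
      = contMat (digits x n) 0 0 * gaussIter x n + contMat (digits x n) 0 1 := by
  induction n with
  | zero => simp [digits, contMat, gaussIter]
  | succ n ih =>
    have ht := (gaussIter_mem hx n).1.1
    set t := gaussIter x n with htdef
    have hs : gaussIter x (n + 1) = 1 / t - ⌊1 / t⌋₊ := rfl
    have e : ∀ i, contMat (digits x (n + 1)) i 0 = contMat (digits x n) i 1 ∧
        contMat (digits x (n + 1)) i 1
          = contMat (digits x n) i 0 + contMat (digits x n) i 1 * (⌊1 / t⌋₊ : ℤ) := by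
      intro i
      rw [digits_succ, contMat_append, ← htdef]
      fin_cases i <;> simp [contMat, Matrix.mul_apply, Fin.sum_univ_two]
    rw [(e 0).1, (e 0).2, (e 1).1, (e 1).2, hs]
    push_cast
    field_simp
    linear_combination ih

lemma abs_sub_mul_den_sq_le {A : Finset ℕ} (hA : 0 ∉ A) {x y : ℝ} (hx : x ∈ Eset A)
    (hy : y ∈ Eset A) {n m : ℕ} (h : digits x n = digits y m) :
    |x - y| * (den (digits x n) : ℝ) ^ 2 ≤ 1 := by
  have ex := mul_contMat_digits hx n
  have ey := mul_contMat_digits hy m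
  rw [← h] at ey
  obtain ⟨⟨hs0, hs1⟩, -⟩ := gaussIter_mem hx n
  obtain ⟨⟨ht0, ht1⟩, -⟩ := gaussIter_mem hy m
  set s := gaussIter x n
  set t := gaussIter y m
  set w := digits x n
  have hw : 0 ∉ w := fun h0 => hA (mem_of_mem_digits hx h0)
  have hd : (den w : ℝ) = contMat w 1 1 := by exact_mod_cast den_cast w
  have hd1 : (1 : ℝ) ≤ contMat w 1 1 := by rw [← hd]; exact_mod_cast one_le_den hw
  have h10 : (0 : ℝ) ≤ contMat w 1 0 := by exact_mod_cast contMat_nonneg w 1 0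
  have hdet : |(contMat w 0 0 : ℝ) * contMat w 1 1 - contMat w 0 1 * contMat w 1 0| = 1 := by
    rcases contMat_det w with h | h
    · have : (contMat w 0 0 : ℝ) * contMat w 1 1 - contMat w 0 1 * contMat w 1 0 = 1 := by
        exact_mod_cast h
      rw [this]; simp
    · have : (contMat w 0 0 : ℝ) * contMat w 1 1 - contMat w 0 1 * contMat w 1 0 = -1 := by
        exact_mod_cast h
      rw [this]; simp
  have key : (x - y) * ((contMat w 1 0 * s + contMat w 1 1) * (contMat w 1 0 * t + contMat w 1 1))
      = ((contMat w 0 0 : ℝ) * contMat w 1 1 - contMat w 0 1 * contMat w 1 0) * (s - t) := by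
    linear_combination (contMat w 1 0 * t + contMat w 1 1 : ℝ) * ex
      - (contMat w 1 0 * s + contMat w 1 1 : ℝ) * ey
  have h1 : (contMat w 1 1 : ℝ) ≤ contMat w 1 0 * s + contMat w 1 1 := by nlinarith
  have h2 : (contMat w 1 1 : ℝ) ≤ contMat w 1 0 * t + contMat w 1 1 := by nlinarith
  have h0 : (0 : ℝ) ≤ contMat w 1 1 := by linarith
  have hst : |s - t| ≤ 1 := abs_le.mpr ⟨by linarith, by linarith⟩
  calc |x - y| * (den w : ℝ) ^ 2 = |x - y| * ((contMat w 1 1 : ℝ) * contMat w 1 1) := by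
        rw [hd]; ring
    _ ≤ |x - y| * ((contMat w 1 0 * s + contMat w 1 1) * (contMat w 1 0 * t + contMat w 1 1)) := by
        gcongr
    _ = |(x - y) * ((contMat w 1 0 * s + contMat w 1 1) *
          (contMat w 1 0 * t + contMat w 1 1))| := by
        rw [abs_mul (x - y), abs_of_nonneg (mul_nonneg (h0.trans h1) (h0.trans h2))]
    _ ≤ 1 := by rw [key, abs_mul, hdet, one_mul]; exact hst

/-- Words over `A` whose continuant lies between `R` and `C * R`. -/
def wordsAt (A : Finset ℕ) (C R : ℝ) : Set (List ℕ) :=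
  {w | (∀ d ∈ w, d ∈ A) ∧ R ≤ den w ∧ den w ≤ C * R}

lemma finite_words (A : Finset ℕ) (n : ℕ) :
    {w : List ℕ | (∀ d ∈ w, d ∈ A) ∧ w.length ≤ n}.Finite := by
  refine ((List.finite_length_le A n).image (List.map Subtype.val)).subset ?_
  rintro w ⟨h1, h2⟩
  refine ⟨w.attach.map fun d => ⟨d.1, h1 _ d.2⟩, by simpa using h2, by simp⟩

lemma length_le_of_den_le {w : List ℕ} (hw : 0 ∉ w) : w.length ≤ 2 * den w + 1 := by
  have h1 := two_pow_le_den hw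
  have h2 := (Nat.lt_two_pow_self (n := w.length / 2))
  omega

lemma finite_wordsAt {A : Finset ℕ} (hA : 0 ∉ A) (C R : ℝ) : (wordsAt A C R).Finite := by
  refine (finite_words A (2 * ⌊C * R⌋₊ + 1)).subset ?_
  rintro w ⟨h1, -, h3⟩
  have := length_le_of_den_le (w := w) fun h0 => hA (h1 _ h0)
  have := Nat.le_floor h3
  exact ⟨h1, by omega⟩

lemma exists_digits_mem_wordsAt {A : Finset ℕ} (hA : 0 ∉ A) {x : ℝ} (hx : x ∈ Eset A) {R : ℝ}
    (hR : 1 < R) : ∃ n, digits x n ∈ wordsAt A (A.sup id + 1 : ℕ) R := by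
  have h0 : ∀ n, 0 ∉ digits x n := fun n h => hA (mem_of_mem_digits hx h)
  have hex : ∃ n, R ≤ den (digits x n) := by
    refine ⟨2 * ⌈R⌉₊, ?_⟩
    have h1 := two_pow_le_den (h0 (2 * ⌈R⌉₊))
    have h2 : (digits x (2 * ⌈R⌉₊)).length = 2 * ⌈R⌉₊ := by simp [digits]
    rw [h2, Nat.mul_div_cancel_left _ (by norm_num)] at h1
    exact (Nat.le_ceil R).trans (by exact_mod_cast (Nat.lt_two_pow_self).le.trans h1)
  classical
  set n := Nat.find hex with hn
  refine ⟨n, fun d hd => mem_of_mem_digits hx hd, Nat.find_spec hex, ?_⟩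
  obtain ⟨k, hk⟩ : ∃ k, n = k + 1 := by
    refine Nat.exists_eq_succ_of_ne_zero fun h => ?_
    have := Nat.find_spec hex
    rw [← hn, h] at this
    simp [digits, den_nil] at this
    linarith
  have hlt : (den (digits x k) : ℝ) < R := not_le.mp (Nat.find_min hex (by omega))
  rw [hk, digits_succ]
  have hd : ⌊1 / gaussIter x k⌋₊ ≤ A.sup id := Finset.le_sup (f := id) (hx.2.2 k)
  have h1 : den (digits x k ++ [⌊1 / gaussIter x k⌋₊])
      ≤ den (digits x k) * (A.sup id + 1) := by
    have h2 : (num (digits x k).reverse : ℤ) ≤ den (digits x k) := by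
      rw [num_reverse_cast]; exact contMat_le_den (h0 k) 1 0
    have h3 : num (digits x k).reverse ≤ den (digits x k) := by exact_mod_cast h2
    rw [den_append, num_cons, den_nil, den_cons, num_nil, den_nil]
    nlinarith [Nat.mul_le_mul_left (den (digits x k)) hd]
  calc (den (digits x k ++ [⌊1 / gaussIter x k⌋₊]) : ℝ)
      ≤ den (digits x k) * (A.sup id + 1 : ℕ) := by exact_mod_cast h1
    _ ≤ R * (A.sup id + 1 : ℕ) := by gcongr
    _ = _ := by ring

open MeasureTheory Filter in
lemma eventually_le_ncard_wordsAt {A : Finset ℕ} (hA : 0 ∉ A) {s : NNReal}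
    (hs : (s : ENNReal) < dimH (Eset A)) :
    ∀ᶠ R : ℝ in atTop, R ^ (2 * s : ℝ) ≤ (wordsAt A (A.sup id + 1 : ℕ) R).ncard := by
  by_contra hcon
  rw [not_eventually] at hcon
  have htop := hausdorffMeasure_of_lt_dimH hs
  have : ∀ R : ℝ, Fintype (wordsAt A (A.sup id + 1 : ℕ) R) := fun R =>
    (finite_wordsAt hA _ R).fintype
  set t : (R : ℝ) → wordsAt A (A.sup id + 1 : ℕ) R → Set ℝ := fun R w =>
    {x | x ∈ Eset A ∧ ∃ n, digits x n = w} with ht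
  have hdiam : ∀ R : ℝ, 0 < R → ∀ w, Metric.ediam (t R w) ≤ ENNReal.ofReal (1 / R ^ 2) := by
    intro R hR w
    refine Metric.ediam_le ?_
    rintro x ⟨hx, n, hn⟩ y ⟨hy, m, hm⟩
    rw [edist_dist]
    refine ENNReal.ofReal_le_ofReal ?_
    rw [Real.dist_eq, le_div_iff₀ (by positivity)]
    refine le_trans ?_ (abs_sub_mul_den_sq_le hA hx hy (hn.trans hm.symm))
    rw [hn]
    have := w.2.2.1
    gcongr
  have hle := Measure.hausdorffMeasure_le_liminf_sum (s : ℝ) (Eset A) (l := atTop)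
    (fun R : ℝ => ENNReal.ofReal (1 / R ^ 2))
    (by
      have : Tendsto (fun R : ℝ => 1 / R ^ 2) atTop (nhds 0) := by
        simp only [one_div]
        exact (tendsto_pow_atTop (by norm_num)).inv_tendsto_atTop
      simpa [Function.comp_def] using (ENNReal.continuous_ofReal.tendsto 0).comp this) t
    (by
      filter_upwards [eventually_gt_atTop 0] with R hR w using hdiam R hR w)
    (by
      filter_upwards [eventually_gt_atTop 1] with R hR x hx
      obtain ⟨n, hn⟩ := exists_digits_mem_wordsAt hA hx hR
      exact Set.mem_iUnion.mpr ⟨⟨_, hn⟩, hx, n, rfl⟩)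
  rw [htop, top_le_iff] at hle
  have hlim : liminf (fun R => ∑ w, Metric.ediam (t R w) ^ (s : ℝ)) atTop ≤ 1 := by
    refine liminf_le_of_frequently_le' ((hcon.and_eventually (eventually_gt_atTop 0)).mono ?_)
    rintro R ⟨h1, hR⟩
    push Not at h1
    calc ∑ w, Metric.ediam (t R w) ^ (s : ℝ)
        ≤ ∑ _w : wordsAt A (A.sup id + 1 : ℕ) R, ENNReal.ofReal ((1 / R ^ 2) ^ (s : ℝ)) := by
          refine Finset.sum_le_sum fun w _ => ?_
          rw [← ENNReal.ofReal_rpow_of_nonneg (by positivity) s.coe_nonneg]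
          exact ENNReal.rpow_le_rpow (hdiam R hR w) s.coe_nonneg
      _ = ENNReal.ofReal ((wordsAt A (A.sup id + 1 : ℕ) R).ncard * (1 / R ^ 2) ^ (s : ℝ)) := by
          rw [Finset.sum_const, Finset.card_univ, nsmul_eq_mul, ENNReal.ofReal_mul (by positivity),
            ENNReal.ofReal_natCast, ← Nat.card_eq_fintype_card, Nat.card_coe_set_eq]
      _ ≤ ENNReal.ofReal (R ^ (2 * s : ℝ) * (1 / R ^ 2) ^ (s : ℝ)) := by gcongr
      _ = 1 := by
          rw [one_div, ← Real.rpow_natCast, ← Real.rpow_neg hR.le, ← Real.rpow_mul hR.le,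
            ← Real.rpow_add hR]
          simp
  rw [hle] at hlim
  simp at hlim

/-- The entries of the continuant matrices of words of `X` agree up to a factor `r`. -/
def IsUnif (r : ℝ) (X : Finset (List ℕ)) : Prop :=
  ∀ v ∈ X, ∀ w ∈ X, ∀ i j, (contMat v i j : ℝ) ≤ r * contMat w i j

lemma length_le_of_den_le_log {w : List ℕ} (hw : 0 ∉ w) {B : ℝ} (hB : (den w : ℝ) ≤ B) :
    (w.length : ℝ) ≤ 3 * Real.log B + 1 := by
  have h1 : ((2 : ℝ) ^ (w.length / 2)) ≤ B := le_trans (by exact_mod_cast two_pow_le_den hw) hB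
  have h2 := Real.log_le_log (by positivity) h1
  rw [Real.log_pow] at h2
  have h3 := Real.log_two_gt_d9
  have h4 : (w.length : ℝ) ≤ 2 * (w.length / 2 : ℕ) + 1 := by
    exact_mod_cast (by omega : w.length ≤ 2 * (w.length / 2) + 1)
  have h5 : (0 : ℝ) ≤ (w.length / 2 : ℕ) := by positivity
  nlinarith

lemma two_le_length {A : Finset ℕ} {w : List ℕ} (hw : ∀ d ∈ w, d ∈ A)
    (h : A.sup id + 1 < den w) : 2 ≤ w.length := by
  rcases w with _ | ⟨d, _ | ⟨e, w⟩⟩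
  · simp [den_nil] at h
  · have hd : d ≤ A.sup id := Finset.le_sup (f := id) (hw d (by simp))
    simp only [den_cons, num_nil, den_nil] at h
    omega
  · simp

lemma le_exp_mul_of_floor_eq {x y l : ℝ} (hx : 0 < x) (hy : 0 < y) (hl : 0 < l)
    (hy1 : 0 ≤ Real.log y)
    (h : ⌊Real.log x * l⌋₊ = ⌊Real.log y * l⌋₊) : x ≤ Real.exp (1 / l) * y := by
  have h1 := Nat.lt_floor_add_one (Real.log x * l)
  have h2 := Nat.floor_le (by positivity : 0 ≤ Real.log y * l)
  rw [h] at h1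
  have h3 : Real.log x ≤ 1 / l + Real.log y := by
    rw [div_add' _ _ _ hl.ne', le_div_iff₀ hl]
    linarith
  calc x = Real.exp (Real.log x) := (Real.exp_log hx).symm
    _ ≤ Real.exp (1 / l + Real.log y) := Real.exp_le_exp.mpr h3
    _ = _ := by rw [Real.exp_add, Real.exp_log hy]

open Filter in
lemma eventually_log_pow_mul_le {s K : ℝ} (hs : 7 / 4 < s) :
    ∀ᶠ R : ℝ in atTop, K * Real.log R ^ 20 * R ^ (7 / 4 : ℝ) ≤ R ^ s := by
  have h := (isLittleO_log_rpow_rpow_atTop 20 (show (0 : ℝ) < s - 7 / 4 by linarith)).def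
    (c := (|K| + 1)⁻¹) (by positivity)
  filter_upwards [h, eventually_gt_atTop 1] with R hR hR1
  have h0 : 0 < Real.log R := Real.log_pos hR1
  have hR0 : 0 < R := by linarith
  rw [Real.norm_of_nonneg (by positivity), Real.norm_of_nonneg (by positivity)] at hR
  have e : Real.log R ^ (20 : ℝ) = Real.log R ^ 20 := by
    rw [← Real.rpow_natCast]; norm_num
  rw [e, ← div_eq_inv_mul, le_div_iff₀ (by positivity)] at hR
  calc K * Real.log R ^ 20 * R ^ (7 / 4 : ℝ)
      ≤ (Real.log R ^ 20 * (|K| + 1)) * R ^ (7 / 4 : ℝ) := by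
        rw [mul_comm K]
        gcongr
        linarith [le_abs_self K]
    _ ≤ R ^ (s - 7 / 4) * R ^ (7 / 4 : ℝ) := by gcongr
    _ = R ^ s := by rw [← Real.rpow_add hR0]; congr 1; ring

open Filter in
/-- At every large scale there are many words over `A` of equal length whose continuant matrices
are almost proportional. -/
lemma eventually_exists_uniform_block {A : Finset ℕ} (hA : 0 ∉ A)
    (hdim : ENNReal.ofReal ((7 : ℝ) / 8) < dimH (Eset A)) :
    ∀ᶠ R : ℝ in atTop, ∃ Ξ : Finset (List ℕ), (∀ w ∈ Ξ, w ∈ wordsAt A (A.sup id + 1 : ℕ) R) ∧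
      IsBlock Ξ ∧ IsUnif (Real.exp (1 / Real.log R ^ 2)) Ξ ∧
      (4 * (A.sup id + 1 : ℕ) * R) ^ (7 / 4 : ℝ) ≤ Ξ.card := by
  obtain ⟨s, hs1, hs2⟩ := ENNReal.lt_iff_exists_nnreal_btwn.mp hdim
  have hs : 7 / 4 < (2 * s : ℝ) := by
    rw [ENNReal.ofReal_lt_coe_iff (by norm_num)] at hs1
    linarith
  set C : ℕ := A.sup id + 1 with hC
  have hC1 : (1 : ℝ) ≤ C := by exact_mod_cast (by omega : 1 ≤ C)
  have hK : 0 ≤ Real.log C := Real.log_nonneg hC1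
  filter_upwards [eventually_le_ncard_wordsAt hA hs2, eventually_gt_atTop 1,
    eventually_gt_atTop (C : ℝ),
    eventually_log_pow_mul_le (K := 32 * (4 * C : ℝ) ^ (7 / 4 : ℝ)) hs,
    Real.tendsto_log_atTop.eventually_ge_atTop (Real.log C + 10)] with R hR hR1 hRC hR2 hl
  classical
  set l := Real.log R with hldef
  have hR0 : 0 < R := by linarith
  set n := ⌈l ^ 4⌉₊ with hn
  have hfin := finite_wordsAt hA C R
  set S := hfin.toFinset with hS
  have hmem : ∀ w ∈ S, w ∈ wordsAt A C R := fun w hw => hfin.mem_toFinset.mp hw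
  have h0 : ∀ w ∈ S, 0 ∉ w := fun w hw h => hA ((hmem w hw).1 _ h)
  have hlen : ∀ w ∈ S, 2 ≤ w.length := fun w hw =>
    two_le_length (hmem w hw).1 (by exact_mod_cast hRC.trans_le (hmem w hw).2.1)
  have hpos : ∀ w ∈ S, ∀ i j, (1 : ℝ) ≤ contMat w i j := fun w hw i j => by
    exact_mod_cast one_le_contMat (h0 w hw) (hlen w hw) i j
  have hlogCR : Real.log (C * R) = Real.log C + l := by
    rw [Real.log_mul (by positivity) (by positivity)]
  set f : List ℕ → ℕ × (Fin 2 × Fin 2 → ℕ) := fun w =>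
    (w.length, fun p => ⌊Real.log (contMat w p.1 p.2) * l ^ 2⌋₊) with hf
  set t := Finset.range n ×ˢ Fintype.piFinset (fun _ : Fin 2 × Fin 2 => Finset.range n) with ht
  have hmaps : ∀ w ∈ S, f w ∈ t := by
    intro w hw
    simp only [ht, hf, Finset.mem_product, Finset.mem_range, Fintype.mem_piFinset]
    constructor
    · rw [hn, Nat.lt_ceil]
      have := length_le_of_den_le_log (h0 w hw) (hmem w hw).2.2
      rw [hlogCR] at this
      have hl4 : l ^ 4 ≥ 1000 * l := by
        have h3 : (10 : ℝ) ^ 3 ≤ l ^ 3 := by gcongr; linarith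
        nlinarith
      linarith
    · intro p
      rw [hn, Nat.lt_ceil]
      have h1 := hpos w hw p.1 p.2
      have h2 : (contMat w p.1 p.2 : ℝ) ≤ C * R :=
        le_trans (by exact_mod_cast contMat_le_den (h0 w hw) p.1 p.2) (hmem w hw).2.2
      have h3 := Real.log_le_log (by linarith) h2
      have h4 := Real.log_nonneg h1
      rw [hlogCR] at h3
      refine (Nat.floor_le (by positivity)).trans_lt ?_
      have h5 : Real.log (contMat w p.1 p.2) < l ^ 2 := by nlinarith
      have hl0 : 0 < l := by linarith
      calc _ < l ^ 2 * l ^ 2 := by gcongr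
        _ = _ := by ring
  have hn1 : (n : ℝ) ≤ 2 * l ^ 4 := by
    have h1 := Nat.ceil_lt_add_one (by positivity : 0 ≤ l ^ 4)
    have h2 : 1 ≤ l ^ 4 := one_le_pow₀ (by linarith)
    linarith
  have hn0 : 0 < n := Nat.ceil_pos.mpr (by have : 0 < l := by linarith
                                           positivity)
  have htcard : t.card = n ^ 5 := by
    rw [ht, Finset.card_product, Fintype.card_piFinset]
    simp
    ring
  have htne : t.Nonempty := by rw [← Finset.card_pos, htcard]; positivity
  have hbig : t.card • ((4 * C * R : ℝ) ^ (7 / 4 : ℝ)) ≤ (S.card : ℝ) := by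
    rw [htcard, nsmul_eq_mul, hS, ← Set.ncard_eq_toFinset_card _ hfin]
    refine le_trans ?_ (hR2.trans hR)
    push_cast
    calc (n : ℝ) ^ 5 * (4 * C * R : ℝ) ^ (7 / 4 : ℝ)
        ≤ (2 * l ^ 4) ^ 5 * ((4 * C) ^ (7 / 4 : ℝ) * R ^ (7 / 4 : ℝ)) := by
          rw [Real.mul_rpow (by positivity) hR0.le]; gcongr
      _ = _ := by ring
  obtain ⟨y, -, hy⟩ := Finset.exists_le_card_fiber_of_nsmul_le_card_of_maps_to hmaps htne hbig
  have hsub : ∀ w ∈ {x ∈ S | f x = y}, w ∈ S ∧ f w = y := fun w hw => Finset.mem_filter.mp hw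
  refine ⟨_, fun w hw => hmem w (hsub w hw).1,
    ⟨fun w hw => h0 w (hsub w hw).1, fun v hv w hw => ?_⟩, fun v hv w hw i j => ?_, hy⟩
  · exact congrArg Prod.fst ((hsub v hv).2.trans (hsub w hw).2.symm)
  · have e := congrFun (congrArg Prod.snd ((hsub v hv).2.trans (hsub w hw).2.symm)) (i, j)
    have h1 := hpos v (hsub v hv).1 i j
    have h2 := hpos w (hsub w hw).1 i j
    have hl0 : 0 < l := by linarith
    exact le_exp_mul_of_floor_eq (by linarith) (by linarith) (by positivity)
      (Real.log_nonneg h2) e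

/-- A block of at least `κ * m ^ (7 / 4)` words over `A` with continuants between `c * m`
and `m`. -/
structure IsScale (A : Finset ℕ) (c κ m : ℝ) (X : Finset (List ℕ)) : Prop where
  mem : ∀ w ∈ X, ∀ d ∈ w, d ∈ A
  block : IsBlock X
  le_den : ∀ w ∈ X, c * m ≤ den w
  den_le : ∀ w ∈ X, (den w : ℝ) ≤ m
  card : κ * m ^ (7 / 4 : ℝ) ≤ X.card

/-- `H` splits off a prefix of size between `V` and `D * V ^ (5 / 4)`, followed by a block of about
the fourth root of that size. -/
def HasPrefix (A : Finset ℕ) (c κ D V : ℝ) (H : Finset (List ℕ)) : Prop :=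
  ∃ X U Z : Finset (List ℕ), ∃ mX mU : ℝ, H = cat X (cat U Z) ∧ IsScale A c κ mX X ∧
    IsScale A c κ mU U ∧ IsBlock Z ∧ V ≤ mX ∧ mX ≤ D * V ^ (5 / 4 : ℝ) ∧
    mX ^ (1 / 4 : ℝ) ≤ D * mU ∧ mU ≤ D * mX ^ (1 / 4 : ℝ)

lemma isBlock_nil : IsBlock {[]} := ⟨by simp, by simp⟩

lemma cat_nil (X : Finset (List ℕ)) : cat X {[]} = X := by simp [cat]

lemma HasPrefix.cat {A : Finset ℕ} {c κ D V : ℝ} {H Ξ : Finset (List ℕ)}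
    (h : HasPrefix A c κ D V H) (hΞ : IsBlock Ξ) : HasPrefix A c κ D V (cat H Ξ) := by
  obtain ⟨X, U, Z, mX, mU, rfl, hX, hU, hZ, h⟩ := h
  exact ⟨X, U, _root_.cat Z Ξ, mX, mU, by simp only [cat_assoc], hX, hU, hZ.cat hΞ, h⟩

lemma IsUnif.cat {r r' : ℝ} {X Y : Finset (List ℕ)} (hX : IsUnif r X) (hY : IsUnif r' Y) :
    IsUnif (r * r') (cat X Y) := by
  intro v hv w hw i j
  obtain ⟨x, hx, y, hy, rfl⟩ := mem_cat.mp hv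
  obtain ⟨x', hx', y', hy', rfl⟩ := mem_cat.mp hw
  simp only [contMat_append, Matrix.mul_apply, Fin.sum_univ_two, Int.cast_add, Int.cast_mul]
  have key : ∀ k, (contMat x i k : ℝ) * contMat y k j
      ≤ r * r' * (contMat x' i k * contMat y' k j) := by
    intro k
    have p1 : (0 : ℝ) ≤ contMat x i k := by exact_mod_cast contMat_nonneg x i k
    have p2 : (0 : ℝ) ≤ contMat y k j := by exact_mod_cast contMat_nonneg y k j
    calc (contMat x i k : ℝ) * contMat y k j
        ≤ (r * contMat x' i k) * (r' * contMat y' k j) :=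
          mul_le_mul (hX x hx x' hx' i k) (hY y hy y' hy' k j) p2
            (p1.trans (hX x hx x' hx' i k))
      _ = _ := by ring
  linarith [key 0, key 1]

lemma IsUnif.mono {r r' : ℝ} {X : Finset (List ℕ)} (hX : IsUnif r X) (h : r ≤ r') :
    IsUnif r' X := fun v hv w hw i j => by
  have : (0 : ℝ) ≤ contMat w i j := by exact_mod_cast contMat_nonneg w i j
  exact (hX v hv w hw i j).trans (by gcongr)

lemma IsUnif.den_le {r : ℝ} {X : Finset (List ℕ)} (hX : IsUnif r X) {v w : List ℕ} (hv : v ∈ X)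
    (hw : w ∈ X) : (den v : ℝ) ≤ r * den w := by
  have := hX v hv w hw 1 1
  rwa [← den_cast, ← den_cast, Int.cast_natCast, Int.cast_natCast] at this

lemma distortion_step {l lr : ℝ} (hl : 4000 ≤ l) (hlr : l / 10 ≤ lr) :
    (1 - 1 / (1 + 4 / 5 * l)) / 2 + 1 / lr ^ 2 ≤ (1 - 1 / (1 + l)) / 2 := by
  have h1 : 1 / lr ^ 2 ≤ 100 / l ^ 2 := by
    rw [div_le_div_iff₀ (by have : 0 < lr := by linarith
                            positivity) (by positivity)]
    nlinarith
  have h2 : 100 / l ^ 2 ≤ 1 / (40 * l) := by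
    rw [div_le_div_iff₀ (by positivity) (by positivity)]
    nlinarith
  have h3 : 1 / (40 * l) ≤ (1 / (1 + 4 / 5 * l) - 1 / (1 + l)) / 2 := by
    rw [div_sub_div _ _ (by positivity) (by positivity), div_div,
      div_le_div_iff₀ (by positivity) (by positivity)]
    nlinarith
  linarith

/-- One step of the tower: appending a uniform block to a uniform block of scale
`L ^ (4 / 5)`. -/
lemma tower_step {A : Finset ℕ} {a c κ D L R₀ : ℝ} (ha : 1 ≤ a) (hc : 0 < c)
    (hca : c * (8 * a) ≤ 1) (hκ : 0 < κ) (hκ1 : κ ≤ 1) (hD : 4 ≤ D) (hcD : 1 ≤ D * c)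
    (hcD' : 1 ≤ D * c ^ (5 / 4 : ℝ))
    (hΞ : ∀ R, R₀ ≤ R → ∃ Ξ : Finset (List ℕ), (∀ w ∈ Ξ, w ∈ wordsAt A a R) ∧ IsBlock Ξ ∧
      IsUnif (Real.exp (1 / Real.log R ^ 2)) Ξ ∧ (4 * a * R) ^ (7 / 4 : ℝ) ≤ Ξ.card)
    (hL : 4000 ≤ Real.log L) (hL0 : 0 < L) (hLa : 10 * Real.log (4 * a) ≤ Real.log L)
    (hLR : 4 * a * R₀ ≤ L ^ (1 / 5 : ℝ)) {H : Finset (List ℕ)}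
    (hH : IsScale A c κ (L ^ (4 / 5 : ℝ)) H)
    (hU : IsUnif (Real.exp ((1 - 1 / (1 + Real.log (L ^ (4 / 5 : ℝ)))) / 2)) H)
    (hP : ∀ V, 1 ≤ V → V ≤ c * (L ^ (4 / 5 : ℝ)) ^ (4 / 5 : ℝ) → HasPrefix A c κ D V H) :
    ∃ H', IsScale A c κ L H' ∧ IsUnif (Real.exp ((1 - 1 / (1 + Real.log L)) / 2)) H' ∧
      ∀ V, 1 ≤ V → V ≤ c * L ^ (4 / 5 : ℝ) → HasPrefix A c κ D V H' := by
  set M := L ^ (4 / 5 : ℝ) with hM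
  have hM0 : 0 < M := by positivity
  have hlogM : Real.log M = 4 / 5 * Real.log L := by rw [hM, Real.log_rpow hL0]
  have hLM : L = M * L ^ (1 / 5 : ℝ) := by
    rw [hM, ← Real.rpow_add hL0]; norm_num
  have hM4 : M ^ (1 / 4 : ℝ) = L ^ (1 / 5 : ℝ) := by
    rw [hM, ← Real.rpow_mul hL0.le]; norm_num
  have hM54 : (M ^ (4 / 5 : ℝ)) ^ (5 / 4 : ℝ) = M := by
    rw [← Real.rpow_mul hM0.le]; norm_num
  have hne : H.Nonempty := by
    rw [← Finset.card_pos]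
    have : (0 : ℝ) < H.card := lt_of_lt_of_le (by positivity) hH.card
    exact_mod_cast this
  obtain ⟨w₀, hw₀⟩ := hne
  set m₀ : ℝ := ((den w₀ : ℕ) : ℝ) with hm₀
  have hm1 : c * M ≤ m₀ := hH.le_den _ hw₀
  have hm2 : m₀ ≤ M := hH.den_le _ hw₀
  have hm0 : 0 < m₀ := lt_of_lt_of_le (by positivity) hm1
  set R := L / (4 * a * m₀) with hR
  have hRm : 4 * a * R * m₀ = L := by rw [hR]; field_simp
  have hR1 : L ^ (1 / 5 : ℝ) / (4 * a) ≤ R := by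
    rw [hR, div_le_div_iff₀ (by positivity) (by positivity)]
    nth_rewrite 2 [hLM]
    calc L ^ (1 / 5 : ℝ) * (4 * a * m₀) ≤ L ^ (1 / 5 : ℝ) * (4 * a * M) := by gcongr
      _ = _ := by ring
  have hR0 : 0 < R := by positivity
  have hRR : R₀ ≤ R := by
    refine le_trans ?_ hR1
    rw [le_div_iff₀ (by positivity)]
    linarith
  have hlogR : Real.log L / 10 ≤ Real.log R := by
    have h1 := Real.log_le_log (by positivity) hR1
    rw [Real.log_div (by positivity) (by positivity), Real.log_rpow hL0] at h1
    linarith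
  obtain ⟨Ξ, hΞ1, hΞB, hΞU, hΞc⟩ := hΞ R hRR
  have hexp : Real.exp ((1 - 1 / (1 + Real.log M)) / 2) ≤ 2 := by
    have h1 : (1 - 1 / (1 + Real.log M)) / 2 ≤ 1 / 2 := by
      have : 0 ≤ 1 / (1 + Real.log M) := by rw [hlogM]; positivity
      linarith
    refine (Real.exp_le_exp.mpr h1).trans ?_
    have h2 : Real.exp (1 / 2) * Real.exp (1 / 2) = Real.exp 1 := by
      rw [← Real.exp_add]; norm_num
    have h3 := Real.exp_one_lt_d9
    nlinarith [Real.exp_pos (1 / 2)]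
  have hHden : ∀ h ∈ H, m₀ ≤ 2 * den h ∧ (den h : ℝ) ≤ 2 * m₀ := fun h hh =>
    ⟨(hU.mono hexp).den_le hw₀ hh, (hU.mono hexp).den_le hh hw₀⟩
  have hΞscale : IsScale A c κ (a * R) Ξ := by
    refine ⟨fun w hw => (hΞ1 w hw).1, hΞB, fun w hw => ?_, fun w hw => (hΞ1 w hw).2.2, ?_⟩
    · refine le_trans ?_ (hΞ1 w hw).2.1
      have : c * a ≤ 1 := by nlinarith
      nlinarith
    · refine le_trans ?_ hΞc
      calc κ * (a * R) ^ (7 / 4 : ℝ) ≤ 1 * (4 * a * R) ^ (7 / 4 : ℝ) := by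
            gcongr
            nlinarith
        _ = _ := one_mul _
  refine ⟨cat H Ξ, ⟨?_, hH.block.cat hΞB, ?_, ?_, ?_⟩, ?_, ?_⟩
  · intro w hw d hd
    obtain ⟨h, hh, x, hx, rfl⟩ := mem_cat.mp hw
    rcases List.mem_append.mp hd with hd | hd
    · exact hH.mem _ hh _ hd
    · exact (hΞ1 _ hx).1 _ hd
  · intro w hw
    obtain ⟨h, hh, x, hx, rfl⟩ := mem_cat.mp hw
    have h1 : (den h : ℝ) * den x ≤ den (h ++ x) := by
      exact_mod_cast (den_append_bounds (hH.block.zero_notMem _ hh) (hΞB.zero_notMem _ hx)).1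
    calc c * L = c * (8 * a) * (m₀ * R) / 2 := by rw [← hRm]; ring
      _ ≤ 1 * (m₀ * R) / 2 := by gcongr
      _ ≤ 1 * (2 * den h * den x) / 2 := by
        have := (hHden h hh).1
        have := (hΞ1 x hx).2.1
        gcongr
      _ = den h * den x := by ring
      _ ≤ _ := h1
  · intro w hw
    obtain ⟨h, hh, x, hx, rfl⟩ := mem_cat.mp hw
    have h1 : (den (h ++ x) : ℝ) ≤ 2 * (den h * den x) := by
      exact_mod_cast (den_append_bounds (hH.block.zero_notMem _ hh) (hΞB.zero_notMem _ hx)).2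
    have h2 := (hHden h hh).2
    have h3 := (hΞ1 x hx).2.2
    calc (den (h ++ x) : ℝ) ≤ 2 * (2 * m₀ * (a * R)) := h1.trans (by gcongr)
      _ = L := by rw [← hRm]; ring
  · rw [hH.block.card_cat]
    push_cast
    calc κ * L ^ (7 / 4 : ℝ) = κ * (m₀ ^ (7 / 4 : ℝ) * (4 * a * R) ^ (7 / 4 : ℝ)) := by
          rw [← Real.mul_rpow hm0.le (by positivity), ← hRm, mul_comm m₀]
      _ ≤ κ * (M ^ (7 / 4 : ℝ) * (4 * a * R) ^ (7 / 4 : ℝ)) := by gcongr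
      _ = κ * M ^ (7 / 4 : ℝ) * (4 * a * R) ^ (7 / 4 : ℝ) := by ring
      _ ≤ _ := mul_le_mul hH.card hΞc (by positivity) (Nat.cast_nonneg _)
  · refine (hU.cat hΞU).mono ?_
    rw [← Real.exp_add, hlogM]
    exact Real.exp_le_exp.mpr (distortion_step hL hlogR)
  · intro V hV1 hV
    rcases le_total V (c * M ^ (4 / 5 : ℝ)) with hle | hle
    · exact (hP V hV1 hle).cat hΞB
    · refine ⟨H, Ξ, {[]}, M, a * R, by rw [cat_nil], hH, hΞscale, isBlock_nil, ?_, ?_, ?_, ?_⟩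
      · refine hV.trans ?_
        have : c ≤ 1 := by
          have := mul_le_mul_of_nonneg_left ha hc.le
          linarith
        exact mul_le_of_le_one_left hM0.le this
      · calc M = 1 * M := (one_mul _).symm
          _ ≤ (D * c ^ (5 / 4 : ℝ)) * M := by gcongr
          _ = D * (c * M ^ (4 / 5 : ℝ)) ^ (5 / 4 : ℝ) := by
            rw [Real.mul_rpow hc.le (by positivity), hM54]; ring
          _ ≤ _ := by gcongr D * ?_ ^ (5 / 4 : ℝ)
      · rw [hM4]
        have : L ^ (1 / 5 : ℝ) ≤ 4 * (a * R) := by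
          rw [div_le_iff₀ (by positivity)] at hR1; linarith
        refine this.trans ?_
        gcongr
      · rw [hM4]
        refine le_of_mul_le_mul_right ?_ hm0
        have e : a * R * m₀ = L / 4 := by rw [← hRm]; ring
        rw [e]
        calc L / 4 ≤ L := by linarith
          _ = 1 * (M * L ^ (1 / 5 : ℝ)) := by rw [one_mul]; exact hLM
          _ ≤ (D * c) * (M * L ^ (1 / 5 : ℝ)) := by gcongr
          _ = D * L ^ (1 / 5 : ℝ) * (c * M) := by ring
          _ ≤ _ := by gcongr

open Filter in
lemma exists_tower {A : Finset ℕ} (hA : 0 ∉ A)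
    (hdim : ENNReal.ofReal ((7 : ℝ) / 8) < dimH (Eset A)) :
    ∃ c κ D : ℝ, 0 < c ∧ c ≤ 1 ∧ 0 < κ ∧ κ ≤ 1 ∧ 1 ≤ D ∧ ∀ L : ℝ, 1 ≤ L → ∃ H,
      IsScale A c κ L H ∧ ∀ V, 1 ≤ V → V ≤ c * L ^ (4 / 5 : ℝ) → HasPrefix A c κ D V H := by
  obtain ⟨R₀, hR₀⟩ := eventually_atTop.mp (eventually_exists_uniform_block hA hdim)
  set a : ℝ := ((A.sup id + 1 : ℕ) : ℝ) with ha_def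
  have ha : 1 ≤ a := by rw [ha_def]; exact_mod_cast (by omega)
  obtain ⟨B, hB⟩ := eventually_atTop.mp
    (((Real.tendsto_log_atTop.eventually_ge_atTop 4000).and
      (Real.tendsto_log_atTop.eventually_ge_atTop (10 * Real.log (4 * a)))).and
    (((tendsto_rpow_atTop (by norm_num : (0 : ℝ) < 1 / 5)).eventually_ge_atTop (4 * a * R₀)).and
      (eventually_gt_atTop 1)))
  have hB1 : 1 < B := (hB B le_rfl).2.2
  have hB0 : 0 < B := by linarith
  have hlogB : 0 < Real.log B := Real.log_pos hB1
  set c : ℝ := 1 / (8 * a * B) with hc_def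
  have hc : 0 < c := by positivity
  have hc1 : c ≤ 1 := by
    rw [hc_def, div_le_one (by positivity)]
    nlinarith
  have hca : c * (8 * a) ≤ 1 := by
    have : c * (8 * a) = 1 / B := by rw [hc_def]; field_simp
    rw [this, div_le_one hB0]; exact hB1.le
  have hcB : c * B ≤ 1 := by
    have : c * B = 1 / (8 * a) := by rw [hc_def]; field_simp
    rw [this, div_le_one (by positivity)]; linarith
  set κ : ℝ := B ^ (-(7 / 4) : ℝ) with hκ_def
  have hκ : 0 < κ := by positivity
  have hκ1 : κ ≤ 1 := Real.rpow_le_one_of_one_le_of_nonpos hB1.le (by norm_num)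
  set D : ℝ := 4 + 1 / c + 1 / c ^ (5 / 4 : ℝ) with hD_def
  have hi1 : 0 < 1 / c := by positivity
  have hi2 : 0 < 1 / c ^ (5 / 4 : ℝ) := by positivity
  have hcD : 1 ≤ D * c := by
    calc 1 = 1 / c * c := by field_simp
      _ ≤ D * c := by gcongr; linarith
  have hcD' : 1 ≤ D * c ^ (5 / 4 : ℝ) := by
    calc 1 = 1 / c ^ (5 / 4 : ℝ) * c ^ (5 / 4 : ℝ) := by field_simp
      _ ≤ D * c ^ (5 / 4 : ℝ) := by gcongr; linarith
  refine ⟨c, κ, D, hc, hc1, hκ, hκ1, by linarith, ?_⟩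
  have main : ∀ n : ℕ, ∀ L : ℝ, 1 ≤ L → Real.log L ≤ (5 / 4) ^ n * Real.log B →
      ∃ H, IsScale A c κ L H ∧ IsUnif (Real.exp ((1 - 1 / (1 + Real.log L)) / 2)) H ∧
        ∀ V, 1 ≤ V → V ≤ c * L ^ (4 / 5 : ℝ) → HasPrefix A c κ D V H := by
    have base : ∀ L : ℝ, 1 ≤ L → L ≤ B →
      ∃ H, IsScale A c κ L H ∧ IsUnif (Real.exp ((1 - 1 / (1 + Real.log L)) / 2)) H ∧
        ∀ V, 1 ≤ V → V ≤ c * L ^ (4 / 5 : ℝ) → HasPrefix A c κ D V H := by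
      intro L hL hLB
      refine ⟨{[]}, ⟨by simp, isBlock_nil, ?_, ?_, ?_⟩, ?_, ?_⟩
      · simp only [Finset.mem_singleton, forall_eq, den_nil, Nat.cast_one]
        nlinarith
      · simpa [den_nil] using hL
      · simp only [Finset.card_singleton, Nat.cast_one]
        calc κ * L ^ (7 / 4 : ℝ) ≤ κ * B ^ (7 / 4 : ℝ) := by gcongr
          _ = 1 := by rw [hκ_def, ← Real.rpow_add hB0]; norm_num
      · intro v hv w hw i j
        rw [Finset.mem_singleton] at hv hw
        subst hv hw
        have : (0 : ℝ) ≤ contMat [] i j := by exact_mod_cast contMat_nonneg [] i j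
        refine le_mul_of_one_le_left this (Real.one_le_exp ?_)
        have hl := Real.log_nonneg hL
        have : 1 / (1 + Real.log L) ≤ 1 := by rw [div_le_one (by positivity)]; linarith
        linarith
      · intro V hV1 hV
        exfalso
        have h1 : L ^ (4 / 5 : ℝ) < B :=
          calc L ^ (4 / 5 : ℝ) ≤ B ^ (4 / 5 : ℝ) := by gcongr
            _ < B ^ (1 : ℝ) := Real.rpow_lt_rpow_of_exponent_lt hB1 (by norm_num)
            _ = B := Real.rpow_one _
        nlinarith
    intro n
    induction n with
    | zero =>
      intro L hL hlog
      refine base L hL ?_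
      rw [pow_zero, one_mul] at hlog
      exact (Real.log_le_log_iff (by linarith) hB0).mp hlog
    | succ n ih =>
      intro L hL hlog
      have hL0 : 0 < L := by linarith
      rcases le_total L B with hLB | hLB
      · exact base L hL hLB
      · obtain ⟨⟨b1, b2⟩, b3, -⟩ := hB L hLB
        obtain ⟨H, h1, h2, h3⟩ := ih (L ^ (4 / 5 : ℝ)) (Real.one_le_rpow hL (by norm_num))
          (by rw [Real.log_rpow hL0, pow_succ] at *; linarith)
        exact tower_step ha hc hca hκ hκ1 (by linarith) hcD hcD' hR₀ b1 hL0 b2 b3 h1 h2 h3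
  intro L hL
  obtain ⟨n, hn⟩ := ((tendsto_pow_atTop_atTop_of_one_lt
    (by norm_num : (1 : ℝ) < 5 / 4)).eventually_ge_atTop (Real.log L / Real.log B)).exists
  rw [div_le_iff₀ hlogB] at hn
  obtain ⟨H, h1, -, h3⟩ := main n L hL hn
  exact ⟨H, h1, h3⟩

/-- The set of reversed words. -/
def rev (X : Finset (List ℕ)) : Finset (List ℕ) := X.image List.reverse

lemma mem_rev {X : Finset (List ℕ)} {w : List ℕ} : w ∈ rev X ↔ ∃ x ∈ X, x.reverse = w := by
  simp [rev]

lemma card_rev (X : Finset (List ℕ)) : (rev X).card = X.card :=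
  Finset.card_image_of_injective _ List.reverse_injective

lemma rev_cat (X Y : Finset (List ℕ)) : rev (cat X Y) = cat (rev Y) (rev X) :=
  Finset.image_image₂_antidistrib fun _ _ => List.reverse_append

lemma IsBlock.rev {X : Finset (List ℕ)} (h : IsBlock X) : IsBlock (rev X) := by
  constructor
  · intro w hw
    obtain ⟨x, hx, rfl⟩ := mem_rev.mp hw
    simpa using h.zero_notMem x hx
  · intro w hw w' hw'
    obtain ⟨x, hx, rfl⟩ := mem_rev.mp hw
    obtain ⟨x', hx', rfl⟩ := mem_rev.mp hw'
    simpa using h.length_eq x hx x' hx'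

lemma IsScale.rev {A : Finset ℕ} {c κ m : ℝ} {X : Finset (List ℕ)} (h : IsScale A c κ m X) :
    IsScale A c κ m (rev X) := by
  refine ⟨fun w hw => ?_, h.block.rev, fun w hw => ?_, fun w hw => ?_, by
    rw [card_rev]; exact h.card⟩
  all_goals obtain ⟨x, hx, rfl⟩ := mem_rev.mp hw
  · simpa using h.mem x hx
  · rw [den_reverse]; exact h.le_den x hx
  · rw [den_reverse]; exact h.den_le x hx

lemma IsScale.cat {A : Finset ℕ} {c κ m n : ℝ} {X Y : Finset (List ℕ)} (hc : 0 < c) (hκ : 0 < κ)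
    (hm : 0 < m) (hn : 0 < n) (hX : IsScale A c κ m X) (hY : IsScale A c κ n Y) :
    IsScale A (c ^ 2 / 2) (κ ^ 2 / 4) (2 * m * n) (cat X Y) := by
  refine ⟨fun w hw d hd => ?_, hX.block.cat hY.block, fun w hw => ?_, fun w hw => ?_, ?_⟩
  · obtain ⟨x, hx, y, hy, rfl⟩ := mem_cat.mp hw
    rcases List.mem_append.mp hd with hd | hd
    · exact hX.mem _ hx _ hd
    · exact hY.mem _ hy _ hd
  · obtain ⟨x, hx, y, hy, rfl⟩ := mem_cat.mp hw
    have h1 : (den x : ℝ) * den y ≤ den (x ++ y) := by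
      exact_mod_cast
        (den_append_bounds (hX.block.zero_notMem _ hx) (hY.block.zero_notMem _ hy)).1
    calc c ^ 2 / 2 * (2 * m * n) = (c * m) * (c * n) := by ring
      _ ≤ den x * den y :=
        mul_le_mul (hX.le_den x hx) (hY.le_den y hy) (by positivity) (by positivity)
      _ ≤ _ := h1
  · obtain ⟨x, hx, y, hy, rfl⟩ := mem_cat.mp hw
    have h1 : (den (x ++ y) : ℝ) ≤ 2 * (den x * den y) := by
      exact_mod_cast
        (den_append_bounds (hX.block.zero_notMem _ hx) (hY.block.zero_notMem _ hy)).2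
    have := mul_le_mul (hX.den_le x hx) (hY.den_le y hy) (by positivity) hm.le
    linarith
  · rw [hX.block.card_cat]
    push_cast
    have h2 : (2 : ℝ) ^ (7 / 4 : ℝ) ≤ 4 :=
      calc (2 : ℝ) ^ (7 / 4 : ℝ) ≤ 2 ^ (2 : ℝ) :=
            Real.rpow_le_rpow_of_exponent_le (by norm_num) (by norm_num)
        _ = 4 := by norm_num
    calc κ ^ 2 / 4 * (2 * m * n) ^ (7 / 4 : ℝ)
        = κ ^ 2 / 4 * (2 ^ (7 / 4 : ℝ) * m ^ (7 / 4 : ℝ) * n ^ (7 / 4 : ℝ)) := by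
          rw [Real.mul_rpow (by positivity) hn.le, Real.mul_rpow (by positivity) hm.le]
      _ ≤ κ ^ 2 / 4 * (4 * m ^ (7 / 4 : ℝ) * n ^ (7 / 4 : ℝ)) := by gcongr
      _ = (κ * m ^ (7 / 4 : ℝ)) * (κ * n ^ (7 / 4 : ℝ)) := by ring
      _ ≤ _ := mul_le_mul hX.card hY.card (by positivity) (Nat.cast_nonneg _)

lemma IsScale.le_mul_den {A : Finset ℕ} {c κ m C : ℝ} {X : Finset (List ℕ)}
    (h : IsScale A c κ m X) (hm : 0 ≤ m) (hC : 0 ≤ C) (hCc : 1 ≤ C * c) :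
    ∀ x ∈ X, m ≤ C * den x := fun x hx => by
  calc m = 1 * m := (one_mul m).symm
    _ ≤ C * c * m := by gcongr
    _ = C * (c * m) := by ring
    _ ≤ _ := by have := h.le_den x hx; gcongr

lemma IsScale.le_mul_card {A : Finset ℕ} {c κ m C : ℝ} {X : Finset (List ℕ)}
    (h : IsScale A c κ m X) (hm : 0 ≤ m) (hC : 0 ≤ C) (hCκ : 1 ≤ C * κ) :
    m ^ (7 / 4 : ℝ) ≤ C * X.card := by
  calc m ^ (7 / 4 : ℝ) = 1 * m ^ (7 / 4 : ℝ) := (one_mul _).symm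
    _ ≤ C * κ * m ^ (7 / 4 : ℝ) := by gcongr
    _ = C * (κ * m ^ (7 / 4 : ℝ)) := by ring
    _ ≤ _ := by have := h.card; gcongr

lemma isMinorSplit_of_hasPrefix {A : Finset ℕ} {c κ D C C' : ℝ} {N : ℕ}
    {H Y : Finset (List ℕ)} (hC : 0 ≤ C) (hCc : 1 ≤ C * c)
    (hCD : D * 2 ^ (5 / 4 : ℝ) ≤ C') (hN : 1 ≤ N)
    (hN' : 4 * C' * (N : ℝ) ^ (25 / 32 : ℝ) ≤ N) (hY : IsBlock Y)
    (hcard : (N : ℝ) ^ (7 / 4 : ℝ) ≤ C * (cat H Y).card)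
    (h : HasPrefix A c κ D (2 * (N : ℝ) ^ (5 / 8 : ℝ)) H) :
    ∃ m X Y', IsMinorSplit C C' N m (cat H Y) X Y' := by
  obtain ⟨X, U, Z, mX, mU, rfl, hX, hU, hZ, h1, h2, -⟩ := h
  have hN1 : (1 : ℝ) ≤ N := by exact_mod_cast hN
  have hN58 : (1 : ℝ) ≤ (N : ℝ) ^ (5 / 8 : ℝ) := Real.one_le_rpow hN1 (by norm_num)
  have hmX : 0 ≤ mX := by linarith
  have hfl := Nat.floor_le hmX
  have hm : (⌊mX⌋₊ : ℝ) ≤ C' * (N : ℝ) ^ (25 / 32 : ℝ) := by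
    refine hfl.trans (h2.trans ?_)
    rw [Real.mul_rpow (by norm_num) (by positivity), ← Real.rpow_mul (by positivity),
      ← mul_assoc]
    norm_num only
    gcongr
  refine ⟨⌊mX⌋₊, X, cat (cat U Z) Y, cat_assoc _ _ _, hX.block, (hU.block.cat hZ).cat hY,
    fun x hx => Nat.le_floor (hX.den_le x hx),
    fun x hx => hfl.trans (hX.le_mul_den hmX hC hCc x hx), hcard, ?_, hm, ?_⟩
  · have := Nat.sub_one_lt_floor mX
    linarith
  · have : (4 * ⌊mX⌋₊ : ℝ) ≤ N := by linarith
    exact_mod_cast this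

lemma isSplit_of_hasPrefix {A : Finset ℕ} {c κ D C K : ℝ} {N T : ℕ}
    {H₁ H₂ : Finset (List ℕ)} (hC : 1 ≤ C) (hD : 1 ≤ D) (hCc : 1 ≤ C * c) (hCκ : 1 ≤ C * κ)
    (hK : K = D * (10 * C) ^ (5 / 4 : ℝ)) (hT : 1 ≤ T) (hN : 4 * K * (T : ℝ) ^ (5 / 2 : ℝ) ≤ N)
    (h₁ : HasPrefix A c κ D (10 * C * (T : ℝ) ^ 2) H₁)
    (h₂ : HasPrefix A c κ D ((T : ℝ) ^ (1 / 2 : ℝ)) H₂) :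
    ∃ m mU mW X U Z W, IsSplit C (D * K) N T m mU mW (cat H₁ (rev H₂)) X U Z W := by
  obtain ⟨X, U, Z, mX, mU, rfl, hX, hU, hZ, h1, h2, h3, h4⟩ := h₁
  obtain ⟨X', U', Z', mW, mU', rfl, hX', hU', hZ', h1', h2', -⟩ := h₂
  have hC0 : 0 ≤ C := by linarith
  have hD0 : 0 ≤ D := by linarith
  have hT1 : (1 : ℝ) ≤ T := by exact_mod_cast hT
  have hT0 : (0 : ℝ) < T := by linarith
  have hKD : D ≤ K := by
    rw [hK]
    exact le_mul_of_one_le_right hD0 (Real.one_le_rpow (by linarith) (by norm_num))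
  have hK1 : 1 ≤ K := hD.trans hKD
  have hDK : K ≤ D * K := le_mul_of_one_le_left (by linarith) hD
  have hCT : 1 ≤ C * (T : ℝ) ^ 2 := one_le_mul_of_one_le_of_one_le hC (one_le_pow₀ hT1)
  have hmX : 0 ≤ mX := by linarith
  have hfl := Nat.floor_le hmX
  have hmXK : mX ≤ K * (T : ℝ) ^ (5 / 2 : ℝ) := by
    refine h2.trans (le_of_eq ?_)
    rw [Real.mul_rpow (by positivity) (by positivity), ← Real.rpow_natCast,
      ← Real.rpow_mul hT0.le, hK]
    norm_num
    ring
  have hm : (⌊mX⌋₊ : ℝ) ≤ K * (T : ℝ) ^ (5 / 2 : ℝ) := hfl.trans hmXK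
  have hTmX : (T : ℝ) ^ (1 / 2 : ℝ) ≤ mX ^ (1 / 4 : ℝ) := by
    have : (T : ℝ) ^ (1 / 2 : ℝ) = ((T : ℝ) ^ 2) ^ (1 / 4 : ℝ) := by
      rw [← Real.rpow_natCast, ← Real.rpow_mul hT0.le]; norm_num
    rw [this]
    gcongr
    nlinarith [sq_nonneg (T : ℝ)]
  have hTsq : (T : ℝ) = ((T : ℝ) ^ (1 / 2 : ℝ)) ^ 2 := by
    rw [← Real.rpow_natCast, ← Real.rpow_mul hT0.le]; norm_num
  have hT12 : 0 < (T : ℝ) ^ (1 / 2 : ℝ) := by positivity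
  have hmU : 0 < mU := pos_of_mul_pos_right (hT12.trans_le (hTmX.trans h3)) hD0
  have hmW : 0 < mW := hT12.trans_le h1'
  have hCK : 0 < D * K := by positivity
  refine ⟨⌊mX⌋₊, mU, mW, X, U, cat Z (rev (cat U' Z')), rev X', ?_, hX.block, hU.block,
    hZ.cat (hU'.block.cat hZ').rev, hX'.block.rev, fun x hx => Nat.le_floor (hX.den_le x hx),
    fun x hx => hfl.trans (hX.le_mul_den hmX hC0 hCc x hx), hU.den_le,
    hU.le_mul_den hmU.le hC0 hCc, hX'.rev.den_le, ?_, hU.le_mul_card hmU.le hC0 hCκ,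
    hX'.rev.le_mul_card hmW.le hC0 hCκ, ?_, ?_, ?_, ?_, ?_, ?_, hmU, hmW, ?_⟩
  · simp only [rev_cat, cat_assoc]
  · refine le_trans ?_ (hX.le_mul_card hmX hC0 hCκ)
    gcongr
  · have := Nat.sub_one_lt_floor mX
    linarith
  · exact hm.trans (by gcongr)
  · calc (T : ℝ) = ((T : ℝ) ^ (1 / 2 : ℝ)) ^ 2 := hTsq
      _ ≤ (D * mU) ^ 2 := by have := hTmX.trans h3; gcongr
      _ = D * D * mU ^ 2 := by ring
      _ ≤ _ := by gcongr
  · have h5 : mX ^ (1 / 4 : ℝ) ≤ K * (T : ℝ) ^ (5 / 8 : ℝ) := by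
      calc mX ^ (1 / 4 : ℝ) ≤ (K * (T : ℝ) ^ (5 / 2 : ℝ)) ^ (1 / 4 : ℝ) := by gcongr
        _ = K ^ (1 / 4 : ℝ) * (T : ℝ) ^ (5 / 8 : ℝ) := by
          rw [Real.mul_rpow (by positivity) (by positivity), ← Real.rpow_mul hT0.le]
          norm_num
        _ ≤ K ^ (1 : ℝ) * (T : ℝ) ^ (5 / 8 : ℝ) := by
          have := Real.rpow_le_rpow_of_exponent_le hK1 (by norm_num : (1 / 4 : ℝ) ≤ 1)
          gcongr
        _ = _ := by rw [Real.rpow_one]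
    calc mU ≤ D * mX ^ (1 / 4 : ℝ) := h4
      _ ≤ D * (K * (T : ℝ) ^ (5 / 8 : ℝ)) := by gcongr
      _ = _ := by ring
  · calc (T : ℝ) = ((T : ℝ) ^ (1 / 2 : ℝ)) ^ 2 := hTsq
      _ ≤ mW ^ 2 := by gcongr
      _ = 1 * mW ^ 2 := (one_mul _).symm
      _ ≤ _ := by have := hK1.trans hDK; gcongr
  · refine h2'.trans ?_
    rw [← Real.rpow_mul hT0.le]
    norm_num only
    have := hKD.trans hDK
    gcongr
  · have : (4 * ⌊mX⌋₊ : ℝ) ≤ N := by linarith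
    exact_mod_cast this

lemma cfValue_eq {w : List ℕ} (hw : 0 ∉ w) : cfValue w = (num w : ℚ) / den w := by
  induction w with
  | nil => simp [cfValue, num_nil]
  | cons d w ih =>
    rw [List.mem_cons, not_or] at hw
    have h0 : (den w : ℚ) ≠ 0 := by
      have := one_le_den hw.2
      exact_mod_cast (by omega : den w ≠ 0)
    rw [cfValue, ih hw.2, num_cons, den_cons]
    push_cast
    rw [← one_div_div _ (den w : ℚ), add_div, mul_div_cancel_right₀ _ h0, add_comm]

lemma den_mem_Dset {A : Finset ℕ} (hA : 0 ∉ A) {w : List ℕ} (hw : ∀ d ∈ w, d ∈ A) {N : ℕ}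
    (hN : den w ≤ N) (h1 : 1 < den w) : den w ∈ Dset A N := by
  refine ⟨hN, num w, coprime_num_den w, w, ?_, hw, cfValue_eq fun h => hA (hw 0 h)⟩
  rintro rfl
  simp [den_nil] at h1

lemma card_image_den_le_ncard_Dset {A : Finset ℕ} (hA : 0 ∉ A) {N : ℕ} {Ω : Finset (List ℕ)}
    (hΩ : ∀ w ∈ Ω, (∀ d ∈ w, d ∈ A) ∧ den w ≤ N ∧ 1 < den w) :
    (Ω.image den).card ≤ (Dset A N).ncard := by
  rw [← Set.ncard_coe_finset]
  refine Set.ncard_le_ncard ?_ ((Set.finite_Iic N).subset fun d hd => hd.1)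
  intro d hd
  obtain ⟨w, hw, rfl⟩ := Finset.mem_image.mp (Finset.mem_coe.mp hd)
  obtain ⟨h1, h2, h3⟩ := hΩ w hw
  exact den_mem_Dset hA h1 h2 h3

open Filter in
lemma eventually_mul_rpow_le (a : ℝ) {s t : ℝ} (h : s < t) :
    ∀ᶠ N : ℕ in atTop, a * (N : ℝ) ^ s ≤ (N : ℝ) ^ t := by
  have h1 : ∀ᶠ x : ℝ in atTop, a * x ^ s ≤ x ^ t := by
    filter_upwards [(tendsto_rpow_atTop (sub_pos.mpr h)).eventually_ge_atTop a,
      eventually_gt_atTop 0] with x hx hx0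
    calc a * x ^ s ≤ x ^ (t - s) * x ^ s := by gcongr
      _ = x ^ t := by rw [← Real.rpow_add hx0]; ring_nf
  exact tendsto_natCast_atTop_atTop.eventually h1

theorem positive_proportion_of_dimH_gt
    (A : Finset ℕ) (hcard : 2 ≤ A.card) (hpos : 0 ∉ A)
    (hdim : ENNReal.ofReal ((7 : ℝ) / 8) < dimH (Eset A)) :
    ∃ c : ℝ, 0 < c ∧ ∃ N₀ : ℕ, ∀ N : ℕ, N₀ ≤ N →
      c * (N : ℝ) ≤ ((Dset A N).ncard : ℝ) := by
  obtain ⟨c, κ, D, hc, hc1, hκ, hκ1, hD, htower⟩ := exists_tower hpos hdim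
  obtain ⟨C, hC_def⟩ : ∃ C, C = 2 / c ^ 2 + 4 / κ ^ 2 := ⟨_, rfl⟩
  have hCc2 : 1 ≤ C * (c ^ 2 / 2) := by
    calc 1 = 2 / c ^ 2 * (c ^ 2 / 2) := by field_simp
      _ ≤ C * (c ^ 2 / 2) := by
        rw [hC_def]; gcongr; exact le_add_of_nonneg_right (by positivity)
  have hCκ2 : 1 ≤ C * (κ ^ 2 / 4) := by
    calc 1 = 4 / κ ^ 2 * (κ ^ 2 / 4) := by field_simp
      _ ≤ C * (κ ^ 2 / 4) := by
        rw [hC_def]; gcongr; exact le_add_of_nonneg_left (by positivity)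
  have hC0 : 0 < C := by rw [hC_def]; positivity
  have hCc : 1 ≤ C * c := hCc2.trans (by gcongr; nlinarith)
  have hCκ : 1 ≤ C * κ := hCκ2.trans (by gcongr; nlinarith)
  have hC : 1 ≤ C := hCc.trans (mul_le_of_le_one_right hC0.le hc1)
  obtain ⟨K, hK⟩ : ∃ K, K = D * (10 * C) ^ (5 / 4 : ℝ) := ⟨_, rfl⟩
  have hK0 : 0 < K := by rw [hK]; positivity
  have h2K : D * 2 ^ (5 / 4 : ℝ) ≤ K := by
    rw [hK]; gcongr; linarith
  have hKDK : K ≤ D * K := le_mul_of_one_le_left hK0.le hD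
  have hC' : 1 ≤ D * K := by
    refine le_trans ?_ (h2K.trans hKDK)
    exact one_le_mul_of_one_le_of_one_le hD (Real.one_le_rpow (by norm_num) (by norm_num))
  have hE := energyConst_pos hC hC'
  refine ⟨(energyConst C (D * K))⁻¹, inv_pos.mpr hE, ?_⟩
  rw [← Filter.eventually_atTop (p := fun N : ℕ =>
    (energyConst C (D * K))⁻¹ * (N : ℝ) ≤ ((Dset A N).ncard : ℝ))]
  filter_upwards [eventually_mul_rpow_le C (by norm_num : (0 : ℝ) < 1 / 4),
    eventually_mul_rpow_le 2 (by norm_num : (0 : ℝ) < 4 / 5),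
    eventually_mul_rpow_le (80 * C / c) (by norm_num : (1 / 2 : ℝ) < 16 / 25),
    eventually_mul_rpow_le (2 / c) (by norm_num : (1 / 8 : ℝ) < 4 / 25),
    eventually_mul_rpow_le (4 / c) (by norm_num : (5 / 8 : ℝ) < 16 / 25),
    eventually_mul_rpow_le (4 * (D * K)) (by norm_num : (25 / 32 : ℝ) < 1),
    eventually_mul_rpow_le (24 * K) (by norm_num : (5 / 8 : ℝ) < 1),
    eventually_mul_rpow_le (2 * C) (by norm_num : (0 : ℝ) < 1),
    Filter.eventually_ge_atTop 1] with N e1 e2 e3 e4 e5 e6 e7 e8 hN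
  have hN1 : (1 : ℝ) ≤ N := by exact_mod_cast hN
  have hN0 : (0 : ℝ) < N := zero_lt_one.trans_le hN1
  rw [Real.rpow_zero, mul_one] at e1 e2 e8
  rw [Real.rpow_one] at e6 e7 e8
  obtain ⟨L, hL⟩ : ∃ L, L = (N : ℝ) ^ (4 / 5 : ℝ) / 2 := ⟨_, rfl⟩
  have hL1 : 1 ≤ L := by rw [hL]; linarith
  have hLpow : (N : ℝ) ^ (16 / 25 : ℝ) / 2 ≤ L ^ (4 / 5 : ℝ) := by
    rw [hL, Real.div_rpow (by positivity) (by norm_num), ← Real.rpow_mul hN0.le]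
    norm_num only
    gcongr
    calc (2 : ℝ) ^ (4 / 5 : ℝ) ≤ 2 ^ (1 : ℝ) :=
          Real.rpow_le_rpow_of_exponent_le (by norm_num) (by norm_num)
      _ = 2 := Real.rpow_one 2
  have hM1 : 1 ≤ (N : ℝ) ^ (1 / 5 : ℝ) := Real.one_le_rpow hN1 (by norm_num)
  have hMpow : ((N : ℝ) ^ (1 / 5 : ℝ)) ^ (4 / 5 : ℝ) = (N : ℝ) ^ (4 / 25 : ℝ) := by
    rw [← Real.rpow_mul hN0.le]; norm_num
  have hLM : 2 * L * (N : ℝ) ^ (1 / 5 : ℝ) = N := by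
    have : (N : ℝ) ^ (4 / 5 : ℝ) * (N : ℝ) ^ (1 / 5 : ℝ) = N := by
      rw [← Real.rpow_add hN0]; norm_num
    rw [hL]; linarith
  obtain ⟨H₁, hH₁, hP₁⟩ := htower L hL1
  obtain ⟨H₂, hH₂, hP₂⟩ := htower _ hM1
  have hΩ := hH₁.cat hc hκ (by linarith) (by linarith) hH₂.rev
  rw [hLM] at hΩ
  have hΩle := hΩ.le_mul_den hN0.le hC0.le hCc2
  have hΩcard := hΩ.le_mul_card hN0.le hC0.le hCκ2
  have hden : ∀ w ∈ cat H₁ (rev H₂), den w ≤ N := fun w hw => by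
    exact_mod_cast hΩ.den_le w hw
  have key := card_image_den_ge hC hC' hN e1 (fun w hw => ⟨hden w hw, hΩle w hw⟩) ?_ ?_
  · rw [inv_mul_le_iff₀ hE]
    refine key.trans ?_
    gcongr
    refine card_image_den_le_ncard_Dset hpos fun w hw => ⟨hΩ.mem w hw, hden w hw, ?_⟩
    have h1 := e8.trans (hΩle w hw)
    rw [mul_comm 2 C] at h1
    have h2 := le_of_mul_le_mul_left h1 hC0
    have h3 : 2 ≤ den w := by exact_mod_cast h2
    omega
  · refine isMinorSplit_of_hasPrefix hC0.le hCc (h2K.trans hKDK) hN e6 hH₂.block.rev hΩcard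
      (hP₁ _ ?_ ?_)
    · have : (1 : ℝ) ≤ (N : ℝ) ^ (5 / 8 : ℝ) := Real.one_le_rpow hN1 (by norm_num)
      linarith
    · calc 2 * (N : ℝ) ^ (5 / 8 : ℝ) = c * ((4 / c * (N : ℝ) ^ (5 / 8 : ℝ)) / 2) := by
            field_simp; ring
        _ ≤ c * ((N : ℝ) ^ (16 / 25 : ℝ) / 2) := by gcongr
        _ ≤ _ := by gcongr
  · intro T hT hTN
    have hT1 : (1 : ℝ) ≤ T := by exact_mod_cast hT
    have hCT : 1 ≤ C * (T : ℝ) ^ 2 := one_le_mul_of_one_le_of_one_le hC (one_le_pow₀ hT1)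
    refine isSplit_of_hasPrefix hC hD hCc hCκ hK hT ?_ (hP₁ _ ?_ ?_) (hP₂ _ ?_ ?_)
    · have h6 : (2 : ℝ) ^ (5 / 2 : ℝ) ≤ 6 := by
        have h7 : ((2 : ℝ) ^ (5 / 2 : ℝ)) ^ 2 = 32 := by
          rw [← Real.rpow_natCast, ← Real.rpow_mul (by norm_num)]; norm_num
        nlinarith
      calc 4 * K * (T : ℝ) ^ (5 / 2 : ℝ)
          ≤ 4 * K * (2 * (N : ℝ) ^ (1 / 4 : ℝ)) ^ (5 / 2 : ℝ) := by gcongr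
        _ = 4 * K * (2 ^ (5 / 2 : ℝ) * (N : ℝ) ^ (5 / 8 : ℝ)) := by
          rw [Real.mul_rpow (by norm_num) (by positivity), ← Real.rpow_mul hN0.le]
          norm_num
        _ ≤ 4 * K * (6 * (N : ℝ) ^ (5 / 8 : ℝ)) := by gcongr
        _ = 24 * K * (N : ℝ) ^ (5 / 8 : ℝ) := by ring
        _ ≤ N := e7
    · linarith
    · calc 10 * C * (T : ℝ) ^ 2 ≤ 10 * C * (2 * (N : ℝ) ^ (1 / 4 : ℝ)) ^ 2 := by gcongr
        _ = c * ((80 * C / c * (N : ℝ) ^ (1 / 2 : ℝ)) / 2) := by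
          have : ((N : ℝ) ^ (1 / 4 : ℝ)) ^ 2 = (N : ℝ) ^ (1 / 2 : ℝ) := by
            rw [← Real.rpow_natCast, ← Real.rpow_mul hN0.le]; norm_num
          rw [mul_pow, this]; field_simp; ring
        _ ≤ c * ((N : ℝ) ^ (16 / 25 : ℝ) / 2) := by gcongr
        _ ≤ _ := by gcongr
    · exact Real.one_le_rpow hT1 (by norm_num)
    · rw [hMpow]
      calc (T : ℝ) ^ (1 / 2 : ℝ) ≤ (2 * (N : ℝ) ^ (1 / 4 : ℝ)) ^ (1 / 2 : ℝ) := by gcongr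
        _ = 2 ^ (1 / 2 : ℝ) * (N : ℝ) ^ (1 / 8 : ℝ) := by
          rw [Real.mul_rpow (by norm_num) (by positivity), ← Real.rpow_mul hN0.le]
          norm_num
        _ ≤ 2 ^ (1 : ℝ) * (N : ℝ) ^ (1 / 8 : ℝ) := by
          have := Real.rpow_le_rpow_of_exponent_le (by norm_num : (1 : ℝ) ≤ 2)
            (by norm_num : (1 / 2 : ℝ) ≤ 1)
          gcongr
        _ = c * (2 / c * (N : ℝ) ^ (1 / 8 : ℝ)) := by rw [Real.rpow_one]; field_simp
        _ ≤ _ := by gcongr
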